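/- Let ℓ be a prime and let K be a function field over an algebraically closed field k with char k ≠ ℓ and trdeg(K|k) ≥ 4, and let A be a subgroup of k^M_1(K). Then A ∈ 𝔊^1(K|k) if and only if A ∈ 𝔐^1(K) and there exist D ∈ 𝔊^1_rat(K|k), B_1, B_2, E ∈ 𝔊^2(K|k), and B_1', B_2', C ∈ 𝔊^3(K|k) such that: (a) B_1 ≠ B_2 and D ⊄ C; (b) B_1 ∪ B_2 ⊆ C; (c) B_1 ∪ D ⊆ B_1' and B_2 ∪ D ⊆ B_2'; (d) E ⊆ B_1' ∩ B_2'; (e) A = B_1 ∩ B_2. -/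

import Mathlib

/-! Common definitions: mod-ℓ Milnor K-theory, K^×/(K^×)^ℓ, Ω_K, relative algebraic
closure, transcendence degree predicates, discrete valuations, etc. -/

noncomputable section

open scoped TensorProduct

universe u v

/-- The `n`-fold tensor power (over `ℤ`) of the multiplicative group `Kˣ`,
written additively. -/
abbrev MilnorPre (n : ℕ) (K : Type*) [Field K] : Type _ :=
  PiTensorProduct ℤ (fun _ : Fin n => Additive Kˣ)

/-- The submodule of Steinberg relations: generated by all `a₁ ⊗ ⋯ ⊗ aₙ`
with `aᵢ + aⱼ = 1` for some `i < j`. -/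
def SteinbergRel (n : ℕ) (K : Type*) [Field K] : Submodule ℤ (MilnorPre n K) :=
  Submodule.span ℤ
    {x | ∃ a : Fin n → Kˣ,
      (∃ i j : Fin n, i < j ∧ ((a i : K) + (a j : K) = 1)) ∧
        x = PiTensorProduct.tprod ℤ (fun i => Additive.ofMul (a i))}

/-- The `n`-th Milnor K-group `K^M_n(K)`: the quotient of the `n`-fold tensor
power of `K^×` by the Steinberg relations. -/
abbrev MilnorK (n : ℕ) (K : Type*) [Field K] : Type _ :=
  MilnorPre n K ⧸ SteinbergRel n K

/-- The mod-`ℓ` Milnor K-group `k^M_n(K) = K^M_n(K)/ℓ`. -/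
abbrev MilnorKMod (ℓ n : ℕ) (K : Type*) [Field K] : Type _ :=
  MilnorK n K ⧸ LinearMap.range ((ℓ : ℤ) • (LinearMap.id : MilnorK n K →ₗ[ℤ] MilnorK n K))

/-- The symbol `{a₁, …, aₙ}` in `k^M_n(K)`. -/
def milnorSymbol (ℓ : ℕ) {n : ℕ} {K : Type*} [Field K] (a : Fin n → Kˣ) :
    MilnorKMod ℓ n K :=
  Submodule.Quotient.mk (Submodule.Quotient.mk
    (PiTensorProduct.tprod ℤ (fun i => Additive.ofMul (a i))))

/-- `k^M_1(K) = K^×/(K^×)^ℓ`, written multiplicatively. -/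
abbrev K1 (ℓ : ℕ) (K : Type*) [Field K] : Type _ :=
  Kˣ ⧸ (powMonoidHom ℓ : Kˣ →* Kˣ).range

/-- The projection `K^× → K^×/(K^×)^ℓ`. -/
def K1proj (ℓ : ℕ) (K : Type*) [Field K] : Kˣ →* K1 ℓ K :=
  QuotientGroup.mk' _

/-- The subgroup of `Kˣ` consisting of the units lying in an intermediate field `L`. -/
def fieldUnits {k K : Type*} [Field k] [Field K] [Algebra k K]
    (L : IntermediateField k K) : Subgroup Kˣ where
  carrier := {x : Kˣ | (x : K) ∈ L}
  one_mem' := by simpa using one_mem L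
  mul_mem' := by
    intro a b ha hb
    simpa using mul_mem ha hb
  inv_mem' := by
    intro a ha
    simpa using inv_mem (show (a : K) ∈ L from ha)

/-- `Ω_K(L)`: the image of `L^×` in `K^×/(K^×)^ℓ`. -/
def Omega (ℓ : ℕ) {k K : Type*} [Field k] [Field K] [Algebra k K]
    (L : IntermediateField k K) : Subgroup (K1 ℓ K) :=
  (fieldUnits L).map (K1proj ℓ K)

/-- A subextension `L` of `K|k` is relatively algebraically closed in `K` if every
element of `K` algebraic over `L` lies in `L`. -/
def RelAlgClosed {k K : Type*} [Field k] [Field K] [Algebra k K]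
    (L : IntermediateField k K) : Prop :=
  ∀ x : K, IsAlgebraic L x → x ∈ L

/-- `K` is a function field over `k`: a finitely generated field extension. -/
def IsFunctionField (k K : Type*) [Field k] [Field K] [Algebra k K] : Prop :=
  ∃ s : Finset K, IntermediateField.adjoin k (s : Set K) = ⊤

/-- `trdeg(K|k) = d`: there is a transcendence basis indexed by `Fin d`. -/
def HasTrdeg (k : Type*) (K : Type*) [Field k] [Field K] [Algebra k K] (d : ℕ) : Prop :=
  ∃ x : Fin d → K, IsTranscendenceBasis k x

/-- `trdeg(K|k) ≥ m`: there are `m` algebraically independent elements. -/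
def TrdegGe (k : Type*) (K : Type*) [Field k] [Field K] [Algebra k K] (m : ℕ) : Prop :=
  ∃ x : Fin m → K, AlgebraicIndependent k x

/-- `dim^M_K(S) ≥ d` for a subset `S ⊆ k^M_1(K)`: there are `s₁, …, s_d ∈ S` with
`{s₁, …, s_d} ≠ 0` in `k^M_d(K)`. -/
def dimMge (ℓ : ℕ) {K : Type*} [Field K] (S : Set (K1 ℓ K)) (d : ℕ) : Prop :=
  ∃ a : Fin d → Kˣ, (∀ i, K1proj ℓ K (a i) ∈ S) ∧ milnorSymbol ℓ a ≠ 0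

/-- `dim^M_K(S) = r`. -/
def dimMeq (ℓ : ℕ) {K : Type*} [Field K] (S : Set (K1 ℓ K)) (r : ℕ) : Prop :=
  dimMge ℓ S r ∧ ¬ dimMge ℓ S (r + 1)

/-- `t` is a general element of `K` over `k`: `t ∉ k` and `k(t)` is relatively
algebraically closed in `K`. -/
def IsGeneralElement (k : Type*) {K : Type*} [Field k] [Field K] [Algebra k K] (t : K) : Prop :=
  t ∉ (⊥ : IntermediateField k K) ∧ RelAlgClosed (IntermediateField.adjoin k {t})

/-- A rational subgroup of `k^M_1(K)`: `Ω_K(k(t))` for a general element `t`. -/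
def IsRationalSubgroup (ℓ : ℕ) (k : Type*) {K : Type*} [Field k] [Field K] [Algebra k K]
    (A : Subgroup (K1 ℓ K)) : Prop :=
  ∃ t : K, IsGeneralElement k t ∧ A = Omega ℓ (IntermediateField.adjoin k {t})

/-- `𝔊^r(K|k)`: the subgroups `Ω_K(L)` for `L` relatively algebraically closed
in `K` of transcendence degree `r` over `k`. -/
def GSet (ℓ : ℕ) (k : Type*) {K : Type*} [Field k] [Field K] [Algebra k K] (r : ℕ) :
    Set (Subgroup (K1 ℓ K)) :=
  {A | ∃ L : IntermediateField k K, RelAlgClosed L ∧ HasTrdeg k L r ∧ A = Omega ℓ L}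

/-- `𝔐^1(K)`: subgroups maximal among the subgroups `B` of `k^M_1(K)`
with `dim^M_K(B) = 1`. -/
def M1Set (ℓ : ℕ) (K : Type*) [Field K] : Set (Subgroup (K1 ℓ K)) :=
  {A | dimMeq ℓ (A : Set (K1 ℓ K)) 1 ∧
    ∀ B : Subgroup (K1 ℓ K), dimMeq ℓ (B : Set (K1 ℓ K)) 1 → A ≤ B → B = A}

/-- Condition (a) and (b) of the maximality characterization of `𝔊^r`:
`B` is generated by rational subgroups and `dim^M_K(B) = r`. -/
def SpannedByRatWithDim (ℓ : ℕ) (k : Type*) {K : Type*} [Field k] [Field K] [Algebra k K]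
    (r : ℕ) (B : Subgroup (K1 ℓ K)) : Prop :=
  (∃ S : Set (Subgroup (K1 ℓ K)), (∀ T ∈ S, IsRationalSubgroup ℓ k T) ∧ B = sSup S) ∧
    dimMeq ℓ (B : Set (K1 ℓ K)) r

/-- A discrete valuation of a field `F`: a surjective homomorphism `F^× → ℤ`
satisfying the ultrametric inequality. -/
structure DiscreteValuation (F : Type*) [Field F] where
  v : Fˣ → ℤ
  map_mul' : ∀ x y : Fˣ, v (x * y) = v x + v y
  surjective' : Function.Surjective v
  min_le' : ∀ x y z : Fˣ, (x : F) + (y : F) = (z : F) → min (v x) (v y) ≤ v z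

lemma DiscreteValuation.v_one {F : Type*} [Field F] (w : DiscreteValuation F) : w.v 1 = 0 := by
  have h := w.map_mul' 1 1
  simp only [mul_one] at h
  omega

/-- A discrete valuation of `F` is trivial on the base field `k`. -/
def DiscreteValuation.TrivialOn (k : Type*) {F : Type*} [Field k] [Field F] [Algebra k F]
    (w : DiscreteValuation F) : Prop :=
  ∀ (c : k) (hc : algebraMap k F c ≠ 0), w.v (Units.mk0 _ hc) = 0

/-- The unit group `U_w ⊆ F^×` of a discrete valuation. -/
def DiscreteValuation.units {F : Type*} [Field F] (w : DiscreteValuation F) : Subgroup Fˣ where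
  carrier := {x : Fˣ | w.v x = 0}
  one_mem' := w.v_one
  mul_mem' := by
    intro a b ha hb
    have h := w.map_mul' a b
    simp only [Set.mem_setOf_eq] at ha hb ⊢
    omega
  inv_mem' := by
    intro a ha
    have h := w.map_mul' a a⁻¹
    rw [mul_inv_cancel] at h
    have h1 := w.v_one
    simp only [Set.mem_setOf_eq] at ha ⊢
    omega

/-- `𝔘_v`: the image of the unit group `U_v` in `K^×/(K^×)^ℓ`. -/
def DiscreteValuation.unitsImage (ℓ : ℕ) {F : Type*} [Field F] (w : DiscreteValuation F) :
    Subgroup (K1 ℓ F) :=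
  w.units.map (K1proj ℓ F)

/-- For a discrete valuation `w` of an intermediate field `F` of `K|k`, the image of
the unit group `U_w` in `K^×/(K^×)^ℓ`. -/
def unitsImageIn (ℓ : ℕ) {k K : Type*} [Field k] [Field K] [Algebra k K]
    (F : IntermediateField k K) (w : DiscreteValuation F) : Subgroup (K1 ℓ K) :=
  (w.units.map (Units.map (algebraMap F K).toMonoidHom)).map (K1proj ℓ K)

/-- The residue field of `v` has transcendence degree `≥ m` over `k`: there are
`v`-units `x₁, …, x_m` whose residues are algebraically independent over `k`,
expressed by saying that every nonzero polynomial over `k` evaluated at the `xᵢ`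
is a unit of value `0`. -/
def DiscreteValuation.ResidueTrdegGe (k : Type*) {K : Type*} [Field k] [Field K] [Algebra k K]
    (v : DiscreteValuation K) (m : ℕ) : Prop :=
  ∃ x : Fin m → Kˣ, (∀ i, v.v (x i) = 0) ∧
    ∀ P : MvPolynomial (Fin m) k, P ≠ 0 →
      ∃ u : Kˣ, (u : K) = MvPolynomial.aeval (fun i => ((x i : K))) P ∧ v.v u = 0

/-- A divisorial-type valuation of `K|k` (where `d = trdeg(K|k)`): a discrete valuation
trivial on `k` whose residue field has transcendence degree exactly `d - 1` over `k`. -/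
def IsDivisorialType (k : Type*) {K : Type*} [Field k] [Field K] [Algebra k K] (d : ℕ)
    (v : DiscreteValuation K) : Prop :=
  v.TrivialOn k ∧ v.ResidueTrdegGe k (d - 1) ∧ ¬ v.ResidueTrdegGe k d

/-- `Δ_A`: the set of subgroups `A ⊓ 𝔘_v`, for `v` ranging over the divisorial-type
valuations of `K` with `A ⊄ 𝔘_v`. -/
def DeltaA (ℓ : ℕ) (k : Type*) {K : Type*} [Field k] [Field K] [Algebra k K] (d : ℕ)
    (A : Subgroup (K1 ℓ K)) : Set (Subgroup (K1 ℓ K)) :=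
  {T | ∃ v : DiscreteValuation K, IsDivisorialType k d v ∧
    ¬ A ≤ v.unitsImage ℓ ∧ T = A ⊓ v.unitsImage ℓ}

/-- A good rational subgroup: a rational subgroup `A = Ω_K(k(t))` such that for every
discrete valuation `w` of `k(t)` trivial on `k`, the image of `U_w` in `K^×/(K^×)^ℓ`
belongs to `Δ_A`. -/
def IsGoodRationalSubgroup (ℓ : ℕ) (k : Type*) {K : Type*} [Field k] [Field K] [Algebra k K]
    (d : ℕ) (A : Subgroup (K1 ℓ K)) : Prop :=
  ∃ t : K, IsGeneralElement k t ∧ A = Omega ℓ (IntermediateField.adjoin k {t}) ∧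
    ∀ w : DiscreteValuation (IntermediateField.adjoin k {t}), w.TrivialOn k →
      unitsImageIn ℓ (IntermediateField.adjoin k {t}) w ∈ DeltaA ℓ k d A

/-- A very general element: a general element `t` such that `Ω_K(k(t))` is a good
rational subgroup. -/
def IsVeryGeneral (ℓ : ℕ) (k : Type*) {K : Type*} [Field k] [Field K] [Algebra k K]
    (d : ℕ) (t : K) : Prop :=
  IsGeneralElement k t ∧ IsGoodRationalSubgroup ℓ k d (Omega ℓ (IntermediateField.adjoin k {t}))

/-- `x` is separable in `K`: in characteristic `p > 0`, `x` is not a `p`-th power;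
in characteristic `0` every element is separable. -/
def IsSeparableIn (K : Type*) [Field K] (x : K) : Prop :=
  ∀ p : ℕ, p.Prime → CharP K p → ¬ ∃ y : K, y ^ p = x

/-- A perfect closure of `K`: a perfect field which is a purely inseparable
extension of `K`. -/
structure PerfectClosureOf (K : Type u) [Field K] : Type (u + 1) where
  carrier : Type u
  [fieldInst : Field carrier]
  [algebraInst : Algebra K carrier]
  purelyInseparable : IsPurelyInseparable K carrier
  perfect : PerfectField carrier

attribute [instance] PerfectClosureOf.fieldInst PerfectClosureOf.algebraInst

/-- A group isomorphism `φ : k^M_1(K) → k^M_1(L)` is induced by a field isomorphism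
`σ : K^i → L^i` of the perfect closures, via the canonical identifications
`k^M_1(K) ≅ k^M_1(K^i)` and `k^M_1(L) ≅ k^M_1(L^i)`. -/
def InducesOnK1 (ℓ : ℕ) {K : Type u} {L : Type v} [Field K] [Field L]
    (PK : PerfectClosureOf K) (PL : PerfectClosureOf L)
    (σ : PK.carrier ≃+* PL.carrier) (φ : K1 ℓ K ≃* K1 ℓ L) : Prop :=
  ∀ (x : Kˣ) (y : Lˣ),
    (φ (K1proj ℓ K x) = K1proj ℓ L y ↔
      ∃ z : (PL.carrier)ˣ,
        Units.map σ.toRingHom.toMonoidHom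
            (Units.map (algebraMap K PK.carrier).toMonoidHom x) =
          Units.map (algebraMap L PL.carrier).toMonoidHom y * z ^ ℓ)

/-- `φ : k^M_1(K) → k^M_1(L)` is compatible with `k^M_2`: `φ ⊗ φ` descends, along the
multiplication maps, to an isomorphism `k^M_2(K) → k^M_2(L)`; equivalently, there is an
additive isomorphism `k^M_2(K) ≃ k^M_2(L)` carrying `{a, b}` to `{a', b'}` whenever
`φ` carries the class of `a` (resp. `b`) to the class of `a'` (resp. `b'`). -/
def CompatWithK2 (ℓ : ℕ) {K L : Type*} [Field K] [Field L] (φ : K1 ℓ K ≃* K1 ℓ L) : Prop :=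
  ∃ ψ : MilnorKMod ℓ 2 K ≃+ MilnorKMod ℓ 2 L,
    ∀ (a b : Kˣ) (a' b' : Lˣ),
      φ (K1proj ℓ K a) = K1proj ℓ L a' → φ (K1proj ℓ K b) = K1proj ℓ L b' →
        ψ (milnorSymbol ℓ ![a, b]) = milnorSymbol ℓ ![a', b']

/-- `φ : k^M_1(K) → k^M_1(L)` is compatible with `𝔊^1_rat`: it maps rational subgroups
bijectively onto rational subgroups. -/
def CompatWithRat (ℓ : ℕ) (k : Type*) (l : Type*) {K L : Type*}
    [Field k] [Field K] [Algebra k K] [Field l] [Field L] [Algebra l L]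
    (φ : K1 ℓ K ≃* K1 ℓ L) : Prop :=
  (∀ A : Subgroup (K1 ℓ K), IsRationalSubgroup ℓ k A →
     IsRationalSubgroup ℓ l (A.map φ.toMonoidHom)) ∧
  (∀ B : Subgroup (K1 ℓ L), IsRationalSubgroup ℓ l B →
     ∃ A : Subgroup (K1 ℓ K), IsRationalSubgroup ℓ k A ∧ A.map φ.toMonoidHom = B)

/-- Two isomorphisms of perfect closures differ by a power of the Frobenius
(in characteristic `0`, they are equal). -/
def FrobTwistEquiv {Ki Li : Type*} [Field Ki] [Field Li] (σ σ' : Ki ≃+* Li) : Prop :=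
  σ = σ' ∨ ∃ p : ℕ, p.Prime ∧ CharP Ki p ∧
    ((∃ n : ℕ, ∀ x, σ' x = σ (x ^ p ^ n)) ∨ (∃ n : ℕ, ∀ x, σ x = σ' (x ^ p ^ n)))

section Symbols

/-- The commutative group structure on `k^M_1(K)`. -/
abbrev K1.commGroup (ℓ : ℕ) (K : Type*) [Field K] : CommGroup (K1 ℓ K) :=
  QuotientGroup.Quotient.commGroup _

attribute [local instance] K1.commGroup

variable {ℓ : ℕ} {K : Type*} [Field K]

/-- The symbol `{a, b}` in `k^M_2(K)` for units. -/
def symU (ℓ : ℕ) {K : Type*} [Field K] (a b : Kˣ) : MilnorKMod ℓ 2 K :=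
  milnorSymbol ℓ ![a, b]

lemma ofMul_cons (a b : Kˣ) : (fun i => Additive.ofMul ((![a, b] : Fin 2 → Kˣ) i)) =
    (![Additive.ofMul a, Additive.ofMul b] : Fin 2 → Additive Kˣ) := by
  funext i; fin_cases i <;> rfl

lemma symU_mul_left (a b c : Kˣ) : symU ℓ (a * b) c = symU ℓ a c + symU ℓ b c := by
  unfold symU milnorSymbol
  rw [← Submodule.Quotient.mk_add, ← Submodule.Quotient.mk_add]
  congr 2
  rw [ofMul_cons, ofMul_cons, ofMul_cons]
  have h := (PiTensorProduct.tprod ℤ (s := fun _ : Fin 2 => Additive Kˣ)).map_update_add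
    ![Additive.ofMul a, Additive.ofMul c] 0 (Additive.ofMul a) (Additive.ofMul b)
  have e : ∀ x : Additive Kˣ, Function.update (![Additive.ofMul a, Additive.ofMul c] :
      Fin 2 → Additive Kˣ) 0 x = ![x, Additive.ofMul c] := by
    intro x; funext i; fin_cases i <;> rfl
  simp only [e] at h
  exact h

lemma symU_mul_right (a b c : Kˣ) : symU ℓ a (b * c) = symU ℓ a b + symU ℓ a c := by
  unfold symU milnorSymbol
  rw [← Submodule.Quotient.mk_add, ← Submodule.Quotient.mk_add]
  congr 2
  rw [ofMul_cons, ofMul_cons, ofMul_cons]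
  have h := (PiTensorProduct.tprod ℤ (s := fun _ : Fin 2 => Additive Kˣ)).map_update_add
    ![Additive.ofMul a, Additive.ofMul c] 1 (Additive.ofMul b) (Additive.ofMul c)
  have e : ∀ x : Additive Kˣ, Function.update (![Additive.ofMul a, Additive.ofMul c] :
      Fin 2 → Additive Kˣ) 1 x = ![Additive.ofMul a, x] := by
    intro x; funext i; fin_cases i <;> rfl
  simp only [e] at h
  exact h

lemma symU_steinberg {a b : Kˣ} (h : (a : K) + b = 1) : symU ℓ a b = 0 := by
  unfold symU milnorSymbol
  have : (Submodule.Quotient.mk (PiTensorProduct.tprod ℤ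
      (fun i => Additive.ofMul ((![a, b] : Fin 2 → Kˣ) i))) : MilnorK 2 K) = 0 := by
    rw [Submodule.Quotient.mk_eq_zero]
    exact Submodule.subset_span ⟨![a, b], ⟨0, 1, by decide, h⟩, rfl⟩
  rw [this]; rfl

lemma MilnorKMod.nsmul_eq_zero {n : ℕ} (x : MilnorKMod ℓ n K) : ℓ • x = 0 := by
  obtain ⟨y, rfl⟩ := Submodule.Quotient.mk_surjective _ x
  rw [← Submodule.Quotient.mk_smul, Submodule.Quotient.mk_eq_zero]
  refine ⟨y, ?_⟩
  simp

/-- The universal property of `k^M_2`. -/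
lemma exists_symU_lift {B : Type*} [AddCommGroup B] (hB : ∀ x : B, ℓ • x = 0) (c : Kˣ → Kˣ → B)
    (hl : ∀ a b d, c (a * b) d = c a d + c b d) (hr : ∀ a b d, c a (b * d) = c a b + c a d)
    (hs : ∀ a b : Kˣ, (a : K) + b = 1 → c a b = 0) :
    ∃ f : MilnorKMod ℓ 2 K →+ B, ∀ a b, f (symU ℓ a b) = c a b := by
  let m : MultilinearMap ℤ (fun _ : Fin 2 => Additive Kˣ) B :=
    { toFun := fun x => c (x 0).toMul (x 1).toMul
      map_update_add' := by
        intro inst x i a b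
        have : inst = instDecidableEqFin 2 := Subsingleton.elim _ _
        subst this
        fin_cases i
        · simp [Function.update, hl]
        · simp [Function.update, hr]
      map_update_smul' := by
        intro inst x i z a
        have : inst = instDecidableEqFin 2 := Subsingleton.elim _ _
        subst this
        fin_cases i
        · let φ : Additive Kˣ →+ B := AddMonoidHom.mk' (fun y => c y.toMul (x 1).toMul)
            (fun _ _ => hl _ _ _)
          exact map_zsmul φ z a
        · let φ : Additive Kˣ →+ B := AddMonoidHom.mk' (fun y => c (x 0).toMul y.toMul)
            (fun _ _ => hr _ _ _)
          exact map_zsmul φ z a }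
  have hst : SteinbergRel 2 K ≤ LinearMap.ker (PiTensorProduct.lift m) := by
    unfold SteinbergRel
    rw [Submodule.span_le]
    rintro x ⟨a, ⟨i, j, hij, hsum⟩, rfl⟩
    have hi : i = 0 := by omega
    have hj : j = 1 := by omega
    subst hi hj
    simp only [SetLike.mem_coe, LinearMap.mem_ker, PiTensorProduct.lift.tprod]
    exact hs _ _ hsum
  let f1 : MilnorK 2 K →ₗ[ℤ] B := (SteinbergRel 2 K).liftQ (PiTensorProduct.lift m) hst
  let f2 : MilnorKMod ℓ 2 K →ₗ[ℤ] B := Submodule.liftQ _ f1 (by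
    rintro x ⟨y, rfl⟩
    simp [hB])
  refine ⟨f2.toAddMonoidHom, fun a b => ?_⟩
  have : f2 (symU ℓ a b) = PiTensorProduct.lift m (PiTensorProduct.tprod ℤ
      (fun i => Additive.ofMul ((![a, b] : Fin 2 → Kˣ) i))) := rfl
  have h2 := this.trans (PiTensorProduct.lift.tprod _)
  exact h2

lemma symU_one_right (a : Kˣ) : symU ℓ a 1 = 0 := by
  have := symU_mul_right (ℓ := ℓ) a 1 1
  simpa using this

lemma symU_one_left (a : Kˣ) : symU ℓ 1 a = 0 := by
  have := symU_mul_left (ℓ := ℓ) 1 1 a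
  simpa using this

lemma symU_inv_left (a b : Kˣ) : symU ℓ a⁻¹ b = - symU ℓ a b := by
  rw [eq_neg_iff_add_eq_zero, ← symU_mul_left, inv_mul_cancel, symU_one_left]

lemma symU_inv_right (a b : Kˣ) : symU ℓ a b⁻¹ = - symU ℓ a b := by
  rw [eq_neg_iff_add_eq_zero, ← symU_mul_right, inv_mul_cancel, symU_one_right]

lemma symU_neg_self (a : Kˣ) : symU ℓ a (-a) = 0 := by
  by_cases h : a = 1
  · rw [h, symU_one_left]
  have h1 : (1 : K) - a ≠ 0 := by
    intro h'; apply h; ext; simpa using (sub_eq_zero.mp h').symm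
  have h2 : (1 : K) - (a : K)⁻¹ ≠ 0 := by
    intro h'; apply h; ext
    have := sub_eq_zero.mp h'
    rw [eq_comm, inv_eq_one] at this
    simpa using this
  have e : -a = Units.mk0 _ h1 * (Units.mk0 _ h2)⁻¹ := by
    rw [eq_mul_inv_iff_mul_eq]
    ext
    simp only [Units.val_mul, Units.val_neg, Units.val_mk0]
    have := a.ne_zero
    field_simp
    ring
  rw [e, symU_mul_right, symU_inv_right, ← symU_inv_left, symU_steinberg, symU_steinberg, add_zero]
  · simp
  · simp

lemma symU_swap (a b : Kˣ) : symU ℓ a b = - symU ℓ b a := by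
  have h := symU_neg_self (ℓ := ℓ) (a * b)
  have e1 : -(a * b) = (-a) * b := by simp
  rw [symU_mul_left, e1, symU_mul_right, symU_neg_self] at h
  have e2 : (-a) * b = a * (-b) := by simp
  rw [e2, symU_mul_right, symU_neg_self] at h
  rw [eq_neg_iff_add_eq_zero]
  simpa using h

/-- Functoriality of `k^M_2`. -/
lemma exists_symU_map {K' : Type*} [Field K'] (f : K →+* K') :
    ∃ F : MilnorKMod ℓ 2 K →+ MilnorKMod ℓ 2 K', ∀ a b : Kˣ,
      F (symU ℓ a b) = symU ℓ (Units.map f.toMonoidHom a) (Units.map f.toMonoidHom b) := by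
  refine exists_symU_lift MilnorKMod.nsmul_eq_zero _ ?_ ?_ ?_
  · intro a b d; rw [map_mul, symU_mul_left]
  · intro a b d; rw [map_mul, symU_mul_right]
  · intro a b h; apply symU_steinberg
    have := congrArg f h
    simpa using this

lemma K1proj_eq_one_iff {a : Kˣ} : K1proj ℓ K a = 1 ↔ ∃ z : Kˣ, a = z ^ ℓ := by
  unfold K1proj
  rw [← MonoidHom.mem_ker, QuotientGroup.ker_mk']
  constructor
  · rintro ⟨z, rfl⟩; exact ⟨z, rfl⟩
  · rintro ⟨z, rfl⟩; exact ⟨z, rfl⟩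

lemma K1proj_eq_iff {a b : Kˣ} : K1proj ℓ K a = K1proj ℓ K b ↔ ∃ z : Kˣ, a = b * z ^ ℓ := by
  have : K1proj ℓ K a = K1proj ℓ K b ↔ K1proj ℓ K (a / b) = 1 := by
    rw [div_eq_mul_inv, map_mul, map_inv, mul_inv_eq_one]
  rw [this, K1proj_eq_one_iff]
  simp only [div_eq_iff_eq_mul, mul_comm b]

lemma milnorSymbol_one_ne_zero {a : Fin 1 → Kˣ} (h : K1proj ℓ K (a 0) ≠ 1) :
    milnorSymbol ℓ a ≠ 0 := by
  let φ : Additive Kˣ →+ Additive (K1 ℓ K) := (K1proj ℓ K).toAdditive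
  let m : MultilinearMap ℤ (fun _ : Fin 1 => Additive Kˣ) (Additive (K1 ℓ K)) :=
    φ.toIntLinearMap.compMultilinearMap
      (MultilinearMap.ofSubsingleton ℤ (Additive Kˣ) (Additive Kˣ) (0 : Fin 1) LinearMap.id)
  have hst : SteinbergRel 1 K ≤ LinearMap.ker (PiTensorProduct.lift m) := by
    unfold SteinbergRel
    rw [Submodule.span_le]
    rintro x ⟨a, ⟨i, j, hij, hsum⟩, rfl⟩
    omega
  let f1 : MilnorK 1 K →ₗ[ℤ] Additive (K1 ℓ K) :=
    (SteinbergRel 1 K).liftQ (PiTensorProduct.lift m) hst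
  let f2 : MilnorKMod ℓ 1 K →ₗ[ℤ] Additive (K1 ℓ K) := Submodule.liftQ _ f1 (by
    rintro x ⟨y, rfl⟩
    obtain ⟨z, hz⟩ := QuotientGroup.mk'_surjective _ (f1 y).toMul
    have : f1 y = φ (Additive.ofMul z) := hz.symm
    simp only [LinearMap.mem_ker, LinearMap.smul_apply, LinearMap.id_coe, id_eq, map_smul, this]
    have e : ((ℓ : ℤ) • φ (Additive.ofMul z)) = φ (Additive.ofMul (z ^ ℓ)) := by
      rw [ofMul_pow, map_nsmul, natCast_zsmul]
    rw [e]
    exact K1proj_eq_one_iff.mpr ⟨z, rfl⟩)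
  intro h0
  have : f2 (milnorSymbol ℓ a) = PiTensorProduct.lift m (PiTensorProduct.tprod ℤ
      (fun i => Additive.ofMul (a i))) := rfl
  have h2 := this.trans (PiTensorProduct.lift.tprod _)
  rw [h0, map_zero] at h2
  exact h h2.symm

end Symbols

section Laurent

attribute [local instance] K1.commGroup

variable {ℓ : ℕ} {κ : Type*} [Field κ]

/-- The order of a nonzero Laurent series. -/
def ordL (x : (LaurentSeries κ)ˣ) : ℤ := HahnSeries.order (x : LaurentSeries κ)

/-- The leading coefficient of a nonzero Laurent series. -/
def lcL (x : (LaurentSeries κ)ˣ) : κˣ :=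
  Units.mk0 (HahnSeries.leadingCoeff (x : LaurentSeries κ))
    (HahnSeries.leadingCoeff_ne_zero.mpr x.ne_zero)

lemma ordL_mul (x y : (LaurentSeries κ)ˣ) : ordL (x * y) = ordL x + ordL y := by
  unfold ordL
  rw [Units.val_mul, HahnSeries.order_mul x.ne_zero y.ne_zero]

lemma lcL_mul (x y : (LaurentSeries κ)ˣ) : lcL (x * y) = lcL x * lcL y := by
  ext
  simp [lcL, HahnSeries.leadingCoeff_mul]

lemma coeff_ordL (x : (LaurentSeries κ)ˣ) : (x : LaurentSeries κ).coeff (ordL x) = lcL x := by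
  simp only [lcL, ordL, Units.val_mk0]
  rw [HahnSeries.leadingCoeff_eq]

lemma coeff_lt_ordL (x : (LaurentSeries κ)ˣ) {n : ℤ} (h : n < ordL x) :
    (x : LaurentSeries κ).coeff n = 0 := HahnSeries.coeff_eq_zero_of_lt_order h

lemma ordL_lcL_of_coeff (x : (LaurentSeries κ)ˣ) (n : ℤ) (c : κ) (hc : c ≠ 0)
    (h1 : (x : LaurentSeries κ).coeff n = c)
    (h2 : ∀ m < n, (x : LaurentSeries κ).coeff m = 0) : ordL x = n ∧ (lcL x : κ) = c := by
  have e : ordL x = n := by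
    apply le_antisymm
    · exact HahnSeries.order_le_of_coeff_ne_zero (by rw [h1]; exact hc)
    · by_contra! hlt
      have := h2 _ hlt
      rw [coeff_ordL] at this
      exact (lcL x).ne_zero this
  exact ⟨e, by rw [← coeff_ordL, e, h1]⟩

lemma laurent_add_eq_one {x y : (LaurentSeries κ)ˣ} (h : (x : LaurentSeries κ) + y = 1) :
    (0 < ordL x ∧ ordL y = 0 ∧ lcL y = 1) ∨ (0 < ordL y ∧ ordL x = 0 ∧ lcL x = 1) ∨
    (ordL x = 0 ∧ ordL y = 0 ∧ (lcL x : κ) + lcL y = 1) ∨ (ordL x = ordL y ∧ lcL y = - lcL x) := by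
  have key : ∀ {x y : (LaurentSeries κ)ˣ}, (x : LaurentSeries κ) + y = 1 → 0 < ordL x →
      ordL y = 0 ∧ lcL y = 1 := by
    intro x y h hx
    have hy : (y : LaurentSeries κ) = 1 - x := by rw [← h]; ring
    have := ordL_lcL_of_coeff y 0 1 one_ne_zero
      (by rw [hy]; simp [coeff_lt_ordL x hx])
      (by
        intro m hm; rw [hy]
        simp [coeff_lt_ordL x (hm.trans hx), HahnSeries.coeff_one, hm.ne])
    exact ⟨this.1, by ext; simpa using this.2⟩
  have key2 : ∀ {x y : (LaurentSeries κ)ˣ}, (x : LaurentSeries κ) + y = 1 → ordL x < 0 →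
      ordL y = ordL x ∧ lcL y = - lcL x := by
    intro x y h hx
    have hy : (y : LaurentSeries κ) = 1 - x := by rw [← h]; ring
    have := ordL_lcL_of_coeff y (ordL x) (-lcL x) (neg_ne_zero.mpr (lcL x).ne_zero)
      (by rw [hy]; simp [coeff_ordL, HahnSeries.coeff_one, hx.ne])
      (by
        intro m hm; rw [hy]
        simp [coeff_lt_ordL x hm, HahnSeries.coeff_one, (hm.trans hx).ne])
    exact ⟨this.1, by ext; simpa using this.2⟩
  have h' : (y : LaurentSeries κ) + x = 1 := by rw [add_comm, h]
  rcases lt_trichotomy (ordL x) 0 with hx | hx | hx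
  · right; right; right
    exact ⟨(key2 h hx).1.symm, (key2 h hx).2⟩
  · rcases lt_trichotomy (ordL y) 0 with hy | hy | hy
    · have := key2 h' hy
      omega
    · right; right; left
      refine ⟨hx, hy, ?_⟩
      rw [← coeff_ordL, ← coeff_ordL, hx, hy, ← HahnSeries.coeff_add, h]
      simp
    · right; left
      exact ⟨hy, key h' hy⟩
  · left
    exact ⟨hx, key h hx⟩

/-- The specialization `k_2(κ((π))) → k_2(κ)` attached to `π`. -/
lemma exists_specialization : ∃ s : MilnorKMod ℓ 2 (LaurentSeries κ) →+ MilnorKMod ℓ 2 κ,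
    ∀ a b, s (symU ℓ a b) = symU ℓ (lcL a) (lcL b) := by
  refine exists_symU_lift MilnorKMod.nsmul_eq_zero _ ?_ ?_ ?_
  · intro a b d; rw [lcL_mul, symU_mul_left]
  · intro a b d; rw [lcL_mul, symU_mul_right]
  · intro a b h
    rcases laurent_add_eq_one h with h | h | h | h
    · rw [h.2.2, symU_one_right]
    · rw [h.2.2, symU_one_left]
    · exact symU_steinberg h.2.2
    · rw [h.2, symU_neg_self]

/-- The tame symbol on `k_2(κ((π)))`, when `-1` is an `ℓ`-th power. -/
lemma exists_tame (hneg : ∃ z : κˣ, z ^ ℓ = -1) :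
    ∃ s : MilnorKMod ℓ 2 (LaurentSeries κ) →+ Additive (K1 ℓ κ),
    ∀ a b, s (symU ℓ a b) =
      Additive.ofMul (K1proj ℓ κ (lcL a ^ ordL b * lcL b ^ (-ordL a))) := by
  refine exists_symU_lift (B := Additive (K1 ℓ κ)) ?_ _ ?_ ?_ ?_
  · intro x
    obtain ⟨z, hz⟩ := QuotientGroup.mk'_surjective _ x.toMul
    have : x = Additive.ofMul (K1proj ℓ κ z) := hz.symm
    rw [this, ← ofMul_pow, ← map_pow, K1proj_eq_one_iff.mpr ⟨z, rfl⟩]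
    rfl
  · intro a b d
    rw [← ofMul_mul, ← map_mul, lcL_mul, ordL_mul]
    congr 2
    rw [mul_zpow, neg_add, zpow_add]
    exact mul_mul_mul_comm _ _ _ _
  · intro a b d
    rw [← ofMul_mul, ← map_mul, lcL_mul, ordL_mul]
    congr 2
    rw [mul_zpow, zpow_add]
    exact mul_mul_mul_comm _ _ _ _
  · intro a b h
    rw [ofMul_eq_zero]
    rcases laurent_add_eq_one h with h | h | h | h
    · simp [h.2.1, h.2.2]
    · simp [h.2.1, h.2.2]
    · simp [h.1, h.2.1]
    · obtain ⟨z, hz⟩ := hneg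
      rw [h.1, h.2, K1proj_eq_one_iff]
      refine ⟨z ^ (-ordL b), ?_⟩
      have e : -lcL a = z ^ ℓ * lcL a := by rw [hz]; simp
      rw [e, mul_zpow, mul_left_comm, ← zpow_add, add_neg_cancel, zpow_zero, mul_one,
        ← zpow_natCast, ← zpow_natCast, zpow_comm]

end Laurent

section

open Polynomial

section Sym

variable {ℓ : ℕ} {K : Type*} [Field K]

open Classical in
/-- The symbol `{a, b}` in `k^M_2(K)`, extended by zero to all pairs of elements of `K`. -/
def sym (ℓ : ℕ) {K : Type*} [Field K] (a b : K) : MilnorKMod ℓ 2 K :=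
  if h : a ≠ 0 ∧ b ≠ 0 then symU ℓ (Units.mk0 a h.1) (Units.mk0 b h.2) else 0

lemma sym_mk0 {a b : K} (ha : a ≠ 0) (hb : b ≠ 0) :
    sym ℓ a b = symU ℓ (Units.mk0 a ha) (Units.mk0 b hb) := by
  rw [sym, dif_pos ⟨ha, hb⟩]

lemma sym_zero_left (b : K) : sym ℓ 0 b = 0 := by simp [sym]

lemma sym_zero_right (b : K) : sym ℓ b 0 = 0 := by simp [sym]

lemma sym_units (a b : Kˣ) : sym ℓ (a : K) b = symU ℓ a b := by
  rw [sym_mk0 a.ne_zero b.ne_zero]; simp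

lemma sym_mul_left {a b : K} (ha : a ≠ 0) (hb : b ≠ 0) (c : K) :
    sym ℓ (a * b) c = sym ℓ a c + sym ℓ b c := by
  by_cases hc : c = 0
  · simp [hc, sym_zero_right]
  rw [sym_mk0 ha hc, sym_mk0 hb hc, sym_mk0 (mul_ne_zero ha hb) hc, ← symU_mul_left]
  congr 1
  ext; simp

lemma sym_swap (a b : K) : sym ℓ a b = - sym ℓ b a := by
  by_cases ha : a = 0
  · simp [ha, sym_zero_right, sym_zero_left]
  by_cases hb : b = 0
  · simp [hb, sym_zero_right, sym_zero_left]
  rw [sym_mk0 ha hb, sym_mk0 hb ha, symU_swap]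

lemma sym_mul_right (a : K) {b c : K} (hb : b ≠ 0) (hc : c ≠ 0) :
    sym ℓ a (b * c) = sym ℓ a b + sym ℓ a c := by
  rw [sym_swap, sym_mul_left hb hc, sym_swap b, sym_swap c]; abel

lemma sym_inv_left (a b : K) : sym ℓ a⁻¹ b = - sym ℓ a b := by
  by_cases ha : a = 0
  · simp [ha, sym_zero_left]
  by_cases hb : b = 0
  · simp [hb, sym_zero_right]
  rw [sym_mk0 ha hb, sym_mk0 (inv_ne_zero ha) hb, ← symU_inv_left]
  congr 1
  ext; simp

lemma sym_inv_right (a b : K) : sym ℓ a b⁻¹ = - sym ℓ a b := by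
  rw [sym_swap, sym_inv_left, sym_swap a]

lemma sym_div_left {a b : K} (ha : a ≠ 0) (hb : b ≠ 0) (c : K) :
    sym ℓ (a / b) c = sym ℓ a c - sym ℓ b c := by
  rw [div_eq_mul_inv, sym_mul_left ha (inv_ne_zero hb), sym_inv_left]; abel

lemma sym_div_right (a : K) {b c : K} (hb : b ≠ 0) (hc : c ≠ 0) :
    sym ℓ a (b / c) = sym ℓ a b - sym ℓ a c := by
  rw [div_eq_mul_inv, sym_mul_right a hb (inv_ne_zero hc), sym_inv_right]; abel

lemma sym_steinberg {a b : K} (h : a + b = 1) : sym ℓ a b = 0 := by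
  by_cases ha : a = 0
  · simp [ha, sym_zero_left]
  by_cases hb : b = 0
  · simp [hb, sym_zero_right]
  rw [sym_mk0 ha hb, symU_steinberg]
  simpa using h

lemma sym_neg_self (a : K) : sym ℓ a (-a) = 0 := by
  by_cases ha : a = 0
  · simp [ha, sym_zero_left]
  rw [sym_mk0 ha (neg_ne_zero.mpr ha)]
  rw [← symU_neg_self (Units.mk0 a ha)]
  congr 1
  ext; simp

lemma sym_self (a : K) : sym ℓ a a = sym ℓ a (-1) := by
  by_cases ha : a = 0
  · simp [ha, sym_zero_left]
  have h := sym_mul_right (ℓ := ℓ) a (neg_ne_zero.mpr ha) (neg_ne_zero.mpr (one_ne_zero (α := K)))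
  rwa [sym_neg_self, zero_add, neg_mul_neg, mul_one] at h

lemma sym_one_right (a : K) : sym ℓ a 1 = 0 := by
  have h := sym_mul_right (ℓ := ℓ) a (one_ne_zero (α := K)) one_ne_zero
  rw [mul_one] at h
  simpa using h

lemma sym_pow_right (a b : K) {n : ℕ} (hn : n ≠ 0) : sym ℓ a (b ^ n) = n • sym ℓ a b := by
  by_cases hb : b = 0
  · simp [hb, hn, sym_zero_right]
  induction n with
  | zero => exact absurd rfl hn
  | succ n ih =>
    by_cases h0 : n = 0
    · simp [h0]
    rw [pow_succ, sym_mul_right a (pow_ne_zero _ hb) hb, ih h0, succ_nsmul]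

lemma sym_ellpow_right (hℓ : ℓ ≠ 0) (a b : K) : sym ℓ a (b ^ ℓ) = 0 := by
  rw [sym_pow_right a b hℓ, MilnorKMod.nsmul_eq_zero]

lemma sym_ellpow_left (hℓ : ℓ ≠ 0) (a b : K) : sym ℓ (a ^ ℓ) b = 0 := by
  rw [sym_swap, sym_ellpow_right hℓ, neg_zero]

/-- Functoriality of `k^M_2`. -/
lemma exists_sym_map (ℓ : ℕ) {K' : Type*} [Field K'] (f : K →+* K') :
    ∃ F : MilnorKMod ℓ 2 K →+ MilnorKMod ℓ 2 K', ∀ a b : K,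
      F (sym ℓ a b) = sym ℓ (f a) (f b) := by
  obtain ⟨F, hF⟩ := exists_symU_map (ℓ := ℓ) f
  refine ⟨F, fun a b => ?_⟩
  by_cases ha : a = 0
  · simp [ha, sym_zero_left]
  by_cases hb : b = 0
  · simp [hb, sym_zero_right]
  rw [sym_mk0 ha hb, hF, sym_mk0 ((map_ne_zero f).mpr ha) ((map_ne_zero f).mpr hb)]
  congr 1 <;> (ext; rfl)

end Sym

section LaurentTotal

variable {ℓ : ℕ} {K κ : Type*} [Field K] [Field κ]

lemma exists_spec_of_hom (ℓ : ℕ) (ι : K →+* LaurentSeries κ) :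
    ∃ s : MilnorKMod ℓ 2 K →+ MilnorKMod ℓ 2 κ,
    ∀ a b, a ≠ 0 → b ≠ 0 →
      s (sym ℓ a b) = sym ℓ (ι a).leadingCoeff (ι b).leadingCoeff := by
  obtain ⟨s, hs⟩ := exists_specialization (ℓ := ℓ) (κ := κ)
  obtain ⟨F, hF⟩ := exists_sym_map ℓ ι
  refine ⟨s.comp F, fun a b ha hb => ?_⟩
  have ha' := (map_ne_zero ι).mpr ha
  have hb' := (map_ne_zero ι).mpr hb
  rw [AddMonoidHom.comp_apply, hF, sym_mk0 ha' hb', hs, sym_mk0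
    (HahnSeries.leadingCoeff_ne_zero.mpr ha') (HahnSeries.leadingCoeff_ne_zero.mpr hb')]
  rfl

attribute [local instance] K1.commGroup in
/-- The tame symbol attached to an embedding into a field of Laurent series. -/
lemma exists_tame_of_hom (hneg : ∃ z : κ, z ^ ℓ = -1) (ι : K →+* LaurentSeries κ) :
    ∃ s : MilnorKMod ℓ 2 K →+ Additive (K1 ℓ κ),
    ∀ (a b : K) (_ : a ≠ 0) (_ : b ≠ 0), ∀ u v : κˣ, (u : κ) = (ι a).leadingCoeff →
      (v : κ) = (ι b).leadingCoeff →
      s (sym ℓ a b) =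
      Additive.ofMul (K1proj ℓ κ (u ^ (ι b).order * v ^ (-(ι a).order))) := by
  have hneg' : ∃ z : κˣ, z ^ ℓ = -1 := by
    obtain ⟨z, hz⟩ := hneg
    by_cases h : z = 0
    · by_cases hl : ℓ = 0
      · subst hl; exact ⟨1, by ext; simpa using hz⟩
      · simp [h, hl] at hz
    · exact ⟨Units.mk0 z h, by ext; simpa using hz⟩
  obtain ⟨s, hs⟩ := exists_tame (ℓ := ℓ) (κ := κ) hneg'
  obtain ⟨F, hF⟩ := exists_sym_map ℓ ι
  refine ⟨s.comp F, fun a b ha hb u v hu hv => ?_⟩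
  have ha' := (map_ne_zero ι).mpr ha
  have hb' := (map_ne_zero ι).mpr hb
  rw [AddMonoidHom.comp_apply, hF, sym_mk0 ha' hb', hs]
  have e1 : lcL (Units.mk0 _ ha') = u := by ext; rw [hu]; rfl
  have e2 : lcL (Units.mk0 _ hb') = v := by ext; rw [hv]; rfl
  rw [e1, e2]; rfl

lemma order_lc_of_coeff (x : LaurentSeries κ) (n : ℤ)
    (h1 : x.coeff n ≠ 0) (h2 : ∀ m < n, x.coeff m = 0) :
    x.order = n ∧ x.leadingCoeff = x.coeff n := by
  have hx : x ≠ 0 := by rintro rfl; simp at h1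
  exact ordL_lcL_of_coeff (Units.mk0 x hx) n _ h1 rfl h2

end LaurentTotal

section Residue

variable {ℓ : ℕ} {F κ : Type*} [Field F] [Field κ]

/-- The expansion of polynomials at `c`. -/
def expandAt (φ : F →+* κ) (c : κ) : F[X] →+* LaurentSeries κ :=
  (HahnSeries.ofPowerSeries ℤ κ).comp
    (coeToPowerSeries.ringHom.comp ((taylorAlgHom c : κ[X] →ₐ[κ] κ[X]).toRingHom.comp (mapRingHom
        φ)))

lemma expandAt_apply (φ : F →+* κ) (c : κ) (p : F[X]) : expandAt φ c p =
    HahnSeries.ofPowerSeries ℤ κ ((taylor c (p.map φ) : κ[X]) : PowerSeries κ) := rfl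

lemma expandAt_injective (φ : F →+* κ) (c : κ) : Function.Injective (expandAt φ c) := by
  intro p q h
  rw [expandAt_apply, expandAt_apply] at h
  exact map_injective φ φ.injective (taylor_injective c
    (Polynomial.coe_injective _ (HahnSeries.ofPowerSeries_injective h)))

/-- The expansion of rational functions at `c`. -/
def ratExpandAt (φ : F →+* κ) (c : κ) : RatFunc F →+* LaurentSeries κ :=
  IsFractionRing.lift (expandAt_injective φ c)

lemma ratExpandAt_algebraMap (φ : F →+* κ) (c : κ) (p : F[X]) :
    ratExpandAt φ c (algebraMap _ _ p) =
    HahnSeries.ofPowerSeries ℤ κ ((taylor c (p.map φ) : κ[X]) : PowerSeries κ) :=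
  IsFractionRing.lift_algebraMap _ _

lemma taylor_order_lc_of_eval_ne_zero (c : κ) (p : κ[X]) (h : p.eval c ≠ 0) :
    (HahnSeries.ofPowerSeries ℤ κ ((taylor c p : κ[X]) : PowerSeries κ)).order = 0 ∧
    (HahnSeries.ofPowerSeries ℤ κ ((taylor c p : κ[X]) : PowerSeries κ)).leadingCoeff =
      p.eval c := by
  have e : (HahnSeries.ofPowerSeries ℤ κ ((taylor c p : κ[X]) : PowerSeries κ)).coeff 0 =
      p.eval c := by
    rw [PowerSeries.coeff_coe]; simp [taylor_coeff_zero]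
  have := order_lc_of_coeff _ 0 (by rw [e]; exact h) (fun m hm => by
    rw [PowerSeries.coeff_coe, if_pos hm])
  rw [e] at this
  exact this

lemma taylor_order (c : κ) (p : κ[X]) (hp : p ≠ 0) :
    (HahnSeries.ofPowerSeries ℤ κ ((taylor c p : κ[X]) : PowerSeries κ)).order =
      p.rootMultiplicity c := by
  obtain ⟨q, hq, hdvd⟩ := exists_eq_pow_rootMultiplicity_mul_and_not_dvd p hp c
  have hq0 : q.eval c ≠ 0 := fun h => hdvd (dvd_iff_isRoot.mpr h)
  have hqne : q ≠ 0 := by rintro rfl; simp at hq0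
  generalize p.rootMultiplicity c = n at hq
  rw [hq]
  have e1 : taylor c ((X - C c) ^ n * q) = X ^ n * taylor c q := by
    rw [taylor_mul, taylor_pow]; simp
  rw [e1, Polynomial.coe_mul, map_mul, HahnSeries.order_mul,
    (taylor_order_lc_of_eval_ne_zero c q hq0).1, add_zero, Polynomial.coe_pow, Polynomial.coe_X,
    HahnSeries.ofPowerSeries_X_pow, HahnSeries.order_single one_ne_zero]
  · rw [Polynomial.coe_pow, Polynomial.coe_X, HahnSeries.ofPowerSeries_X_pow]; simp
  · rw [Ne, map_eq_zero_iff _ HahnSeries.ofPowerSeries_injective, Polynomial.coe_eq_zero_iff]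
    intro h
    exact hqne (taylor_injective c (by rw [h, map_zero]))

lemma coprime_expChar_pow [Fact ℓ.Prime] (hF : (ℓ : F) ≠ 0) (q n : ℕ) [ExpChar F q] :
    (q ^ n).Coprime ℓ := by
  apply Nat.Coprime.pow_left
  have hl : ℓ.Prime := Fact.out
  cases ‹ExpChar F q› with
  | zero => simp
  | prime hq =>
    rw [Nat.coprime_primes hq hl]
    rintro rfl
    exact hF (CharP.cast_eq_zero F q)

lemma exists_pow_of_pow_coprime {κ : Type*} [Field κ] {a : κˣ} {e ℓ : ℕ} (h : e.Coprime ℓ)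
    {z : κˣ} (hz : a ^ e = z ^ ℓ) : ∃ w : κˣ, a = w ^ ℓ := by
  have hb := Nat.gcd_eq_gcd_ab e ℓ
  rw [h.gcd_eq_one] at hb
  refine ⟨z ^ (Nat.gcdA e ℓ) * a ^ (Nat.gcdB e ℓ), ?_⟩
  have : a = a ^ ((1 : ℕ) : ℤ) := by simp
  conv_lhs => rw [this, hb, zpow_add, zpow_mul, zpow_mul, zpow_natCast, zpow_natCast, hz]
  rw [mul_pow, ← zpow_natCast, ← zpow_natCast, ← zpow_natCast, ← zpow_natCast, zpow_comm,
    zpow_comm a]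

lemma rootMultiplicity_coprime [Fact ℓ.Prime] (hF : (ℓ : F) ≠ 0) (P : F[X]) (hP : Irreducible P)
    (φ : F →+* κ) (c : κ) (hc : (P.map φ).eval c = 0) :
    ((P.map φ).rootMultiplicity c).Coprime ℓ := by
  obtain ⟨q, hq⟩ := ExpChar.exists F
  obtain ⟨g, hg, m, hm⟩ := hP.hasSeparableContraction q
  have hqκ : ExpChar κ q := expChar_of_injective_ringHom φ.injective q
  have hP0 : P.map φ ≠ 0 := by
    rw [Ne, Polynomial.map_eq_zero]; exact hP.ne_zero
  have hpos := (rootMultiplicity_pos hP0).mpr hc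
  have e : (P.map φ).rootMultiplicity c = q ^ m * (g.map φ).rootMultiplicity (c ^ q ^ m) := by
    rw [← hm, map_expand, rootMultiplicity_expand_pow]
  have h1 := rootMultiplicity_le_one_of_separable (hg.map (f := φ)) (c ^ q ^ m)
  have h2 : (g.map φ).rootMultiplicity (c ^ q ^ m) = 1 := by
    rcases Nat.le_one_iff_eq_zero_or_eq_one.mp h1 with h | h
    · rw [e, h] at hpos; simp at hpos
    · exact h
  rw [e, h2, mul_one]
  exact coprime_expChar_pow hF q m

/-- The residue map attached to a monic irreducible polynomial. -/
lemma exists_residue [Fact ℓ.Prime] (hF : (ℓ : F) ≠ 0) (hneg : ∃ z : F, z ^ ℓ = -1)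
    (P : F[X]) (hP : Irreducible P) :
    ∃ N : AddSubgroup (MilnorKMod ℓ 2 (RatFunc F)),
      (∀ f g : F[X], ¬ P ∣ f → ¬ P ∣ g → sym ℓ (algebraMap _ (RatFunc F) f) (algebraMap _ _ g) ∈ N)
          ∧
      (∀ g : F[X], ¬ P ∣ g → (sym ℓ (algebraMap _ (RatFunc F) P) (algebraMap _ _ g) ∈ N ↔
        ∃ h : F[X], P ∣ g - h ^ ℓ)) := by
  have : Fact (Irreducible P) := ⟨hP⟩
  let φ : F →+* AdjoinRoot P := AdjoinRoot.of P
  let θ : AdjoinRoot P := AdjoinRoot.root P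
  let _ := K1.commGroup ℓ (AdjoinRoot P)
  obtain ⟨s, hs⟩ := exists_tame_of_hom (ℓ := ℓ) (κ := AdjoinRoot P) (by
    obtain ⟨z, hz⟩ := hneg
    exact ⟨φ z, by rw [← map_pow, hz, map_neg, map_one]⟩) (ratExpandAt φ θ)
  have hne : ∀ f : F[X], f ≠ 0 → algebraMap F[X] (RatFunc F) f ≠ 0 := fun f hf => by
    simpa using hf
  have hev : ∀ f : F[X], (f.map φ).eval θ = AdjoinRoot.mk P f := fun f => by
    rw [eval_map, ← AdjoinRoot.aeval_eq]; rfl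
  have hnz : ∀ f : F[X], ¬ P ∣ f → (f.map φ).eval θ ≠ 0 := fun f hf => by
    rw [hev, Ne, AdjoinRoot.mk_eq_zero]; exact hf
  have hf0 : ∀ f : F[X], ¬ P ∣ f → f ≠ 0 := by
    rintro f hf rfl; exact hf (dvd_zero _)
  refine ⟨s.ker, fun f g hf hg => ?_, fun g hg => ?_⟩
  · have h1 := taylor_order_lc_of_eval_ne_zero θ (f.map φ) (hnz f hf)
    have h2 := taylor_order_lc_of_eval_ne_zero θ (g.map φ) (hnz g hg)
    rw [AddMonoidHom.mem_ker, hs _ _ (hne f (hf0 f hf)) (hne g (hf0 g hg))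
      (Units.mk0 _ (hnz f hf)) (Units.mk0 _ (hnz g hg))]
    · rw [ratExpandAt_algebraMap, ratExpandAt_algebraMap, h1.1, h2.1]
      simp
    · rw [ratExpandAt_algebraMap, h1.2]; rfl
    · rw [ratExpandAt_algebraMap, h2.2]; rfl
  · have h2 := taylor_order_lc_of_eval_ne_zero θ (g.map φ) (hnz g hg)
    have hPm : P.map φ ≠ 0 := by
      rw [Ne, Polynomial.map_eq_zero]; exact hP.ne_zero
    have hroot : (P.map φ).eval θ = 0 := by rw [hev, AdjoinRoot.mk_self]
    have hcop := rootMultiplicity_coprime hF P hP φ θ hroot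
    have hlc : (ratExpandAt φ θ (algebraMap _ _ P)).leadingCoeff ≠ 0 :=
      HahnSeries.leadingCoeff_ne_zero.mpr ((_root_.map_ne_zero _).mpr (hne P hP.ne_zero))
    rw [AddMonoidHom.mem_ker, hs _ _ (hne P hP.ne_zero) (hne g (hf0 g hg))
      (Units.mk0 _ hlc) (Units.mk0 _ (hnz g hg)) rfl
        (by rw [ratExpandAt_algebraMap, h2.2]; rfl)]
    generalize Units.mk0 _ hlc = u0
    rw [ratExpandAt_algebraMap, ratExpandAt_algebraMap, h2.1, taylor_order θ _ hPm, ofMul_eq_zero,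
      zpow_zero, one_mul, zpow_neg, map_inv, inv_eq_one, zpow_natCast, K1proj_eq_one_iff]
    constructor
    · rintro ⟨z, hz⟩
      obtain ⟨w, hw⟩ := exists_pow_of_pow_coprime hcop hz
      obtain ⟨h, hh⟩ := AdjoinRoot.mk_surjective (w : AdjoinRoot P)
      refine ⟨h, ?_⟩
      rw [← AdjoinRoot.mk_eq_mk, map_pow, hh, ← hev]
      have := congrArg Units.val hw
      simpa using this
    · rintro ⟨h, hh⟩
      have hw : ¬ P ∣ h := by
        intro hd
        apply hg
        have := dvd_add hh (dvd_pow hd (Fact.out : ℓ.Prime).ne_zero)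
        simpa using this
      rw [← AdjoinRoot.mk_eq_mk] at hh
      refine ⟨(Units.mk0 _ (hnz h hw)) ^ ((P.map φ).rootMultiplicity θ), ?_⟩
      rw [pow_right_comm]
      congr 1
      ext
      simp [hev, hh]

end Residue

end

section

open Polynomial

section MilnorFiltration

variable {ℓ : ℕ} {F : Type*} [Field F]

/-- The symbol of two polynomials in `k_2` of the field of rational functions. -/
def psym (ℓ : ℕ) {F : Type*} [Field F] (p q : F[X]) : MilnorKMod ℓ 2 (RatFunc F) :=
  sym ℓ (algebraMap _ (RatFunc F) p) (algebraMap _ (RatFunc F) q)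

lemma ratFunc_ne_zero {p : F[X]} (hp : p ≠ 0) : algebraMap F[X] (RatFunc F) p ≠ 0 := by
  simpa using hp

lemma psym_mul_left {p q : F[X]} (hp : p ≠ 0) (hq : q ≠ 0) (r : F[X]) :
    psym ℓ (p * q) r = psym ℓ p r + psym ℓ q r := by
  rw [psym, map_mul, sym_mul_left (ratFunc_ne_zero hp) (ratFunc_ne_zero hq)]; rfl

lemma psym_mul_right (r : F[X]) {p q : F[X]} (hp : p ≠ 0) (hq : q ≠ 0) :
    psym ℓ r (p * q) = psym ℓ r p + psym ℓ r q := by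
  rw [psym, map_mul, sym_mul_right _ (ratFunc_ne_zero hp) (ratFunc_ne_zero hq)]; rfl

lemma psym_swap (p q : F[X]) : psym ℓ p q = - psym ℓ q p := sym_swap _ _

lemma psym_zero_right (p : F[X]) : psym ℓ p 0 = 0 := by
  rw [psym, map_zero, sym_zero_right]

lemma psym_zero_left (p : F[X]) : psym ℓ 0 p = 0 := by
  rw [psym, map_zero, sym_zero_left]

lemma psym_one_right (p : F[X]) : psym ℓ p 1 = 0 := by
  rw [psym, map_one, sym_one_right]

lemma psym_self (p : F[X]) : psym ℓ p p = psym ℓ p (-1) := by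
  rw [psym, sym_self, psym, map_neg, map_one]

/-- The Steinberg relation for `x + y = z`. -/
lemma psym_of_add {x y z : F[X]} (hx : x ≠ 0) (hy : y ≠ 0) (hz : z ≠ 0) (h : x + y = z) :
    psym ℓ x y - psym ℓ x z - psym ℓ z y + psym ℓ z z = 0 := by
  have hz' := ratFunc_ne_zero hz
  have := sym_steinberg (ℓ := ℓ) (a := algebraMap F[X] (RatFunc F) x / algebraMap _ _ z)
    (b := algebraMap F[X] (RatFunc F) y / algebraMap _ _ z) (by
      rw [← add_div, ← map_add, h, div_self hz'])
  rw [sym_div_left (ratFunc_ne_zero hx) hz', sym_div_right _ (ratFunc_ne_zero hy) hz',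
    sym_div_right _ (ratFunc_ne_zero hy) hz'] at this
  rw [← this]; unfold psym; abel

/-- The filtration of `k_2(F(T))` by degree. -/
def milnorFil (ℓ : ℕ) (F : Type*) [Field F] (d : ℕ) : Submodule ℤ (MilnorKMod ℓ 2 (RatFunc F)) :=
  Submodule.span ℤ {x | ∃ p q : F[X], p.natDegree ≤ d ∧ q.natDegree ≤ d ∧ x = psym ℓ p q}

lemma psym_mem_milnorFil {d : ℕ} {p q : F[X]} (hp : p.natDegree ≤ d) (hq : q.natDegree ≤ d) :
    psym ℓ p q ∈ milnorFil ℓ F d :=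
  Submodule.subset_span ⟨p, q, hp, hq, rfl⟩

lemma not_dvd_of_natDegree_le {P g : F[X]} {e : ℕ} (hPd : P.natDegree = e + 1) (hg : g ≠ 0)
    (hgd : g.natDegree ≤ e) : ¬ P ∣ g := fun h => by
  have := natDegree_le_of_dvd h hg
  omega

lemma psym_reduce {P u v : F[X]} {e : ℕ} (hP : Irreducible P) (hPm : P.Monic)
    (hPd : P.natDegree = e + 1) (hu : u ≠ 0) (hv : v ≠ 0) (hud : u.natDegree ≤ e)
    (hvd : v.natDegree ≤ e) : ∃ r : F[X], r ≠ 0 ∧ r.natDegree ≤ e ∧ P ∣ u * v - r ∧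
      psym ℓ P (u * v) - psym ℓ P r ∈ milnorFil ℓ F e := by
  have hdm := modByMonic_add_div (u * v) P
  set r := (u * v) %ₘ P with hr
  set q := (u * v) /ₘ P with hq
  have hPuv : ¬ P ∣ u * v := fun h => by
    rcases hP.prime.dvd_or_dvd h with h | h
    · exact not_dvd_of_natDegree_le hPd hu hud h
    · exact not_dvd_of_natDegree_le hPd hv hvd h
  have hr0 : r ≠ 0 := by
    intro h0
    rw [h0, zero_add] at hdm
    exact hPuv ⟨q, hdm.symm⟩
  have hrd : r.natDegree ≤ e := by
    have := natDegree_modByMonic_lt (u * v) hPm (by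
      rintro rfl; simp at hPd)
    rw [← hr] at this
    omega
  refine ⟨r, hr0, hrd, ⟨q, by rw [← hdm]; ring⟩, ?_⟩
  have hqd : q.natDegree ≤ e := by
    rw [hq, natDegree_divByMonic _ hPm, hPd, natDegree_mul hu hv]; omega
  by_cases hq0 : q = 0
  · have : u * v = r := by rw [← hdm, hq0]; ring
    rw [this, sub_self]; exact zero_mem _
  have huv := mul_ne_zero hu hv
  have hst := psym_of_add (ℓ := ℓ) hr0 (mul_ne_zero hP.ne_zero hq0) huv hdm
  rw [psym_mul_right _ hP.ne_zero hq0, psym_mul_right _ hP.ne_zero hq0,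
    psym_swap r P, psym_swap (u * v) P, psym_mul_left hu hv q, psym_mul_right r hu hv] at hst
  have e1 : psym ℓ (u * v) (u * v) = psym ℓ u (-1) + psym ℓ v (-1) := by
    rw [psym_self, psym_mul_left hu hv]
  rw [e1] at hst
  have e2 : psym ℓ P (u * v) - psym ℓ P r =
      psym ℓ r u + psym ℓ r v + psym ℓ u q + psym ℓ v q - psym ℓ r q
        - psym ℓ u (-1) - psym ℓ v (-1) := by
    rw [← sub_eq_zero, ← hst]; abel
  rw [e2]
  have h1 : (-1 : F[X]).natDegree ≤ e := by simp
  refine sub_mem (sub_mem (sub_mem (add_mem (add_mem (add_mem ?_ ?_) ?_) ?_) ?_) ?_) ?_ <;>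
    exact psym_mem_milnorFil (by assumption) (by assumption)

lemma psym_reduce_pow {P h : F[X]} {e : ℕ} (hP : Irreducible P) (hPm : P.Monic)
    (hPd : P.natDegree = e + 1) (hh : h ≠ 0) (hd : h.natDegree ≤ e) (n : ℕ) :
    ∃ r : F[X], r ≠ 0 ∧ r.natDegree ≤ e ∧ P ∣ h ^ n - r ∧
      psym ℓ P r - n • psym ℓ P h ∈ milnorFil ℓ F e := by
  induction n with
  | zero => exact ⟨1, one_ne_zero, by simp, by simp, by simp [psym_one_right]⟩
  | succ n ih =>
    obtain ⟨r, hr0, hrd, hdvd, hmem⟩ := ih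
    obtain ⟨s, hs0, hsd, hdvd', hmem'⟩ := psym_reduce (ℓ := ℓ) hP hPm hPd hr0 hh hrd hd
    refine ⟨s, hs0, hsd, ?_, ?_⟩
    · have : h ^ (n + 1) - s = (h ^ n - r) * h + (r * h - s) := by ring
      rw [this]
      exact dvd_add (hdvd.mul_right _) hdvd'
    · rw [psym_mul_right _ hr0 hh] at hmem'
      have : psym ℓ P s - (n + 1) • psym ℓ P h = (psym ℓ P r - n • psym ℓ P h) -
          (psym ℓ P r + psym ℓ P h - psym ℓ P s) := by
        rw [succ_nsmul]; abel
      rw [this]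
      exact sub_mem hmem hmem'

/-- The subgroup of symbols `{P, g}` modulo lower filtration. -/
def residuePart (ℓ : ℕ) (hℓ : ℓ ≠ 0) {F : Type*} [Field F] (e : ℕ) (P : F[X]) (hP : Irreducible P)
    (hPm : P.Monic) (hPd : P.natDegree = e + 1) : Submodule ℤ (MilnorKMod ℓ 2 (RatFunc F)) :=
  let S : AddSubmonoid (MilnorKMod ℓ 2 (RatFunc F)) :=
    { carrier := {x | ∃ g : F[X], g ≠ 0 ∧ g.natDegree ≤ e ∧ x - psym ℓ P g ∈ milnorFil ℓ F e}
      zero_mem' := ⟨1, one_ne_zero, by simp, by simp [psym_one_right]⟩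
      add_mem' := by
        rintro x y ⟨g, hg, hgd, hx⟩ ⟨g', hg', hgd', hy⟩
        obtain ⟨r, hr0, hrd, -, hr⟩ := psym_reduce (ℓ := ℓ) hP hPm hPd hg hg' hgd hgd'
        refine ⟨r, hr0, hrd, ?_⟩
        rw [psym_mul_right _ hg hg'] at hr
        have : x + y - psym ℓ P r = (x - psym ℓ P g) + (y - psym ℓ P g') +
          (psym ℓ P g + psym ℓ P g' - psym ℓ P r) := by abel
        rw [this]
        exact add_mem (add_mem hx hy) hr }
  AddSubgroup.toIntSubmodule { S with
    neg_mem' := by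
      intro x hx
      have h1 := S.nsmul_mem hx (ℓ - 1)
      have h2 : (ℓ - 1) • x = -x := by
        rw [eq_neg_iff_add_eq_zero, ← succ_nsmul,
          Nat.sub_add_cancel (Nat.one_le_iff_ne_zero.mpr hℓ), MilnorKMod.nsmul_eq_zero]
      rw [h2] at h1
      exact h1 }

lemma mem_residuePart {hℓ : ℓ ≠ 0} {e : ℕ} {P : F[X]} {hP : Irreducible P}
    {hPm : P.Monic} {hPd : P.natDegree = e + 1} {x : MilnorKMod ℓ 2 (RatFunc F)} :
    x ∈ residuePart ℓ hℓ e P hP hPm hPd ↔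
      ∃ g : F[X], g ≠ 0 ∧ g.natDegree ≤ e ∧ x - psym ℓ P g ∈ milnorFil ℓ F e := Iff.rfl

lemma exists_factor_of_not_irreducible {p : F[X]} {e : ℕ} (hp : p.natDegree = e + 1)
    (hirr : ¬ Irreducible p) : ∃ a b : F[X], a ≠ 0 ∧ b ≠ 0 ∧ p = a * b ∧ a.natDegree ≤ e ∧
      b.natDegree ≤ e := by
  have hp0 : p ≠ 0 := by rintro rfl; simp at hp
  have hnu : ¬ IsUnit p := fun h => by
    have := natDegree_eq_zero_of_isUnit h; omega
  rw [irreducible_iff] at hirr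
  push Not at hirr
  obtain ⟨a, b, hab, ha, hb⟩ := hirr hnu
  have ha0 : a ≠ 0 := by rintro rfl; simp at hab; exact hp0 hab
  have hb0 : b ≠ 0 := by rintro rfl; simp at hab; exact hp0 hab
  have hpos : ∀ c : F[X], c ≠ 0 → ¬ IsUnit c → 0 < c.natDegree := by
    intro c hc hcu
    rw [Nat.pos_iff_ne_zero]
    intro h0
    apply hcu
    rw [eq_C_of_natDegree_eq_zero h0] at hc ⊢
    exact isUnit_C.mpr (isUnit_iff_ne_zero.mpr (by simpa using hc))
  have h1 := hpos a ha0 ha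
  have h2 := hpos b hb0 hb
  have h3 : p.natDegree = a.natDegree + b.natDegree := by rw [hab, natDegree_mul ha0 hb0]
  exact ⟨a, b, ha0, hb0, hab, by omega, by omega⟩

lemma milnorFil_succ_le (hℓ : ℓ ≠ 0) (e : ℕ) : milnorFil ℓ F (e + 1) ≤ milnorFil ℓ F e ⊔
    ⨆ P : {P : F[X] // Irreducible P ∧ P.Monic ∧ P.natDegree = e + 1},
      residuePart ℓ hℓ e P.1 P.2.1 P.2.2.1 P.2.2.2 := by
  set W := milnorFil ℓ F e ⊔
    ⨆ P : {P : F[X] // Irreducible P ∧ P.Monic ∧ P.natDegree = e + 1},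
      residuePart ℓ hℓ e P.1 P.2.1 P.2.2.1 P.2.2.2 with hW
  have hV : ∀ {p q : F[X]}, p.natDegree ≤ e → q.natDegree ≤ e → psym ℓ p q ∈ W :=
    fun hp hq => (le_sup_left : _ ≤ W) (psym_mem_milnorFil hp hq)
  have h1 : ∀ p q : F[X], p.natDegree ≤ e + 1 → q.natDegree ≤ e → psym ℓ p q ∈ W := by
    intro p q hp hq
    rcases Nat.lt_or_ge p.natDegree (e + 1) with h | h
    · exact hV (by omega) hq
    have hp' : p.natDegree = e + 1 := by omega
    have hp0 : p ≠ 0 := by rintro rfl; simp at hp'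
    by_cases hq0 : q = 0
    · rw [hq0, psym_zero_right]; exact zero_mem _
    by_cases hirr : Irreducible p
    · have hlc : p.leadingCoeff ≠ 0 := leadingCoeff_ne_zero.mpr hp0
      set P := p * C (p.leadingCoeff)⁻¹ with hPdef
      have e1 : p = P * C p.leadingCoeff := by
        rw [hPdef, mul_assoc, ← C_mul, inv_mul_cancel₀ hlc, C_1, mul_one]
      have hPirr : Irreducible P := irreducible_mul_leadingCoeff_inv.mpr hirr
      have hPm : P.Monic := monic_mul_leadingCoeff_inv hp0
      have hPd : P.natDegree = e + 1 := by
        rw [hPdef, natDegree_mul_C (inv_ne_zero hlc), hp']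
      rw [e1, psym_mul_left hPirr.ne_zero (by simpa using hp0)]
      refine add_mem ?_ (hV (by simp) hq)
      refine (le_sup_right : _ ≤ W) ?_
      refine (le_iSup (fun P : {P : F[X] // Irreducible P ∧ P.Monic ∧ P.natDegree = e + 1} =>
        residuePart ℓ hℓ e P.1 P.2.1 P.2.2.1 P.2.2.2) ⟨P, hPirr, hPm, hPd⟩) ?_
      exact mem_residuePart.mpr ⟨q, hq0, hq, by rw [sub_self]; exact zero_mem _⟩
    · obtain ⟨a, b, ha, hb, rfl, had, hbd⟩ := exists_factor_of_not_irreducible hp' hirr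
      rw [psym_mul_left ha hb]
      exact add_mem (hV had hq) (hV hbd hq)
  have h2 : ∀ p q : F[X], p.natDegree ≤ e → q.natDegree ≤ e + 1 → psym ℓ p q ∈ W := by
    intro p q hp hq
    rw [psym_swap]
    exact neg_mem (h1 _ _ hq hp)
  have hs : milnorFil ℓ F (e + 1) = Submodule.span ℤ {x | ∃ p q : F[X],
    p.natDegree ≤ e + 1 ∧ q.natDegree ≤ e + 1 ∧ x = psym ℓ p q} := rfl
  rw [hs, Submodule.span_le]
  rintro x ⟨p, q, hp, hq, rfl⟩
  rw [SetLike.mem_coe]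
  rcases Nat.lt_or_ge p.natDegree (e + 1) with h | h
  · exact h2 p q (by omega) hq
  rcases Nat.lt_or_ge q.natDegree (e + 1) with h' | h'
  · exact h1 p q hp (by omega)
  have hp' : p.natDegree = e + 1 := by omega
  have hq' : q.natDegree = e + 1 := by omega
  have hp0 : p ≠ 0 := by rintro rfl; simp at hp'
  have hq0 : q ≠ 0 := by rintro rfl; simp at hq'
  set c := q.leadingCoeff / p.leadingCoeff with hc
  have hc0 : c ≠ 0 := div_ne_zero (leadingCoeff_ne_zero.mpr hq0) (leadingCoeff_ne_zero.mpr hp0)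
  have hC0 : C c ≠ 0 := by simpa using hc0
  set r := q - C c * p with hr
  have hrd : r.natDegree ≤ e := by
    by_cases hr0 : r = 0
    · simp [hr0]
    have : r.degree < q.degree := by
      apply degree_sub_lt_left _ hq0 _
      · rw [degree_C_mul hc0, degree_eq_natDegree hp0, degree_eq_natDegree hq0, hp', hq']
      · rw [leadingCoeff_mul, leadingCoeff_C, hc, div_mul_cancel₀]
        exact leadingCoeff_ne_zero.mpr hp0
    have := (natDegree_lt_natDegree_iff hr0).mpr this
    omega
  have hneg1 : (-1 : F[X]).natDegree ≤ e := by simp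
  by_cases hr0 : r = 0
  · have : q = C c * p := by rw [← sub_eq_zero]; exact hr0
    rw [this, psym_mul_right _ hC0 hp0, psym_self]
    exact add_mem (h1 _ _ hp (by simp)) (h1 _ _ hp hneg1)
  · have hst := psym_of_add (ℓ := ℓ) hr0 (mul_ne_zero hC0 hp0) hq0 (by rw [hr]; ring)
    rw [psym_mul_right q hC0 hp0, psym_swap q p, psym_self] at hst
    have : psym ℓ p q = -(psym ℓ r (C c * p) - psym ℓ r q - psym ℓ q (C c) + psym ℓ q (-1)) := by
      rw [← sub_eq_zero, ← hst]; abel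
    rw [this]
    refine neg_mem (add_mem (sub_mem (sub_mem (h2 _ _ hrd ?_) (h2 _ _ hrd hq)) (h1 _ _ hq ?_))
      (h1 _ _ hq hneg1))
    · rw [natDegree_C_mul hc0]; exact hp
    · simp

/-- Elements of `k_2(F(T))` with trivial residues come from the bottom of the filtration. -/
lemma mem_milnorFil_zero [Fact ℓ.Prime] (hF : (ℓ : F) ≠ 0) (hneg : ∃ z : F, z ^ ℓ = -1) :
    ∃ N : F[X] → AddSubgroup (MilnorKMod ℓ 2 (RatFunc F)),
      (∀ P, Irreducible P → ∀ f g : F[X], ¬ P ∣ f → ¬ P ∣ g → psym ℓ f g ∈ N P) ∧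
      (∀ P, Irreducible P → ∀ g : F[X], ¬ P ∣ g →
        (psym ℓ P g ∈ N P ↔ ∃ h : F[X], P ∣ g - h ^ ℓ)) ∧
      (∀ d, ∀ ξ ∈ milnorFil ℓ F d, (∀ P, Irreducible P → P.Monic → ξ ∈ N P) →
        ξ ∈ milnorFil ℓ F 0) := by
  classical
  have hℓ : ℓ ≠ 0 := (Fact.out : ℓ.Prime).ne_zero
  choose! N hN1 hN2 using (exists_residue (ℓ := ℓ) hF hneg)
  refine ⟨N, hN1, hN2, fun d => ?_⟩
  induction d with
  | zero => intro ξ hξ _; exact hξ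
  | succ e ih =>
    intro ξ hξ hres
    refine ih ξ ?_ hres
    obtain ⟨v, hv, w, hw, rfl⟩ := Submodule.mem_sup.mp (milnorFil_succ_le hℓ e hξ)
    rw [Submodule.mem_iSup_iff_exists_finsupp] at hw
    obtain ⟨f, hf, rfl⟩ := hw
    refine add_mem hv (Submodule.sum_mem _ fun P _ => ?_)
    have hVN : ∀ P : F[X], Irreducible P → P.natDegree = e + 1 → ∀ x ∈ milnorFil ℓ F e, x ∈ N P :=
        by
      intro P hP hPd x hx
      have : milnorFil ℓ F e ≤ AddSubgroup.toIntSubmodule (N P) := by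
        unfold milnorFil
        rw [Submodule.span_le]
        rintro x ⟨p, q, hp, hq, rfl⟩
        by_cases hp0 : p = 0
        · rw [hp0, psym_zero_left]; exact zero_mem _
        by_cases hq0 : q = 0
        · rw [hq0, psym_zero_right]; exact zero_mem _
        exact hN1 P hP p q (not_dvd_of_natDegree_le hPd hp0 hp) (not_dvd_of_natDegree_le hPd hq0 hq)
      exact this hx
    have hother : ∀ Q : {P : F[X] // Irreducible P ∧ P.Monic ∧ P.natDegree = e + 1}, Q ≠ P →
        f Q ∈ N P.1 := by
      intro Q hQ
      obtain ⟨g, hg0, hgd, hg⟩ := mem_residuePart.mp (hf Q)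
      have h1 := hVN P.1 P.2.1 P.2.2.2 _ hg
      have h2 : psym ℓ Q.1 g ∈ N P.1 := by
        refine hN1 P.1 P.2.1 Q.1 g (fun hd => hQ ?_) (not_dvd_of_natDegree_le P.2.2.2 hg0 hgd)
        have := (P.2.1.associated_of_dvd Q.2.1 hd)
        exact Subtype.ext (eq_of_monic_of_associated Q.2.2.1 P.2.2.1 this.symm)
      have := add_mem h1 h2
      rwa [sub_add_cancel] at this
    have hfP : f P ∈ N P.1 := by
      have h1 := hres P.1 P.2.1 P.2.2.1
      have h2 := hVN P.1 P.2.1 P.2.2.2 _ hv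
      have h3 : f.sum (fun _ x => x) ∈ N P.1 := by
        have := sub_mem h1 h2
        rwa [add_sub_cancel_left] at this
      by_cases hsupp : P ∈ f.support
      · rw [Finsupp.sum, ← Finset.add_sum_erase _ _ hsupp] at h3
        have h4 : ∑ x ∈ f.support.erase P, f x ∈ N P.1 :=
          sum_mem fun Q hQ => hother Q (Finset.ne_of_mem_erase hQ)
        have := sub_mem h3 h4
        rwa [add_sub_cancel_right] at this
      · rw [Finsupp.notMem_support_iff.mp hsupp]; exact zero_mem _
    obtain ⟨g, hg0, hgd, hg⟩ := mem_residuePart.mp (hf P)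
    have h5 : psym ℓ P.1 g ∈ N P.1 := by
      have := sub_mem hfP (hVN P.1 P.2.1 P.2.2.2 _ hg)
      rwa [sub_sub_cancel] at this
    have hPg := not_dvd_of_natDegree_le P.2.2.2 hg0 hgd
    obtain ⟨h, hh⟩ := (hN2 P.1 P.2.1 g hPg).mp h5
    set h' := h %ₘ P.1 with hh'
    have hd : P.1 ∣ h ^ ℓ - h' ^ ℓ := by
      refine dvd_trans ?_ (sub_dvd_pow_sub_pow _ _ ℓ)
      exact ⟨h /ₘ P.1, by rw [hh', sub_eq_iff_eq_add, add_comm, modByMonic_add_div]⟩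
    have hgh' : P.1 ∣ g - h' ^ ℓ := by
      have := dvd_add hh hd
      rwa [sub_add_sub_cancel] at this
    have hh0 : h' ≠ 0 := by
      intro h0
      rw [h0, zero_pow hℓ, sub_zero] at hgh'
      exact hPg hgh'
    have hh'd : h'.natDegree ≤ e := by
      have := natDegree_modByMonic_lt h P.2.2.1 (fun h => by
        have := P.2.2.2; rw [h] at this; simp at this)
      rw [← hh'] at this
      have := P.2.2.2
      omega
    obtain ⟨r, hr0, hrd, hrdvd, hr⟩ := psym_reduce_pow (ℓ := ℓ) P.2.1 P.2.2.1 P.2.2.2 hh0 hh'd ℓ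
    have hgr : g = r := by
      have h6 : P.1 ∣ g - r := by
        have := dvd_add hgh' hrdvd
        rwa [sub_add_sub_cancel] at this
      by_contra hne
      refine not_dvd_of_natDegree_le P.2.2.2 (sub_ne_zero.mpr hne) ?_ h6
      exact (natDegree_sub_le _ _).trans (max_le hgd hrd)
    rw [MilnorKMod.nsmul_eq_zero, sub_zero, ← hgr] at hr
    have := add_mem hg hr
    rwa [sub_add_cancel] at this

/-- Evaluation of polynomials at `π⁻¹`. -/
def expandInfty (F : Type*) [Field F] : F[X] →+* LaurentSeries F :=
  eval₂RingHom HahnSeries.C (HahnSeries.single (-1 : ℤ) (1 : F))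

lemma expandInfty_coeff (p : F[X]) (n : ℕ) : (expandInfty F p).coeff (-(n : ℤ)) = p.coeff n := by
  induction p using Polynomial.induction_on' with
  | add p q hp hq => rw [map_add, HahnSeries.coeff_add, hp, hq, coeff_add]
  | monomial m a =>
    simp only [expandInfty, coe_eval₂RingHom, eval₂_monomial, HahnSeries.single_pow, one_pow]
    rw [HahnSeries.C_mul_eq_smul, HahnSeries.coeff_smul, coeff_monomial]
    by_cases h : m = n
    · subst h; simp
    · rw [HahnSeries.coeff_single_of_ne (by simp; omega), if_neg h, smul_zero]

lemma expandInfty_injective : Function.Injective (expandInfty F) := by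
  intro p q h
  ext n
  rw [← expandInfty_coeff, ← expandInfty_coeff, h]

lemma expandInfty_leadingCoeff {p : F[X]} (hp : p ≠ 0) :
    (expandInfty F p).leadingCoeff = p.leadingCoeff := by
  have h := order_lc_of_coeff (expandInfty F p) (-(p.natDegree : ℤ))
    (by rw [expandInfty_coeff]; exact leadingCoeff_ne_zero.mpr hp) (by
      intro m hm
      obtain ⟨n, rfl⟩ : ∃ n : ℕ, m = -(n : ℤ) := ⟨(-m).toNat, by omega⟩
      rw [expandInfty_coeff]
      exact coeff_eq_zero_of_natDegree_lt (by omega))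
  rw [h.2, expandInfty_coeff]; rfl

/-- If `a` becomes an `ℓ`-th power in `F[T]/P`, then `{a, P(0)} = 0`. -/
lemma sym_eq_zero_of_isPow_mod [Fact ℓ.Prime] (hF : (ℓ : F) ≠ 0) (hneg : ∃ z : F, z ^ ℓ = -1)
    {P : F[X]} (hP : Irreducible P) (hPm : P.Monic) (hP0 : P.eval 0 ≠ 0) {a : F} (ha : a ≠ 0)
    {h : F[X]} (hh : P ∣ C a - h ^ ℓ) : sym ℓ a (P.eval 0) = 0 := by
  obtain ⟨N, hN1, hN2, hN⟩ := mem_milnorFil_zero (ℓ := ℓ) hF hneg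
  have hCa : ∀ Q : F[X], Irreducible Q → ¬ Q ∣ C a := fun Q hQ hd => by
    have : IsUnit (C a) := isUnit_C.mpr (isUnit_iff_ne_zero.mpr ha)
    exact hQ.not_isUnit (isUnit_of_dvd_unit hd this)
  have h0 := hN P.natDegree (psym ℓ (C a) P) (psym_mem_milnorFil (by simp) le_rfl) (by
    intro Q hQ hQm
    by_cases hd : Q ∣ P
    · have := hQ.associated_of_dvd hP hd
      have hQP := eq_of_monic_of_associated hQm hPm this
      rw [hQP, psym_swap]
      exact neg_mem ((hN2 P hP (C a) (hCa P hP)).mpr ⟨h, hh⟩)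
    · exact hN1 Q hQ _ _ (hCa Q hQ) hd)
  obtain ⟨s, hs⟩ := exists_spec_of_hom ℓ (ratExpandAt (RingHom.id F) 0)
  obtain ⟨t, ht⟩ := exists_spec_of_hom ℓ
    (IsFractionRing.lift (K := RatFunc F) (expandInfty_injective (F := F)))
  have hsp : ∀ p : F[X], p.eval 0 ≠ 0 →
      (ratExpandAt (RingHom.id F) 0 (algebraMap _ _ p)).leadingCoeff = p.eval 0 := by
    intro p hp
    rw [ratExpandAt_algebraMap]
    have := (taylor_order_lc_of_eval_ne_zero (0 : F) (p.map (RingHom.id F)) (by simpa using hp)).2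
    rw [this]; simp
  have htp : ∀ p : F[X], p ≠ 0 → (IsFractionRing.lift (K := RatFunc F)
      (expandInfty_injective (F := F)) (algebraMap _ _ p)).leadingCoeff = p.leadingCoeff := by
    intro p hp
    rw [IsFractionRing.lift_algebraMap, expandInfty_leadingCoeff hp]
  have hst : ∀ ξ ∈ milnorFil ℓ F 0, s ξ = t ξ := by
    intro ξ hξ
    refine Submodule.span_induction ?_ ?_ ?_ ?_ hξ
    · rintro x ⟨p, q, hp, hq, rfl⟩
      by_cases hp0 : p = 0
      · simp [hp0, psym_zero_left]
      by_cases hq0 : q = 0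
      · simp [hq0, psym_zero_right]
      have e1 := eq_C_of_natDegree_le_zero hp
      have e2 := eq_C_of_natDegree_le_zero hq
      have n1 : p.coeff 0 ≠ 0 := fun h => hp0 (by rw [e1, h, C_0])
      have n2 : q.coeff 0 ≠ 0 := fun h => hq0 (by rw [e2, h, C_0])
      have e3 : p.leadingCoeff = p.eval 0 := by rw [e1]; simp
      have e4 : q.leadingCoeff = q.eval 0 := by rw [e2]; simp
      rw [psym, hs _ _ (ratFunc_ne_zero hp0) (ratFunc_ne_zero hq0),
        ht _ _ (ratFunc_ne_zero hp0) (ratFunc_ne_zero hq0), hsp, hsp, htp _ hp0, htp _ hq0, e3, e4]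
      · rw [← coeff_zero_eq_eval_zero]; exact n2
      · rw [← coeff_zero_eq_eval_zero]; exact n1
    · simp
    · intro x y _ _ hx hy; rw [map_add, map_add, hx, hy]
    · intro z x _ hx; rw [map_zsmul, map_zsmul, hx]
  have hCa0 : (C a : F[X]) ≠ 0 := by simpa using ha
  have := hst _ h0
  rw [psym, hs _ _ (ratFunc_ne_zero hCa0) (ratFunc_ne_zero hP.ne_zero),
    ht _ _ (ratFunc_ne_zero hCa0) (ratFunc_ne_zero hP.ne_zero), hsp _ hP0,
    hsp _ (by simpa using ha), htp _ hCa0, htp _ hP.ne_zero, hPm.leadingCoeff, sym_one_right,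
    eval_C] at this
  exact this

end MilnorFiltration

end

section CommonZero
open MvPolynomial

variable {k : Type*} [Field k] {σ : Type*}

lemma height_vanishingIdeal_singleton (x y : σ → k) :
    (vanishingIdeal k {x}).height = (vanishingIdeal k {y}).height := by
  let e : MvPolynomial σ k ≃ₐ[k] MvPolynomial σ k :=
    AlgEquiv.ofAlgHom (aeval fun i => X i + C (y i - x i)) (aeval fun i => X i - C (y i - x i))
      (by ext i; simp [algebraMap_eq]) (by ext i; simp [algebraMap_eq])
  rw [← RingEquiv.height_comap e.toRingEquiv]
  congr 1
  ext p
  simp only [Ideal.mem_comap, mem_vanishingIdeal_singleton_iff]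
  have : ∀ p : MvPolynomial σ k, aeval x (e p) = aeval y p := by
    intro p
    have : (aeval x).comp e.toAlgHom = aeval y := by
      ext i; simp [e]
    exact DFunLike.congr_fun this p
  rw [← this p]; rfl

variable [IsAlgClosed k] [Finite σ]

lemma card_le_height_vanishingIdeal_singleton (x : σ → k) :
    (Nat.card σ : ℕ∞) ≤ (vanishingIdeal k {x}).height := by
  have h : ringKrullDim (MvPolynomial σ k) ≤ ((vanishingIdeal k {x}).height : WithBot ℕ∞) := by
    rw [ringKrullDim_le_iff_isMaximal_height_le]
    intro I hI
    obtain ⟨y, rfl⟩ := eq_vanishingIdeal_singleton_of_isMaximal k hI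
    rw [height_vanishingIdeal_singleton y x]
  rw [MvPolynomial.ringKrullDim_of_isNoetherianRing, ringKrullDim_eq_zero_of_field, zero_add] at h
  exact_mod_cast h

/-- Fewer equations than unknowns: polynomials vanishing at the origin have another common zero. -/
lemma exists_common_zero_ne_zero (S : Finset (MvPolynomial σ k)) (hS : S.card < Nat.card σ)
    (h0 : ∀ p ∈ S, eval 0 p = 0) : ∃ u : σ → k, u ≠ 0 ∧ ∀ p ∈ S, eval u p = 0 := by
  by_contra! hcon
  have hz : zeroLocus k (Ideal.span (S : Set (MvPolynomial σ k))) = {0} := by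
    ext u
    rw [zeroLocus_span]
    simp only [Set.mem_ofPred_eq, Set.mem_singleton_iff]
    constructor
    · intro hu
      by_contra hne
      obtain ⟨p, hp, hpu⟩ := hcon u hne
      exact hpu (by simpa [aeval_eq_eval] using hu p hp)
    · rintro rfl p hp
      simpa [aeval_eq_eval] using h0 p hp
  have hrad := vanishingIdeal_zeroLocus_eq_radical (K := k)
    (Ideal.span (S : Set (MvPolynomial σ k)))
  rw [hz] at hrad
  have hmin : vanishingIdeal k {(0 : σ → k)} ∈
      (Ideal.span (S : Set (MvPolynomial σ k))).minimalPrimes := by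
    rw [← Ideal.radical_minimalPrimes, ← hrad, Ideal.minimalPrimes_eq_subsingleton_self]
    rfl
  have h1 := Ideal.height_le_card_of_mem_minimalPrimes_span_finset hmin
  have h2 := (card_le_height_vanishingIdeal_singleton (0 : σ → k)).trans h1
  have : Nat.card σ ≤ S.card := by exact_mod_cast h2
  omega

end CommonZero

section TsenLang
open Polynomial

variable {k : Type*} [Field k] {L : Type*} [Field L] [Algebra k[X] L] {n : ℕ}

/-- A family of maps into `L` which, up to a common denominator, have coordinates
in `k[X]` of degree at most `r * m + C` with coefficients polynomial in the parameters. -/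
def IsPolyFam (e : Fin n → L) {σ : ℕ → Type*} (r : ℕ) (G : ∀ m, (σ m → k) → L) : Prop :=
  ∃ D : ℕ, ∃ s : k[X], s ≠ 0 ∧ ∀ m, ∃ g : Fin n → (MvPolynomial (σ m) k)[X],
    (∀ i, (g i).natDegree ≤ r * m + D) ∧
    ∀ u, s • G m u = ∑ i, ((g i).map (MvPolynomial.eval u)) • e i

/-- `e` generates `L` over `k[X]` up to denominators. -/
def DenomSpans (k : Type*) [Field k] {L : Type*} [Field L] [Algebra k[X] L] {n : ℕ}
    (e : Fin n → L) : Prop :=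
  ∀ x : L, ∃ s : k[X], s ≠ 0 ∧ ∃ c : Fin n → k[X], s • x = ∑ i, c i • e i

lemma DenomSpans.family {e : Fin n → L} (he : DenomSpans k e) {ι : Type*} [Fintype ι]
    (x : ι → L) : ∃ s : k[X], s ≠ 0 ∧ ∃ c : ι → Fin n → k[X], ∀ j, s • x j = ∑ i, c j i • e i := by
  classical
  choose s hs c hc using fun j => he (x j)
  refine ⟨∏ j, s j, Finset.prod_ne_zero_iff.mpr fun j _ => hs j,
    fun j i => (∏ l ∈ Finset.univ.erase j, s l) * c j i, fun j => ?_⟩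
  rw [← Finset.prod_erase_mul _ _ (Finset.mem_univ j), mul_smul, hc, Finset.smul_sum]
  simp [mul_smul]

variable {e : Fin n → L} {σ : ℕ → Type*} {r r' : ℕ} {G G' : ∀ m, (σ m → k) → L}

lemma IsPolyFam.mono (h : IsPolyFam e r G) (hr : r ≤ r') : IsPolyFam e r' G := by
  obtain ⟨D, s, hs, h⟩ := h
  refine ⟨D, s, hs, fun m => ?_⟩
  obtain ⟨g, hg, h⟩ := h m
  exact ⟨g, fun i => (hg i).trans (by gcongr), h⟩

lemma IsPolyFam.const (he : DenomSpans k e) (x : L) : IsPolyFam e 0 (fun m (_ : σ m → k) => x) := by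
  obtain ⟨s, hs, c, hc⟩ := he x
  refine ⟨Finset.univ.sup fun i => (c i).natDegree, s, hs, fun m =>
    ⟨fun i => (c i).map MvPolynomial.C, fun i => ?_, fun u => ?_⟩⟩
  · refine natDegree_map_le.trans ?_
    have := Finset.le_sup (f := fun i => (c i).natDegree) (Finset.mem_univ i)
    simpa using this
  · rw [hc]
    refine Finset.sum_congr rfl fun i _ => ?_
    rw [Polynomial.map_map]
    congr 1
    ext j
    simp

lemma IsPolyFam.add (h : IsPolyFam e r G) (h' : IsPolyFam e r G') :
    IsPolyFam e r (fun m u => G m u + G' m u) := by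
  obtain ⟨D, s, hs, h⟩ := h
  obtain ⟨D', s', hs', h'⟩ := h'
  refine ⟨max (s'.natDegree + D) (s.natDegree + D'), s * s', mul_ne_zero hs hs', fun m => ?_⟩
  obtain ⟨g, hg, h⟩ := h m
  obtain ⟨g', hg', h'⟩ := h' m
  refine ⟨fun i => s'.map MvPolynomial.C * g i + s.map MvPolynomial.C * g' i, fun i => ?_,
    fun u => ?_⟩
  · refine (natDegree_add_le _ _).trans (max_le ?_ ?_)
    · refine natDegree_mul_le.trans ?_
      have h1 : (s'.map (MvPolynomial.C (σ := σ m))).natDegree ≤ s'.natDegree := natDegree_map_le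
      have h2 := hg i
      have := le_max_left (s'.natDegree + D) (s.natDegree + D')
      omega
    · refine natDegree_mul_le.trans ?_
      have h1 : (s.map (MvPolynomial.C (σ := σ m))).natDegree ≤ s.natDegree := natDegree_map_le
      have h2 := hg' i
      have := le_max_right (s'.natDegree + D) (s.natDegree + D')
      omega
  · have hC : ∀ p : k[X], (p.map MvPolynomial.C).map (MvPolynomial.eval u) = p := fun p => by
      ext j; simp
    rw [smul_add, mul_comm s, mul_smul, h, mul_comm s', mul_smul, h', Finset.smul_sum,
      Finset.smul_sum, ← Finset.sum_add_distrib]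
    refine Finset.sum_congr rfl fun i _ => ?_
    rw [Polynomial.map_add, Polynomial.map_mul, Polynomial.map_mul, hC, hC, add_smul, mul_smul,
      mul_smul]

lemma IsPolyFam.mul (he : DenomSpans k e) (h : IsPolyFam e r G) (h' : IsPolyFam e r' G') :
    IsPolyFam e (r + r') (fun m u => G m u * G' m u) := by
  obtain ⟨D, s, hs, h⟩ := h
  obtain ⟨D', s', hs', h'⟩ := h'
  obtain ⟨t, ht, c, hc⟩ := he.family (fun p : Fin n × Fin n => e p.1 * e p.2)
  let N := Finset.univ.sup fun q : (Fin n × Fin n) × Fin n => (c q.1 q.2).natDegree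
  have hN : ∀ p l, (c p l).natDegree ≤ N := fun p l =>
    Finset.le_sup (f := fun q : (Fin n × Fin n) × Fin n => (c q.1 q.2).natDegree)
      (Finset.mem_univ (p, l))
  refine ⟨D + D' + N, s * s' * t, mul_ne_zero (mul_ne_zero hs hs') ht, fun m => ?_⟩
  obtain ⟨g, hg, h⟩ := h m
  obtain ⟨g', hg', h'⟩ := h' m
  refine ⟨fun l => ∑ p : Fin n × Fin n, g p.1 * g' p.2 * (c p l).map MvPolynomial.C,
    fun l => ?_, fun u => ?_⟩
  · refine natDegree_sum_le_of_forall_le _ _ fun p _ => ?_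
    refine natDegree_mul_le.trans ?_
    have h1 : ((c p l).map (MvPolynomial.C (σ := σ m))).natDegree ≤ (c p l).natDegree :=
      natDegree_map_le
    have h2 := hN p l
    have h3 : (g p.1 * g' p.2).natDegree ≤ _ := natDegree_mul_le
    have h4 := hg p.1
    have h5 := hg' p.2
    rw [add_mul]
    omega
  · have hC : ∀ p : k[X], (p.map MvPolynomial.C).map (MvPolynomial.eval u) = p := fun p => by
      ext j; simp
    have e1 : (s * s' * t) • (G m u * G' m u) = t • ((s • G m u) * (s' • G' m u)) := by
      rw [smul_mul_smul_comm, smul_smul, mul_comm t]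
    rw [e1, h, h', Finset.sum_mul_sum, ← Finset.sum_product', Finset.univ_product_univ,
      Finset.smul_sum]
    have e2 : ∀ p : Fin n × Fin n, t • (((g p.1).map (MvPolynomial.eval u)) • e p.1 *
        ((g' p.2).map (MvPolynomial.eval u)) • e p.2) = ∑ l, ((g p.1 * g' p.2 *
          (c p l).map MvPolynomial.C).map (MvPolynomial.eval u)) • e l := by
      intro p
      rw [smul_mul_smul_comm, smul_comm, hc, Finset.smul_sum]
      refine Finset.sum_congr rfl fun l _ => ?_
      rw [Polynomial.map_mul, Polynomial.map_mul, hC, mul_smul, mul_smul, mul_smul]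
    simp_rw [e2]
    rw [Finset.sum_comm]
    refine Finset.sum_congr rfl fun l _ => ?_
    rw [← Finset.sum_smul, Polynomial.map_sum]

lemma IsPolyFam.sum (he : DenomSpans k e) {ι : Type*} (S : Finset ι)
    {H : ι → ∀ m, (σ m → k) → L} (h : ∀ i ∈ S, IsPolyFam e r (H i)) :
    IsPolyFam e r (fun m u => ∑ i ∈ S, H i m u) := by
  classical
  induction S using Finset.induction_on with
  | empty => simpa using (IsPolyFam.const he 0).mono (Nat.zero_le r)
  | insert a S ha ih =>
    simp_rw [Finset.sum_insert ha]
    exact (h a (by simp)).add (ih fun i hi => h i (by simp [hi]))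

lemma IsPolyFam.prod (he : DenomSpans k e) {ι : Type*} (S : Finset ι) {ρ : ι → ℕ}
    {H : ι → ∀ m, (σ m → k) → L} (h : ∀ i ∈ S, IsPolyFam e (ρ i) (H i)) :
    IsPolyFam e (∑ i ∈ S, ρ i) (fun m u => ∏ i ∈ S, H i m u) := by
  classical
  induction S using Finset.induction_on with
  | empty => simpa using IsPolyFam.const he 1
  | insert a S ha ih =>
    simp_rw [Finset.prod_insert ha, Finset.sum_insert ha]
    exact (h a (by simp)).mul he (ih fun i hi => h i (by simp [hi]))

lemma IsPolyFam.pow (he : DenomSpans k e) (h : IsPolyFam e r G) (j : ℕ) :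
    IsPolyFam e (j * r) (fun m u => G m u ^ j) := by
  have := IsPolyFam.prod he (Finset.range j) (ρ := fun _ => r) (H := fun _ => G) fun _ _ => h
  simpa using this

lemma IsPolyFam.mvEval (he : DenomSpans k e) {ι : Type*} [Fintype ι]
    {H : ι → ∀ m, (σ m → k) → L} (h : ∀ i, IsPolyFam e 1 (H i)) (F : MvPolynomial ι L) :
    IsPolyFam e F.totalDegree (fun m u => MvPolynomial.eval (fun i => H i m u) F) := by
  simp_rw [MvPolynomial.eval_eq]
  refine IsPolyFam.sum he _ fun d hd => ?_
  have h1 := IsPolyFam.prod he d.support (ρ := fun i => d i * 1) (H := fun i m u => H i m u ^ d i)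
    fun i _ => (h i).pow he (d i)
  have h2 := ((IsPolyFam.const (σ := σ) he (F.coeff d)).mul he h1)
  refine h2.mono ?_
  rw [zero_add]
  simpa [Finsupp.sum] using MvPolynomial.le_totalDegree hd

/-- Tsen–Lang: a polynomial with zero constant term in more variables than its degree has a
nontrivial zero over a function field of one variable over an algebraically closed field. -/
theorem exists_ne_zero_eval_eq_zero [IsAlgClosed k] (he : DenomSpans k e)
    (hli : LinearIndependent k[X] e) {ι : Type*} [Fintype ι] (F : MvPolynomial ι L)
    (hn : 0 < n) (hF : F.totalDegree < Fintype.card ι) (h0 : MvPolynomial.eval 0 F = 0) :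
    ∃ x : ι → L, x ≠ 0 ∧ MvPolynomial.eval x F = 0 := by
  classical
  let σ : ℕ → Type _ := fun m => (ι × Fin n) × Fin (m + 1)
  let H : ι → ∀ m, (σ m → k) → L := fun j m u =>
    ∑ i, (∑ a : Fin (m + 1), C (u ((j, i), a)) * X ^ (a : ℕ) : k[X]) • e i
  have hH : ∀ j, IsPolyFam e 1 (H j) := by
    intro j
    refine ⟨0, 1, one_ne_zero, fun m => ⟨fun i =>
      ∑ a : Fin (m + 1), C (MvPolynomial.X ((j, i), a)) * X ^ (a : ℕ), fun i => ?_, fun u => ?_⟩⟩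
    · refine natDegree_sum_le_of_forall_le _ _ fun a _ => ?_
      refine (natDegree_C_mul_X_pow_le _ _).trans ?_
      have := a.2
      omega
    · simp [H, Polynomial.map_sum]
  obtain ⟨D, s, hs, h⟩ := IsPolyFam.mvEval he hH F
  let m := D + 1
  obtain ⟨g, hg, h⟩ := h m
  let S : Finset (MvPolynomial (σ m) k) := Finset.univ.image
    fun p : Fin n × Fin (F.totalDegree * m + D + 1) => (g p.1).coeff p.2
  have hS : S.card < Nat.card (σ m) := by
    refine lt_of_le_of_lt Finset.card_image_le ?_
    simp only [Finset.card_univ, Fintype.card_prod, Fintype.card_fin, Nat.card_eq_fintype_card, σ]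
    have h1 : F.totalDegree * m + D + 1 < Fintype.card ι * (m + 1) := by
      obtain ⟨q, hq⟩ := Nat.exists_eq_add_of_lt hF
      rw [hq]
      simp only [m]
      nlinarith
    calc n * (F.totalDegree * m + D + 1) < n * (Fintype.card ι * (m + 1)) := by gcongr
      _ = _ := by ring
  have key : ∀ u, (∀ p ∈ S, MvPolynomial.eval u p = 0) ↔
      MvPolynomial.eval (fun j => H j m u) F = 0 := by
    intro u
    constructor
    · intro hu
      have : s • MvPolynomial.eval (fun j => H j m u) F = 0 := by
        rw [h]
        refine Finset.sum_eq_zero fun i _ => ?_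
        have : (g i).map (MvPolynomial.eval u) = 0 := by
          ext a
          rw [coeff_map, coeff_zero]
          by_cases ha : a < F.totalDegree * m + D + 1
          · exact hu _ (Finset.mem_image.mpr ⟨(i, ⟨a, ha⟩), Finset.mem_univ _, rfl⟩)
          · rw [coeff_eq_zero_of_natDegree_lt (by have := hg i; omega), map_zero]
        rw [this, zero_smul]
      have hsm : s • (1 : L) ≠ 0 := by
        intro h1
        have h2 := linearIndependent_iff'.mp hli Finset.univ (fun i => s) (by
          refine Finset.sum_eq_zero fun i _ => ?_
          rw [← one_mul (e i), ← smul_mul_assoc, h1, zero_mul]) ⟨0, hn⟩ (Finset.mem_univ _)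
        exact hs h2
      rw [← one_mul (MvPolynomial.eval _ F), ← smul_mul_assoc] at this
      exact (mul_eq_zero.mp this).resolve_left hsm
    · intro hu p hp
      obtain ⟨⟨i, a⟩, -, rfl⟩ := Finset.mem_image.mp hp
      have h3 := h u
      beta_reduce at h3
      rw [hu, smul_zero] at h3
      have h2 := linearIndependent_iff'.mp hli Finset.univ _ h3.symm i (Finset.mem_univ _)
      have := congrArg (fun q => Polynomial.coeff q a) h2
      simpa [coeff_map] using this
  obtain ⟨u, hu0, hu⟩ := exists_common_zero_ne_zero S hS (by
    refine (key 0).mpr ?_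
    have : (fun j => H j m 0) = 0 := by
      ext j; simp [H]
    rw [this, h0])
  refine ⟨fun j => H j m u, fun hx => hu0 ?_, (key u).mp hu⟩
  ext ⟨⟨j, i⟩, a⟩
  have h1 : H j m u = 0 := congrFun hx j
  have h2 := linearIndependent_iff'.mp hli Finset.univ _ h1 i (Finset.mem_univ _)
  have h3 := congrArg (fun q => Polynomial.coeff q (a : ℕ)) h2
  simp only [finsetSum_coeff, coeff_C_mul, coeff_X_pow, coeff_zero] at h3
  rw [Finset.sum_eq_single a] at h3
  · simpa using h3
  · intro b _ hb
    simp [Fin.val_inj, Ne.symm hb]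
  · simp

end TsenLang

section TsenSymbol
open Polynomial

variable {k : Type*} [Field k] {L : Type*} [Field L] [Algebra k[X] L] {n : ℕ}

lemma exists_denomSpans_of_finite [Algebra (RatFunc k) L] [IsScalarTower k[X] (RatFunc k) L]
    [FiniteDimensional (RatFunc k) L] :
    ∃ n, 0 < n ∧ ∃ e : Fin n → L, DenomSpans k e ∧ LinearIndependent k[X] e := by
  classical
  let β := Module.finBasis (RatFunc k) L
  refine ⟨Module.finrank (RatFunc k) L, Module.finrank_pos, β, fun x => ?_, ?_⟩
  · obtain ⟨s, hs⟩ := IsLocalization.exist_integer_multiples_of_finset (nonZeroDivisors k[X])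
      (Finset.univ.image fun i => β.repr x i)
    choose c hc using fun i => hs (β.repr x i) (by simp)
    refine ⟨s, nonZeroDivisors.coe_ne_zero s, c, ?_⟩
    conv_lhs => rw [← β.sum_repr x]
    rw [Finset.smul_sum]
    refine Finset.sum_congr rfl fun i _ => ?_
    rw [← smul_assoc, ← hc i, algebraMap_smul]
  · exact (LinearIndependent.iff_fractionRing k[X] (RatFunc k)).mpr β.linearIndependent

variable [IsAlgClosed k]

/-- Norms from finite extensions of a function field of one variable are surjective. -/
lemma norm_surjective_of_denomSpans {e : Fin n → L} (he : DenomSpans k e)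
    (hli : LinearIndependent k[X] e) (hn : 0 < n) {E : Type*} [Field E] [Algebra L E]
    [FiniteDimensional L E] (b : L) : ∃ h : E, Algebra.norm L h = b := by
  classical
  let d := Module.finrank L E
  have hd : 0 < d := Module.finrank_pos
  let β : Module.Basis (Fin d) L E := Module.finBasis L E
  let M : Matrix (Fin d) (Fin d) (MvPolynomial (Option (Fin d)) L) := fun i j =>
    ∑ l, MvPolynomial.X (some l) * MvPolynomial.C (Algebra.leftMulMatrix β (β l) i j)
  let F := M.det - MvPolynomial.C b * MvPolynomial.X none ^ d
  have hM : ∀ i j, (M i j).IsHomogeneous 1 := fun i j =>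
    MvPolynomial.IsHomogeneous.sum _ _ _ fun l _ => by
      simpa using (MvPolynomial.isHomogeneous_X L (some l)).mul (MvPolynomial.isHomogeneous_C _ _)
  have hdet : M.det.IsHomogeneous d := by
    rw [Matrix.det_apply]
    refine MvPolynomial.IsHomogeneous.sum _ _ _ fun τ _ => ?_
    have := MvPolynomial.IsHomogeneous.prod Finset.univ (fun i => M (τ i) i) (fun _ => 1)
      fun i _ => hM (τ i) i
    simp only [Finset.sum_const, Finset.card_univ, Fintype.card_fin, smul_eq_mul, mul_one] at this
    rcases Int.units_eq_one_or (Equiv.Perm.sign τ) with h | h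
    · rw [h, one_smul]; exact this
    · rw [h, Units.neg_smul, one_smul]; exact this.neg
  have hF : F.IsHomogeneous d := by
    refine hdet.sub ?_
    simpa using (MvPolynomial.isHomogeneous_C _ b).mul
      ((MvPolynomial.isHomogeneous_X L (none : Option (Fin d))).pow d)
  have hev : ∀ x : Option (Fin d) → L, MvPolynomial.eval x F =
      Algebra.norm L (∑ l, x (some l) • β l) - b * x none ^ d := by
    intro x
    rw [Algebra.norm_eq_matrix_det β]
    simp only [F, map_sub, map_mul, MvPolynomial.eval_C, map_pow, MvPolynomial.eval_X]
    rw [RingHom.map_det]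
    congr 2
    ext i j
    change MvPolynomial.eval x (M i j) = _
    simp [M, Matrix.sum_apply]
  obtain ⟨x, hx0, hx⟩ := exists_ne_zero_eval_eq_zero he hli F hn
    (lt_of_le_of_lt hF.totalDegree_le (by simp)) (by
      rw [hev]
      simp [hd.ne'])
  rw [hev, sub_eq_zero] at hx
  have hw : x none ≠ 0 := by
    intro h0
    rw [h0, zero_pow hd.ne', mul_zero, Algebra.norm_eq_zero_iff] at hx
    refine hx0 (funext fun o => ?_)
    rcases o with _ | l
    · exact h0
    · exact linearIndependent_iff'.mp β.linearIndependent Finset.univ _ hx l (Finset.mem_univ _)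
  refine ⟨algebraMap L E (x none)⁻¹ * ∑ l, x (some l) • β l, ?_⟩
  rw [map_mul, Algebra.norm_algebraMap, hx]
  have : Module.finrank L E = d := rfl
  rw [this, inv_pow, mul_comm b, inv_mul_cancel_left₀ (pow_ne_zero _ hw)]

variable {ℓ : ℕ}

lemma sym_eq_zero_of_denomSpans [Fact ℓ.Prime] {e : Fin n → L} (he : DenomSpans k e)
    (hli : LinearIndependent k[X] e) (hn : 0 < n) (hL : (ℓ : L) ≠ 0) (hneg : ∃ z : L, z ^ ℓ = -1)
    (a b : L) : sym ℓ a b = 0 := by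
  have hℓ : ℓ.Prime := Fact.out
  by_cases ha : a = 0
  · rw [ha, sym_zero_left]
  by_cases hb : b = 0
  · rw [hb, sym_zero_right]
  by_cases hpow : ∃ z, z ^ ℓ = a
  · obtain ⟨z, rfl⟩ := hpow
    exact sym_ellpow_left hℓ.ne_zero _ _
  have hirr : Irreducible (X ^ ℓ - C a) :=
    X_pow_sub_C_irreducible_of_prime hℓ fun z hz => hpow ⟨z, hz⟩
  have _ := Fact.mk hirr
  have hne := hirr.ne_zero
  let E := AdjoinRoot (X ^ ℓ - C a)
  let pb : PowerBasis L E := AdjoinRoot.powerBasis hne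
  have _ : FiniteDimensional L E := pb.finite
  have hfin : Module.finrank L E = ℓ := by
    rw [pb.finrank, AdjoinRoot.powerBasis_dim, natDegree_X_pow_sub_C]
  obtain ⟨h, hh⟩ := norm_surjective_of_denomSpans he hli hn (E := E) b
  have h_int : IsIntegral L h := Algebra.IsIntegral.isIntegral h
  by_cases hbot : h ∈ (⊥ : IntermediateField L E)
  · obtain ⟨c, rfl⟩ := IntermediateField.mem_bot.mp hbot
    rw [Algebra.norm_algebraMap, hfin] at hh
    rw [← hh]
    exact sym_ellpow_right hℓ.ne_zero _ _
  have hdvd : Module.finrank L (IntermediateField.adjoin L {h}) ∣ ℓ := by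
    exact ⟨_, hfin.symm.trans
      (Module.finrank_mul_finrank L (IntermediateField.adjoin L {h}) E).symm⟩
  have hadj : Module.finrank L (IntermediateField.adjoin L {h}) = ℓ := by
    rcases (Nat.dvd_prime hℓ).mp hdvd with h1 | h1
    · exact absurd (IntermediateField.finrank_adjoin_simple_eq_one_iff.mp h1) hbot
    · exact h1
  have htop : IntermediateField.adjoin L {h} = ⊤ :=
    IntermediateField.eq_of_le_of_finrank_eq le_top
      (by rw [hadj, IntermediateField.finrank_top', hfin])
  let P := minpoly L h
  have hPd : P.natDegree = ℓ := by
    rw [← hadj, IntermediateField.adjoin.finrank h_int]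
  have hPm : P.Monic := minpoly.monic h_int
  have hPi : Irreducible P := minpoly.irreducible h_int
  have hnorm : Algebra.norm L h = (-1) ^ ℓ * P.eval 0 := by
    have hg := Algebra.PowerBasis.norm_gen_eq_coeff_zero_minpoly
      (IntermediateField.adjoin.powerBasis h_int)
    have e1 : Algebra.norm L h = Algebra.norm L (IntermediateField.AdjoinSimple.gen L h) ^
        Module.finrank (IntermediateField.adjoin L {h}) E := by
      rw [← Algebra.norm_norm (R := L) (S := IntermediateField.adjoin L {h})]
      rw [← map_pow, ← Algebra.norm_algebraMap]
      rfl
    have e2 : Module.finrank (IntermediateField.adjoin L {h}) E = 1 := by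
      rw [htop]; exact IntermediateField.finrank_top
    rw [e2, pow_one] at e1
    rw [e1, ← IntermediateField.adjoin.powerBasis_gen h_int, hg,
      IntermediateField.adjoin.powerBasis_gen, IntermediateField.minpoly_gen,
      IntermediateField.adjoin.powerBasis_dim, coeff_zero_eq_eval_zero]
    change (-1) ^ P.natDegree * _ = _
    rw [hPd]
  have hP0 : P.eval 0 ≠ 0 := by
    intro h0
    rw [hnorm, h0, mul_zero] at hh
    exact hb hh.symm
  have hroot : AdjoinRoot.root (X ^ ℓ - C a) ∈ IntermediateField.adjoin L {h} := by
    rw [htop]; trivial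
  obtain ⟨q, hq⟩ : ∃ q : L[X], aeval h q = AdjoinRoot.root (X ^ ℓ - C a) := by
    have := hroot
    rw [← IntermediateField.mem_toSubalgebra,
      IntermediateField.adjoin_simple_toSubalgebra_of_isAlgebraic h_int.isAlgebraic] at this
    rw [Algebra.adjoin_singleton_eq_range_aeval] at this
    exact this
  have hdiv : P ∣ C a - q ^ ℓ := by
    refine minpoly.dvd L h ?_
    rw [map_sub, aeval_C, map_pow, hq]
    have := AdjoinRoot.eval₂_root (X ^ ℓ - C a)
    simp only [eval₂_sub, eval₂_X_pow, eval₂_C] at this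
    rw [sub_eq_zero] at this
    rw [this, sub_eq_zero]; rfl
  have h6 := sym_eq_zero_of_isPow_mod (ℓ := ℓ) hL hneg hPi hPm hP0 ha hdiv
  obtain ⟨z, hz⟩ := hneg
  rw [← hh, hnorm, ← hz, ← pow_mul, mul_comm, pow_mul,
    sym_mul_right a hP0 (pow_ne_zero _ (pow_ne_zero _ ?_)), h6,
    sym_ellpow_right hℓ.ne_zero, add_zero]
  rintro rfl
  rw [zero_pow hℓ.ne_zero] at hz
  exact one_ne_zero (neg_eq_zero.mp hz.symm)

lemma mem_range_algebraMap_of_isAlgebraic {K : Type*} [Field K] [Algebra k K] {a : K}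
    (ha : IsAlgebraic k a) : a ∈ (algebraMap k K).range :=
  minpoly.mem_range_of_degree_eq_one k a
    (IsAlgClosed.degree_eq_one_of_irreducible k (minpoly.irreducible ha.isIntegral))

/-- If `b` is algebraic over `k(a)`, with `k` algebraically closed, then `{a, b} = 0`. -/
theorem sym_eq_zero_of_isAlgebraic [Fact ℓ.Prime] (hk : (ℓ : k) ≠ 0) {K : Type*}
    [Field K] [Algebra k K] (a b : K)
    (hb : IsAlgebraic (IntermediateField.adjoin k {a}) b) : sym ℓ a b = 0 := by
  have hℓ : ℓ.Prime := Fact.out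
  have hroots : ∀ c : k, ∃ z, z ^ ℓ = c := fun c => IsAlgClosed.exists_pow_nat_eq c hℓ.pos
  by_cases ha : Transcendental k a
  · let ψ := RatFunc.algEquivOfTranscendental a ha
    let φ : RatFunc k →+* K := (algebraMap (IntermediateField.adjoin k {a}) K).comp (ψ : _ →+* _)
    let _ : Algebra (RatFunc k) K := φ.toAlgebra
    have hb' : IsAlgebraic (RatFunc k) b :=
      hb.of_ringHom_of_comp_eq (ψ : RatFunc k →+* _) (RingHom.id K) ψ.surjective
        (fun _ _ h => h) rfl
    let M := IntermediateField.adjoin (RatFunc k) {b}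
    let _ : Algebra k[X] M :=
      ((algebraMap (RatFunc k) M).comp (algebraMap k[X] (RatFunc k))).toAlgebra
    have _ : IsScalarTower k[X] (RatFunc k) M := IsScalarTower.of_algebraMap_eq' rfl
    have _ : FiniteDimensional (RatFunc k) M :=
      IntermediateField.adjoin.finiteDimensional hb'.isIntegral
    obtain ⟨n, hn, e, he, hli⟩ := exists_denomSpans_of_finite (k := k) (L := M)
    let θ : k →+* M := (algebraMap k[X] M).comp (C : k →+* k[X])
    have ha' : a ∈ M := by
      have : a = algebraMap (RatFunc k) K (algebraMap k[X] _ X) := by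
        change a = algebraMap _ K (ψ _)
        rw [RatFunc.algEquivOfTranscendental_algebraMap]
        simp
      rw [this]
      exact M.algebraMap_mem _
    have h0 : (ℓ : M) ≠ 0 := fun h => hk (by
      rw [← map_natCast θ] at h
      exact (_root_.map_eq_zero _).mp h)
    have h1 : ∃ z : M, z ^ ℓ = -1 := by
      obtain ⟨z, hz⟩ := hroots (-1)
      exact ⟨θ z, by rw [← map_pow, hz, map_neg, map_one]⟩
    obtain ⟨F, hF⟩ := exists_sym_map ℓ (M.val : M →+* K)
    have h1 := hF ⟨a, ha'⟩ ⟨b, IntermediateField.mem_adjoin_simple_self _ b⟩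
    rw [sym_eq_zero_of_denomSpans he hli hn h0 (by assumption), map_zero] at h1
    exact h1.symm
  · obtain ⟨c, rfl⟩ := mem_range_algebraMap_of_isAlgebraic (not_not.mp ha)
    obtain ⟨z, rfl⟩ := hroots c
    rw [map_pow]
    exact sym_ellpow_left hℓ.ne_zero _ _

end TsenSymbol

section BertiniNoether
open MvPolynomial

lemma sum_monomial_coeff_eq {σ A : Type*} [CommRing A] (M : Finset (σ →₀ ℕ))
    (g : MvPolynomial σ A) (hg : g.support ⊆ M) :
    ∑ m : M, monomial m.1 (g.coeff m.1) = g := by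
  classical
  conv_rhs => rw [g.as_sum]
  rw [Finset.sum_coe_sort M (fun m => monomial m (g.coeff m))]
  refine (Finset.sum_subset hg fun m _ hm => ?_).symm
  rw [notMem_support_iff.mp hm, monomial_zero]

/-- The polynomial with support in `M` whose coefficients are the indeterminates `X (f m)`. -/
def genericPoly {σ τ : Type*} (M : Finset (σ →₀ ℕ)) (f : M → τ) :
    MvPolynomial σ (MvPolynomial τ ℤ) := ∑ m : M, monomial m.1 (X (f m))

/-- The equation saying that the coefficient at `m` of the product of two polynomials with
supports in `M` is that of `Q`. -/
def factorEq {σ A : Type*} [CommRing A] (M : Finset (σ →₀ ℕ)) (Q : MvPolynomial σ A)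
    (m : σ →₀ ℕ) : MvPolynomial (M ⊕ M) A :=
  map (Int.castRingHom A) ((genericPoly M Sum.inl * genericPoly M Sum.inr).coeff m) - C (Q.coeff m)

lemma eval₂_factorEq {σ A B : Type*} [CommRing A] [CommRing B] (M : Finset (σ →₀ ℕ)) (ψ : A →+* B)
    (Q : MvPolynomial σ A) (pt : M ⊕ M → B) (m : σ →₀ ℕ) :
    eval₂ ψ pt (factorEq M Q m) =
      ((∑ m : M, monomial m.1 (pt (Sum.inl m))) * (∑ m : M, monomial m.1 (pt (Sum.inr m)))).coeff m
        - ψ (Q.coeff m) := by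
  simp only [factorEq, eval₂_sub, eval₂_C, eval₂_map]
  congr 1
  have h1 : eval₂ (ψ.comp (Int.castRingHom A)) pt
        ((genericPoly M Sum.inl * genericPoly M Sum.inr).coeff m)
      = (map (eval₂Hom (ψ.comp (Int.castRingHom A)) pt)
          (genericPoly M Sum.inl * genericPoly M Sum.inr)).coeff m := by
    rw [coeff_map]; rfl
  rw [h1, map_mul]
  simp only [genericPoly, map_sum, map_monomial, coe_eval₂Hom, eval₂_X]

theorem exists_finset_forall_factor_trivial {σ Λ : Type*} [Finite σ] [Field Λ] [IsAlgClosed Λ]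
    (P : MvPolynomial σ Λ) (hP : Irreducible P) :
    ∃ S : Finset Λ, ∀ (k' : Type*) [Field k'] (R : Subring Λ) (_ : ↑S ⊆ (R : Set Λ))
      (φ : R →+* k') (P' : MvPolynomial σ R) (_ : map R.subtype P' = P)
      (g h : MvPolynomial σ k'), g ≠ 0 → h ≠ 0 → g * h = map φ P' →
      g.totalDegree = 0 ∨ h.totalDegree = 0 := by
  classical
  set D := P.totalDegree with hD
  have hfin : {f : σ →₀ ℕ | f.degree ≤ D - 1}.Finite := Finsupp.finite_of_degree_le _
  set M : Finset (σ →₀ ℕ) := hfin.toFinset with hM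
  have hMs' : ∀ m ∈ M, m.degree ≤ D - 1 := by
    intro m hm
    rw [hM, Set.Finite.mem_toFinset] at hm
    exact hm
  have hone : (1 : MvPolynomial (M ⊕ M) Λ) ∈ Ideal.span (Set.range (factorEq M P)) := by
    rw [← Ideal.eq_top_iff_one]
    by_contra hne
    have hz : (zeroLocus Λ (Ideal.span (Set.range (factorEq M P)))).Nonempty := by
      by_contra hem
      rw [Set.not_nonempty_iff_eq_empty] at hem
      have := vanishingIdeal_zeroLocus_eq_radical (K := Λ) (Ideal.span (Set.range (factorEq M P)))
      rw [hem, vanishingIdeal_empty] at this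
      exact hne (Ideal.radical_eq_top.mp this.symm)
    obtain ⟨pt, hpt⟩ := hz
    rw [zeroLocus_span] at hpt
    have hfac : P = (∑ m : M, monomial m.1 (pt (Sum.inl m)))
        * (∑ m : M, monomial m.1 (pt (Sum.inr m))) := by
      ext m
      have := hpt (factorEq M P m) ⟨m, rfl⟩
      rw [aeval_def, eval₂_factorEq, sub_eq_zero] at this
      rw [this]; rfl
    have hdeg : ∀ c : M → Λ, (∑ m : M, monomial m.1 (c m)).totalDegree ≤ D - 1 := by
      intro c
      refine totalDegree_finsetSum_le fun m _ => ?_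
      exact (totalDegree_monomial_le _ _).trans (hMs' m.1 m.2)
    have hP0 := hP.ne_zero
    rw [hfac] at hP0
    have h1 := left_ne_zero_of_mul hP0
    have h2 := right_ne_zero_of_mul hP0
    have hsum := totalDegree_mul_of_isDomain h1 h2
    rw [← hfac, ← hD] at hsum
    have hDpos : 0 < D := by
      rw [hD, Nat.pos_iff_ne_zero]
      intro h0
      rw [totalDegree_eq_zero_iff_eq_C.mp h0] at hP
      have hc : coeff 0 P ≠ 0 := by
        intro hc
        rw [hc, C_0] at hP
        exact hP.ne_zero rfl
      exact hP.not_isUnit ((isUnit_iff_ne_zero.mpr hc).map C)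
    rcases hP.isUnit_or_isUnit hfac with hu | hu
    · have h0 := (isUnit_iff_totalDegree_of_isReduced.mp hu).2
      have := hdeg (fun m => pt (Sum.inr m))
      omega
    · have h0 := (isUnit_iff_totalDegree_of_isReduced.mp hu).2
      have := hdeg (fun m => pt (Sum.inl m))
      omega
  rw [Finsupp.mem_ideal_span_range_iff_exists_finsupp] at hone
  obtain ⟨c, hc⟩ := hone
  refine ⟨c.support.biUnion fun m => (c m).coeffs, ?_⟩
  intro k' _ R hS φ P' hP' g h hg hh hgh
  by_contra hcon
  push Not at hcon
  have hdP : (map φ P').totalDegree ≤ D := by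
    rw [hD, ← hP', totalDegree, totalDegree, support_map_of_injective P' (f :=
        R.subtype) Subtype.val_injective]
    exact Finset.sup_mono (support_map_subset _ _)
  have hsum := totalDegree_mul_of_isDomain hg hh
  rw [hgh] at hsum
  have hMs : ∀ g : MvPolynomial σ k', g.totalDegree ≤ D - 1 → g.support ⊆ M := by
    intro g hg m hm
    rw [hM, Set.Finite.mem_toFinset]
    exact (le_totalDegree hm).trans hg
  have hgM := hMs g (by omega)
  have hhM := hMs h (by omega)
  have hlift : ∀ m, ∃ a : MvPolynomial (M ⊕ M) R, map R.subtype a = c m := by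
    intro m
    have : c m ∈ Set.range (map (σ := M ⊕ M) R.subtype) := by
      rw [mem_range_map_iff_coeffs_subset]
      intro x hx
      by_cases hm : c m = 0
      · simp [hm] at hx
      · refine ⟨⟨x, hS ?_⟩, rfl⟩
        rw [Finset.mem_coe, Finset.mem_biUnion]
        exact ⟨m, Finsupp.mem_support_iff.mpr hm, hx⟩
    exact this
  choose a ha using hlift
  have hone' : ∑ m ∈ c.support, a m * factorEq M P' m = 1 := by
    apply map_injective R.subtype Subtype.val_injective
    rw [map_sum, map_one, ← hc, Finsupp.sum]
    refine Finset.sum_congr rfl fun m _ => ?_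
    rw [map_mul, ha]
    congr 1
    simp only [factorEq, map_sub, map_map, map_C]
    congr 2
    rw [← hP', coeff_map]
  have key := congrArg (eval₂ φ (Sum.elim (fun m : M => g.coeff m.1) (fun m : M => h.coeff m.1)))
    hone'
  rw [eval₂_one, eval₂_sum] at key
  refine one_ne_zero (key.symm.trans (Finset.sum_eq_zero fun m _ => ?_))
  rw [eval₂_mul, eval₂_factorEq]
  simp only [Sum.elim_inl, Sum.elim_inr]
  rw [sum_monomial_coeff_eq M g hgM, sum_monomial_coeff_eq M h hhM, hgh, coeff_map, sub_self,
    mul_zero]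

lemma optionEquivLeft_map {σ A B : Type*} [CommRing A] [CommRing B] (f : A →+* B)
    (p : MvPolynomial (Option σ) A) :
    optionEquivLeft B σ (map f p) = (optionEquivLeft A σ p).map (map f) := by
  induction p using MvPolynomial.induction_on with
  | C a => simp [optionEquivLeft_C]
  | add p q hp hq => simp [hp, hq]
  | mul_X p i hp =>
    rw [map_mul, map_mul, map_mul, Polynomial.map_mul, hp, map_X]
    congr 1
    cases i with
    | none => simp [optionEquivLeft_X_none]
    | some i => simp [optionEquivLeft_X_some]

theorem exists_finset_forall_irreducible_map {σ Λ : Type*} [Finite σ] [Field Λ] [IsAlgClosed Λ]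
    (F : Polynomial (MvPolynomial σ Λ)) (hF : Irreducible F) (hm : F.Monic) :
    ∃ S : Finset Λ, ∀ (k' : Type*) [Field k'] (R : Subring Λ) (_ : ↑S ⊆ (R : Set Λ))
      (φ : R →+* k') (F' : Polynomial (MvPolynomial σ R)) (_ : F'.map (map R.subtype) = F),
      F'.Monic → Irreducible (F'.map (map φ)) := by
  have hdeg : F.natDegree ≠ 0 := by
    intro h0
    rw [hm.natDegree_eq_zero.mp h0] at hF
    exact hF.not_isUnit isUnit_one
  obtain ⟨S, hS⟩ := exists_finset_forall_factor_trivial ((optionEquivLeft Λ σ).symm F)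
    ((MulEquiv.irreducible_iff (optionEquivLeft Λ σ).symm).mpr hF)
  refine ⟨S, fun k' _ R hR φ F' hF' hm' => ?_⟩
  have hm'' := hm'.map (map (σ := σ) φ)
  have hd' : (F'.map (map (σ := σ) φ)).natDegree = F.natDegree := by
    rw [hm'.natDegree_map, ← hF', hm'.natDegree_map]
  refine ⟨fun hu => ?_, fun a b hab => ?_⟩
  · rw [hm''.isUnit_iff] at hu
    rw [hu, Polynomial.natDegree_one] at hd'
    exact hdeg hd'.symm
  have hunit : ∀ a : Polynomial (MvPolynomial σ k'), a ≠ 0 →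
      ((optionEquivLeft k' σ).symm a).totalDegree = 0 → IsUnit a := by
    intro a ha h
    have hu : IsUnit ((optionEquivLeft k' σ).symm a) := by
      rw [totalDegree_eq_zero_iff_eq_C] at h
      rw [h]
      refine IsUnit.map _ (isUnit_iff_ne_zero.mpr fun h0 => ?_)
      rw [h0, C_0] at h
      exact ha ((map_eq_zero_iff _ (optionEquivLeft k' σ).symm.injective).mp h)
    simpa using hu.map (optionEquivLeft k' σ)
  have hne := hm''.ne_zero
  rw [hab] at hne
  have ha := left_ne_zero_of_mul hne
  have hb := right_ne_zero_of_mul hne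
  have h1 : map R.subtype ((optionEquivLeft R σ).symm F') = (optionEquivLeft Λ σ).symm F := by
    apply (optionEquivLeft Λ σ).injective
    rw [optionEquivLeft_map]
    simpa using hF'
  have h2 : (optionEquivLeft k' σ).symm a * (optionEquivLeft k' σ).symm b =
      map φ ((optionEquivLeft R σ).symm F') := by
    apply (optionEquivLeft k' σ).injective
    rw [optionEquivLeft_map]
    simp [hab]
  exact (hS k' R hR φ _ h1 _ _ (by simpa using ha) (by simpa using hb) h2).imp
    (hunit a ha) (hunit b hb)

end BertiniNoether

section Embedding
open Polynomial

lemma exists_root_powerSeries {κ : Type*} [Field κ] (g : (PowerSeries κ)[X]) (hg : g.Monic)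
    (a₀ : κ) (h0 : (g.map PowerSeries.constantCoeff).eval a₀ = 0)
    (h1 : (derivative (g.map PowerSeries.constantCoeff)).eval a₀ ≠ 0) :
    ∃ a : PowerSeries κ, g.eval a = 0 := by
  have hc : ∀ p : (PowerSeries κ)[X], PowerSeries.constantCoeff (p.eval (PowerSeries.C a₀)) =
      (p.map PowerSeries.constantCoeff).eval a₀ := by
    intro p
    rw [eval_map, ← eval₂_hom, PowerSeries.constantCoeff_C]
  obtain ⟨a, ha, -⟩ := HenselianRing.is_henselian (I := Ideal.span {(PowerSeries.X :
      PowerSeries κ)})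
    g hg (PowerSeries.C a₀)
    (by rw [Ideal.mem_span_singleton, PowerSeries.X_dvd_iff, hc, h0])
    (by
      refine IsUnit.map _ ?_
      rw [PowerSeries.isUnit_iff_constantCoeff, hc, isUnit_iff_ne_zero, ← derivative_map]
      exact h1)
  exact ⟨a, ha⟩

lemma exists_bezout_of_separable {F : Type*} [Field F] (f : F[X][X])
    (h : (f.map (algebraMap F[X] (RatFunc F))).Separable) :
    ∃ r : F[X], r ≠ 0 ∧ ∃ a b : F[X][X], a * f + b * derivative f = C r := by
  obtain ⟨a, b, hab⟩ := h
  obtain ⟨u, hu0, hu⟩ := IsLocalization.integerNormalization_spec (nonZeroDivisors F[X]) a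
  obtain ⟨v, hv0, hv⟩ := IsLocalization.integerNormalization_spec (nonZeroDivisors F[X]) b
  refine ⟨u * v, mul_ne_zero (nonZeroDivisors.ne_zero hu0) (nonZeroDivisors.ne_zero hv0),
    C v * IsLocalization.integerNormalization (nonZeroDivisors F[X]) a,
    C u * IsLocalization.integerNormalization (nonZeroDivisors F[X]) b, ?_⟩
  apply map_injective _ (IsFractionRing.injective F[X] (RatFunc F))
  have e : ∀ (w : F[X]) (p : (RatFunc F)[X]), w • p = C (algebraMap _ _ w) * p := by
    intro w p
    rw [← algebraMap_smul (RatFunc F) w p, smul_eq_C_mul]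
  simp only [Polynomial.map_add, Polynomial.map_mul, map_C, hu, hv, ← derivative_map, e,
    _root_.map_mul]
  linear_combination C (algebraMap F[X] (RatFunc F) u) * C (algebraMap F[X] (RatFunc F) v) * hab

/-- Specialization at `c` of the polynomials with polynomial coefficients. -/
theorem exists_laurent_embedding {F N : Type*} [Field F] [Field N] [Algebra (RatFunc F) N] (θ : N)
    (hθ : IntermediateField.adjoin (RatFunc F) {θ} = ⊤) (h_int : IsIntegral (RatFunc F) θ)
    (f : F[X][X]) (hm : f.Monic) (hf : f.map (algebraMap F[X] (RatFunc F)) = minpoly (RatFunc F) θ)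
    (hsep : (minpoly (RatFunc F) θ).Separable) :
    ∃ r : F[X], r ≠ 0 ∧ ∀ c : F, r.eval c ≠ 0 → ∀ (κ : Type*) [Field κ] (j : F →+* κ) (θb : κ),
      eval₂ j θb (f.map (evalRingHom c)) = 0 → ∃ ι : N →+* LaurentSeries κ,
        ∀ z : RatFunc F, ι (algebraMap _ _ z) = ratExpandAt j (j c) z := by
  rw [← hf] at hsep
  obtain ⟨r, hr, a, b, hab⟩ := exists_bezout_of_separable f hsep
  refine ⟨r, hr, fun c hc κ _ j θb hroot => ?_⟩
  let ψ : F[X] →+* PowerSeries κ :=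
    (Polynomial.coeToPowerSeries.ringHom (R := κ)).comp
      ((taylorAlgHom (j c) : κ[X] →ₐ[κ] κ[X]).toRingHom.comp (mapRingHom j))
  have hψ : ∀ p : F[X], ψ p = ((taylor (j c) (p.map j) : κ[X]) : PowerSeries κ) := fun p => rfl
  have hψ0 : (PowerSeries.constantCoeff (R := κ)).comp ψ = j.comp (evalRingHom c) := by
    ext p
    · simp [hψ]
    · simp [hψ]
  have hmap : (f.map ψ).map PowerSeries.constantCoeff = (f.map (evalRingHom c)).map j := by
    rw [Polynomial.map_map, hψ0, Polynomial.map_map]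
  have hder : (derivative ((f.map (evalRingHom c)).map j)).eval θb ≠ 0 := by
    intro h0
    have := congrArg (fun p => eval θb ((p.map (evalRingHom c)).map j)) hab
    simp only [Polynomial.map_add, Polynomial.map_mul, eval_add, eval_mul, map_C, eval_C,
      ← derivative_map, h0, mul_zero, add_zero, eval_map (p := f.map _), hroot] at this
    rw [eq_comm, map_eq_zero_iff _ j.injective] at this
    exact hc this
  obtain ⟨α, hα⟩ := exists_root_powerSeries (f.map ψ) (hm.map ψ) θb
    (by rw [hmap, eval_map]; exact hroot) (by rw [hmap]; exact hder)
  let _ : Algebra (RatFunc F) (LaurentSeries κ) := (ratExpandAt j (j c)).toAlgebra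
  let pb := (IntermediateField.adjoin.powerBasis h_int)
  have hgen : aeval (HahnSeries.ofPowerSeries ℤ κ α) (minpoly (RatFunc F) pb.gen) = 0 := by
    rw [IntermediateField.adjoin.powerBasis_gen, IntermediateField.minpoly_gen, ← hf, aeval_def,
      eval₂_map]
    have : (algebraMap (RatFunc F) (LaurentSeries κ)).comp (algebraMap F[X] (RatFunc F)) =
        (HahnSeries.ofPowerSeries ℤ κ).comp ψ := by
      refine RingHom.ext fun p => ?_
      exact ratExpandAt_algebraMap j (j c) p
    rw [this, ← hom_eval₂, ← eval_map, hα, _root_.map_zero]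
  let ι₀ := pb.lift _ hgen
  refine ⟨ι₀.toRingHom.comp
    ((IntermediateField.equivOfEq hθ).trans IntermediateField.topEquiv).symm.toAlgHom.toRingHom,
    fun z => ?_⟩
  have : ∀ w : N, w ∈ (⊤ : IntermediateField (RatFunc F) N) := fun w => IntermediateField.mem_top
  calc _ = ι₀ (((IntermediateField.equivOfEq hθ).trans IntermediateField.topEquiv).symm
        (algebraMap _ _ z)) := rfl
    _ = _ := by rw [AlgEquiv.commutes, AlgHom.commutes]; rfl

end Embedding

section EmbeddingK
open Polynomial

lemma exists_integral_primitive (A : Type*) {E N : Type*} [CommRing A] [IsDomain A] [Field E]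
    [Algebra A E] [IsFractionRing A E] [Field N] [Algebra E N] [Algebra A N] [IsScalarTower A E N]
    [FiniteDimensional E N] [Algebra.IsSeparable E N] :
    ∃ θ : N, IntermediateField.adjoin E {θ} = ⊤ ∧ IsIntegral A θ := by
  obtain ⟨θ, hθ⟩ := Field.exists_primitive_element E N
  have h1 : IsAlgebraic A θ :=
    (IsFractionRing.isAlgebraic_iff A E N).mpr (Algebra.IsAlgebraic.isAlgebraic θ)
  obtain ⟨y, hy, h_int⟩ := h1.exists_integral_multiple
  refine ⟨y • θ, ?_, h_int⟩
  rw [eq_top_iff, ← hθ, IntermediateField.adjoin_simple_le_iff]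
  have hy' : algebraMap A E y ≠ 0 := by
    rwa [Ne, map_eq_zero_iff _ (IsFractionRing.injective A E)]
  have e : θ = algebraMap E N (algebraMap A E y)⁻¹ * (y • θ) := by
    rw [← algebraMap_smul E y θ, Algebra.smul_def, ← mul_assoc, ← _root_.map_mul,
        inv_mul_cancel₀ hy',
      _root_.map_one, one_mul]
  have h2 := mul_mem (IntermediateField.algebraMap_mem (IntermediateField.adjoin E {y • θ})
    (algebraMap A E y)⁻¹) (IntermediateField.mem_adjoin_simple_self E (y • θ))
  rwa [← e] at h2

lemma exists_frobenius_to_separableClosure (E K : Type*) [Field E] [Field K] [Algebra E K]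
    [FiniteDimensional E K] (p : ℕ) [ExpChar E p] :
    ∃ (n : ℕ) (ψ : K →+* separableClosure E K), ∀ z, (ψ z : K) = z ^ p ^ n := by
  have : ExpChar K p := expChar_of_injective_algebraMap (algebraMap E K).injective p
  have : ExpChar (separableClosure E K) p :=
    expChar_of_injective_algebraMap (algebraMap E (separableClosure E K)).injective p
  let n := IsPurelyInseparable.exponent (separableClosure E K) K
  have h : ∀ z : K, iterateFrobenius K p n z ∈ (separableClosure E K) := by
    intro z
    obtain ⟨y, hy⟩ := IsPurelyInseparable.exponent_def' (separableClosure E K) p z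
    rw [iterateFrobenius_def, ← hy]
    exact y.2
  exact ⟨n, (iterateFrobenius K p n).codRestrict (separableClosure E K).toSubring h,
    fun z => iterateFrobenius_def p n z⟩

theorem exists_frobenius_embedding {F : Type u} {K : Type v} [Field F] [Field K] [Algebra (RatFunc
    F) K]
    [FiniteDimensional (RatFunc F) K] (p : ℕ) [ExpChar F p] :
    ∃ (n : ℕ) (r : F[X]), r ≠ 0 ∧ ∀ c : F, r.eval c ≠ 0 → ∃ (κ : Type u) (_ : Field κ)
      (j : F →+* κ) (ι : K →+* LaurentSeries κ), (∀ w : κ, ∃ g : F[X], g ≠ 0 ∧ eval₂ j w g = 0) ∧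
        ∀ z : RatFunc F, ι (algebraMap _ _ z) = ratExpandAt j (j c) z ^ p ^ n := by
  have : ExpChar (RatFunc F) p :=
    expChar_of_injective_algebraMap (algebraMap F (RatFunc F)).injective p
  obtain ⟨n, ψ, hψ⟩ := exists_frobenius_to_separableClosure (RatFunc F) K p
  let _ : Algebra F[X] (separableClosure (RatFunc F) K) :=
    ((algebraMap (RatFunc F) _).comp (algebraMap F[X] (RatFunc F))).toAlgebra
  have : IsScalarTower F[X] (RatFunc F) (separableClosure (RatFunc F) K) :=
    IsScalarTower.of_algebraMap_eq fun _ => rfl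
  obtain ⟨θ, hθ, h_int⟩ := exists_integral_primitive F[X] (E := RatFunc F)
    (N := separableClosure (RatFunc F) K)
  have hmin := minpoly.isIntegrallyClosed_eq_field_fractions (RatFunc F)
    (separableClosure (RatFunc F) K) h_int
  rw [Algebra.algebraMap_self_apply] at hmin
  have h_int' : IsIntegral (RatFunc F) θ := Algebra.IsIntegral.isIntegral θ
  have hm := minpoly.monic h_int
  obtain ⟨r, hr, H⟩ := exists_laurent_embedding θ hθ h_int' (minpoly F[X] θ) hm hmin.symm
    (Algebra.IsSeparable.isSeparable _ θ)
  refine ⟨n, r, hr, fun c hc => ?_⟩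
  set fc := (minpoly F[X] θ).map (evalRingHom c) with hfc
  have hdeg : fc.natDegree ≠ 0 := by
    rw [hfc, hm.natDegree_map]
    have := minpoly.natDegree_pos h_int'
    rw [hmin, hm.natDegree_map] at this
    exact this.ne'
  have hfc0 : fc ≠ 0 := fun h => by rw [h] at hdeg; exact hdeg rfl
  have hirr := irreducible_factor fc
  have := Fact.mk hirr
  obtain ⟨ι, hι⟩ := H c hc (AdjoinRoot fc.factor) (AdjoinRoot.of _) (AdjoinRoot.root _) (by
    rw [← hfc]
    exact eval₂_eq_zero_of_dvd_of_eval₂_eq_zero _ _ (factor_dvd_of_natDegree_ne_zero hdeg)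
      (AdjoinRoot.eval₂_root _))
  refine ⟨AdjoinRoot fc.factor, inferInstance, AdjoinRoot.of _, ι.comp ψ, fun w => ?_, fun z => ?_⟩
  · have : Algebra.IsAlgebraic F (AdjoinRoot fc.factor) := by
      have := (AdjoinRoot.powerBasis hirr.ne_zero).finite
      exact Algebra.IsAlgebraic.of_finite _ _
    obtain ⟨g, hg, h0⟩ := Algebra.IsAlgebraic.isAlgebraic (R := F) w
    exact ⟨g, hg, h0⟩
  · rw [← hι, ← _root_.map_pow, RingHom.comp_apply]
    congr 1
    apply Subtype.ext
    rw [hψ]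
    rfl

end EmbeddingK

section Place
open Polynomial IntermediateField

lemma IsFunctionField.of_tower {k F K : Type*} [Field k] [Field F] [Field K] [Algebra k F]
    [Algebra k K] [Algebra F K] [IsScalarTower k F K] (h : IsFunctionField k K) :
    IsFunctionField F K := by
  obtain ⟨s, hs⟩ := h
  refine ⟨s, ?_⟩
  have h1 : adjoin k (s : Set K) ≤ (adjoin F (s : Set K)).restrictScalars k :=
    adjoin_le_iff.mpr (subset_adjoin F _)
  rw [hs] at h1
  exact eq_top_iff.mpr fun x _ => h1 (mem_top (x := x))

lemma finiteDimensional_of_isFunctionField {F K : Type*} [Field F] [Field K] [Algebra F K]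
    (h : IsFunctionField F K) [Algebra.IsAlgebraic F K] : FiniteDimensional F K := by
  obtain ⟨s, hs⟩ := h
  have h1 : FiniteDimensional F (adjoin F (s : Set K)) :=
    finiteDimensional_adjoin fun x _ => Algebra.IsIntegral.isIntegral x
  rw [hs] at h1
  exact Module.Finite.equiv (topEquiv (F := F) (E := K)).toLinearEquiv

lemma IsAlgebraic.of_range_subset {A B K : Type*} [Field A] [Field B] [Field K] [Algebra A K]
    [Algebra B K] {z : K} (hz : IsAlgebraic A z)
    (h : Set.range (algebraMap A K) ⊆ Set.range (algebraMap B K)) : IsAlgebraic B z := by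
  have hinj := (algebraMap B K).injective
  choose f hf using fun a : A => h ⟨a, rfl⟩
  let g : A →+* B :=
    { toFun := f
      map_one' := hinj (by simp [hf])
      map_mul' := fun a b => hinj (by simp [hf])
      map_zero' := hinj (by simp [hf])
      map_add' := fun a b => hinj (by simp [hf]) }
  let _ := g.toAlgebra
  have : IsScalarTower A B K := IsScalarTower.of_algebraMap_eq fun a => (hf a).symm
  exact hz.tower_top B

/-- Evaluation of rational functions at a transcendental element. -/
def ratFuncEval {F K : Type*} [Field F] [Field K] [Algebra F K] (t : K) (ht : Transcendental F t) :
    RatFunc F →ₐ[F] K :=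
  (adjoin F {t}).val.comp (RatFunc.algEquivOfTranscendental t ht).toAlgHom

lemma ratFuncEval_X {F K : Type*} [Field F] [Field K] [Algebra F K] (t : K)
    (ht : Transcendental F t) : ratFuncEval t ht RatFunc.X = t :=
  RatFunc.algEquivOfTranscendental_X t ht

lemma ratFuncEval_range {F K : Type*} [Field F] [Field K] [Algebra F K] (t : K)
    (ht : Transcendental F t) (z : K) (hz : z ∈ adjoin F {t}) : ∃ w, ratFuncEval t ht w = z := by
  obtain ⟨w, hw⟩ := (RatFunc.algEquivOfTranscendental t ht).surjective ⟨z, hz⟩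
  exact ⟨w, congrArg Subtype.val hw⟩

/-- `K` is finite over the rational function field in `t`. -/
lemma finiteDimensional_ratFunc {F K : Type*} [Field F] [Field K] [Algebra F K]
    (hK : IsFunctionField F K) (t : K) (ht : Transcendental F t)
    (halg : ∀ z : K, IsAlgebraic (adjoin F {t}) z) :
    letI := (ratFuncEval t ht).toRingHom.toAlgebra
    FiniteDimensional (RatFunc F) K := by
  let _ := (ratFuncEval t ht).toRingHom.toAlgebra
  have : IsScalarTower F (RatFunc F) K :=
    IsScalarTower.of_algebraMap_eq fun z => ((ratFuncEval t ht).commutes z).symm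
  have : Algebra.IsAlgebraic (RatFunc F) K := by
    refine ⟨fun z => (halg z).of_range_subset ?_⟩
    rintro _ ⟨y, rfl⟩
    exact ratFuncEval_range t ht y y.2
  exact finiteDimensional_of_isFunctionField hK.of_tower

theorem exists_laurent_place {F : Type u} {K : Type v} [Field F] [Field K] [Algebra F K]
    (hK : IsFunctionField F K) (t : K) (ht : Transcendental F t)
    (halg : ∀ z : K, IsAlgebraic (adjoin F {t}) z) (p : ℕ) [ExpChar F p] :
    ∃ (n : ℕ) (B : Set F), B.Finite ∧ ∀ c : F, c ∉ B → ∃ (κ : Type u) (_ : Field κ)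
      (j : F →+* κ) (ι : K →+* LaurentSeries κ),
        (∀ z : F, ι (algebraMap F K z) = HahnSeries.C (j z ^ p ^ n)) ∧
        ι (t - algebraMap F K c) = HahnSeries.single 1 1 ^ p ^ n := by
  let _ := (ratFuncEval t ht).toRingHom.toAlgebra
  have hfin := finiteDimensional_ratFunc hK t ht halg
  obtain ⟨n, r, hr, H⟩ := exists_frobenius_embedding (F := F) (K := K) p
  refine ⟨n, {c | r.IsRoot c}, Polynomial.finite_setOfPred_isRoot hr, fun c hc => ?_⟩
  obtain ⟨κ, _, j, ι, -, hι⟩ := H c hc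
  refine ⟨κ, _, j, ι, fun z => ?_, ?_⟩
  · have h1 : algebraMap F K z = algebraMap (RatFunc F) K (algebraMap F[X] _ (C z)) :=
      ((ratFuncEval t ht).commutes z).symm
    rw [h1, hι, ratExpandAt_algebraMap]
    simp [← _root_.map_pow]
  · have h1 : t - algebraMap F K c = algebraMap (RatFunc F) K (algebraMap F[X] _ (X - C c)) := by
      have h2 := ratFuncEval_X t ht
      have h3 : algebraMap (RatFunc F) K (algebraMap F[X] _ (C c)) = algebraMap F K c :=
        (ratFuncEval t ht).commutes c
      rw [_root_.map_sub, _root_.map_sub, h3, RatFunc.algebraMap_X]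
      congr 1
      exact h2.symm
    rw [h1, hι, ratExpandAt_algebraMap]
    congr 1
    simp

/-- A transcendental element is part of a transcendence basis. -/
lemma exists_intermediateField_of_transcendental {M K : Type*} [Field M] [Field K] [Algebra M K]
    (x : K) (hx : Transcendental M x) :
    ∃ F : IntermediateField M K, Transcendental F x ∧ ∀ z : K, IsAlgebraic (adjoin F {x}) z := by
  have h1 : AlgebraicIndepOn M id ({x} : Set K) :=
    (algebraicIndependent_singleton_iff (x := fun i : ({x} : Set K) => (i : K)) ⟨x, rfl⟩).mpr hx
  obtain ⟨B, hB, hbas⟩ := exists_isTranscendenceBasis_superset h1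
  rw [Set.singleton_subset_iff] at hB
  have himage : B \ {x} = Subtype.val '' {b : B | b.1 ≠ x} := by
    ext b
    simp [and_comm]
  refine ⟨adjoin M (B \ {x}), ?_, fun z => ?_⟩
  · rw [transcendental_adjoin_iff, himage]
    exact hbas.1.transcendental_adjoin (s := {b | b.1 ≠ x}) (i := ⟨x, hB⟩) (by simp)
  · have h2 := hbas.isAlgebraic_field.isAlgebraic z
    rw [Subtype.range_coe] at h2
    have h3 : adjoin M B ≤ (adjoin (adjoin M (B \ {x})) {x}).restrictScalars M := by
      rw [adjoin_adjoin_left]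
      exact adjoin.mono _ _ _ (by simp)
    refine h2.of_range_subset ?_
    rintro _ ⟨y, rfl⟩
    exact ⟨⟨y, h3 y.2⟩, rfl⟩

lemma order_single_one_pow {κ : Type*} [Field κ] (e : ℕ) :
    ((HahnSeries.single 1 1 : LaurentSeries κ) ^ e).order = e := by
  rw [HahnSeries.single_pow]
  simp [HahnSeries.order_single]

/-- An element outside a relatively algebraically closed `M` has a translate which is not an
`ℓ`-th power modulo `M`. -/
theorem exists_translate_ne_mul_pow {k K : Type*} [Field k] [Field K] [Algebra k K]
    [IsAlgClosed k] {ℓ : ℕ} [Fact ℓ.Prime] (hk : (ℓ : k) ≠ 0) (hK : IsFunctionField k K)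
    {M : IntermediateField k K} (hM : RelAlgClosed M) {x : K} (hx : x ∉ M) :
    ∃ c : k, ∀ m ∈ M, ∀ z : K, x - algebraMap k K c ≠ m * z ^ ℓ := by
  have htr : Transcendental M x := fun h => hx (hM x h)
  obtain ⟨F, hF, halg⟩ := exists_intermediateField_of_transcendental x htr
  have : IsScalarTower k F K := IsScalarTower.of_algebraMap_eq fun _ => rfl
  have := expChar_of_injective_algebraMap (algebraMap k F).injective (ringExpChar k)
  obtain ⟨n, B, hB, H⟩ := exists_laurent_place (hK.of_tower (F := F)) x hF halg (ringExpChar k)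
  have hB' := hB.preimage ((algebraMap k F).injective.injOn (s := algebraMap k F ⁻¹' B))
  have := IsAlgClosed.instInfinite (K := k)
  obtain ⟨c, hc⟩ := hB'.exists_notMem
  obtain ⟨κ, _, j, ι, h1, h2⟩ := H (algebraMap k F c) hc
  refine ⟨c, fun m hm z h => ?_⟩
  have hne : x - algebraMap k K c ≠ 0 := by
    rw [sub_ne_zero]
    rintro rfl
    exact hx (M.algebraMap_mem c)
  have hm0 : m ≠ 0 := by
    rintro rfl
    exact hne (by rw [h, zero_mul])
  have hz0 : z ≠ 0 := by
    rintro rfl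
    exact hne (by rw [h, zero_pow (Fact.out : ℓ.Prime).ne_zero, mul_zero])
  have hmo : (ι m).order = 0 := by
    have : m = algebraMap F K (algebraMap M F ⟨m, hm⟩) := rfl
    rw [this, h1, HahnSeries.order_C]
  have h3 := congrArg HahnSeries.order (congrArg ι h)
  rw [show algebraMap k K c = algebraMap F K (algebraMap k F c) from rfl, h2,
    order_single_one_pow, _root_.map_mul, _root_.map_pow,
    HahnSeries.order_mul ((_root_.map_ne_zero ι).mpr hm0)
      (pow_ne_zero _ ((_root_.map_ne_zero ι).mpr hz0)), hmo, HahnSeries.order_pow, zero_add,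
    nsmul_eq_mul] at h3
  have hcop := coprime_expChar_pow (ℓ := ℓ) hk (ringExpChar k) n
  have hdvd : (ℓ : ℤ) ∣ ((ringExpChar k ^ n : ℕ) : ℤ) := ⟨_, by exact_mod_cast h3⟩
  have := Nat.dvd_gcd (Int.natCast_dvd_natCast.mp hdvd) dvd_rfl
  rw [hcop] at this
  exact (Fact.out : ℓ.Prime).one_lt.ne' (Nat.dvd_one.mp this)

end Place

section Inclusion

variable {k K : Type*} [Field k] [Field K] [Algebra k K]

lemma K1proj_mem_Omega_iff {ℓ : ℕ} {L : IntermediateField k K} {a : Kˣ} :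
    K1proj ℓ K a ∈ Omega ℓ L ↔ ∃ b : Kˣ, (b : K) ∈ L ∧ ∃ z : Kˣ, a = b * z ^ ℓ := by
  constructor
  · rintro ⟨b, hb, h⟩
    exact ⟨b, hb, K1proj_eq_iff.mp h.symm⟩
  · rintro ⟨b, hb, h⟩
    exact ⟨b, hb, (K1proj_eq_iff.mpr h).symm⟩

lemma Omega_mono {ℓ : ℕ} {L M : IntermediateField k K} (h : L ≤ M) : Omega ℓ L ≤ Omega ℓ M :=
  Subgroup.map_mono fun _ hx => h hx

theorem le_of_Omega_le [IsAlgClosed k] {ℓ : ℕ} [Fact ℓ.Prime] (hk : (ℓ : k) ≠ 0)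
    (hK : IsFunctionField k K) {L M : IntermediateField k K} (hM : RelAlgClosed M)
    (h : Omega ℓ L ≤ Omega ℓ M) : L ≤ M := by
  intro x hx
  by_contra hxM
  obtain ⟨c, hc⟩ := exists_translate_ne_mul_pow hk hK hM hxM
  have hne : x - algebraMap k K c ≠ 0 := by
    rw [sub_ne_zero]
    rintro rfl
    exact hxM (M.algebraMap_mem c)
  obtain ⟨b, hb, z, hz⟩ := K1proj_mem_Omega_iff.mp
    (h (K1proj_mem_Omega_iff (a := Units.mk0 _ hne).mpr ⟨Units.mk0 _ hne,
        sub_mem hx (L.algebraMap_mem c), 1, by simp⟩))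
  exact hc b hb z (by simpa using congrArg Units.val hz)

lemma relAlgClosed_bot [IsAlgClosed k] : RelAlgClosed (⊥ : IntermediateField k K) := by
  intro x hx
  have h : IsAlgebraic k x := hx.of_range_subset <| by
    rintro _ ⟨y, rfl⟩
    obtain ⟨c, hc⟩ := IntermediateField.mem_bot.mp y.2
    exact ⟨c, hc⟩
  exact IntermediateField.mem_bot.mpr (mem_range_algebraMap_of_isAlgebraic h)

lemma K1proj_mem_Omega_bot [IsAlgClosed k] {ℓ : ℕ} (hℓ : ℓ ≠ 0) (a : Kˣ) :
    K1proj ℓ K a ∈ Omega ℓ (⊥ : IntermediateField k K) ↔ K1proj ℓ K a = 1 := by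
  refine ⟨fun h => ?_, fun h => h ▸ one_mem _⟩
  obtain ⟨b, hb, z, rfl⟩ := K1proj_mem_Omega_iff.mp h
  obtain ⟨c, hc⟩ := IntermediateField.mem_bot.mp hb
  obtain ⟨d, rfl⟩ := IsAlgClosed.exists_pow_nat_eq c (Nat.pos_of_ne_zero hℓ)
  rw [K1proj_eq_one_iff]
  have hd : algebraMap k K d ≠ 0 := by
    intro h0
    rw [map_pow, h0, zero_pow hℓ] at hc
    exact b.ne_zero hc.symm
  refine ⟨Units.mk0 _ hd * z, ?_⟩
  rw [mul_pow]
  congr 1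
  ext
  simp [← hc]

end Inclusion

section Descent
open Polynomial IntermediateField

lemma exists_pow_mem_of_fixed {K Ω : Type*} [Field K] [Field Ω] [Algebra K Ω] [IsAlgClosure K Ω]
    (p : ℕ) [ExpChar K p] (z : Ω) (hz : ∀ σ : Ω ≃ₐ[K] Ω, σ z = z) :
    ∃ n, z ^ p ^ n ∈ (algebraMap K Ω).range := by
  have : Algebra.IsAlgebraic K Ω := IsAlgClosure.isAlgebraic
  have := IsAlgClosure.isAlgClosed K (K := Ω)
  have := expChar_of_injective_algebraMap (algebraMap K (separableClosure K Ω)).injective p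
  obtain ⟨n, w, hw⟩ := IsPurelyInseparable.pow_mem (separableClosure K Ω) p z
  refine ⟨n, ?_⟩
  by_contra hcon
  have hsep : IsSeparable K (z ^ p ^ n) := by
    rw [← hw]
    exact mem_separableClosure_iff.mp w.2
  have h1 : z ^ p ^ n ∉ (⊥ : Subalgebra K Ω) := by
    rwa [Algebra.mem_bot]
  rw [notMem_iff_exists_ne_and_isConjRoot hsep (IsAlgClosed.splits _)] at h1
  obtain ⟨y, hne, hy⟩ := h1
  obtain ⟨σ, hσ⟩ := isConjRoot_iff_exists_algEquiv.mp hy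
  refine hne (σ.injective ?_)
  rw [hσ, _root_.map_pow, hz]

lemma exists_eq_mul_pow_of_pow_coprime {K S : Type*} [Field K] [SetLike S K] [SubfieldClass S K]
    {L : S} {e ℓ : ℕ} (h : e.Coprime ℓ) (hℓ : 1 < ℓ) {b l z : K} (hl : l ∈ L) (hb : b ≠ 0)
    (hbz : b ^ e = l * z ^ ℓ) : ∃ l' ∈ L, ∃ z' : K, b = l' * z' ^ ℓ := by
  obtain ⟨m, -, hm⟩ := Nat.exists_mul_mod_eq_one_of_coprime h hℓ
  set j := e * m / ℓ
  have hj : e * m = ℓ * j + 1 := by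
    have := Nat.div_add_mod (e * m) ℓ
    rw [hm] at this
    exact this.symm
  refine ⟨l ^ m, pow_mem hl m, z ^ m / b ^ j, ?_⟩
  have h1 : b ^ (ℓ * j + 1) = l ^ m * (z ^ m) ^ ℓ := by
    rw [← hj, pow_mul, hbz, mul_pow, ← pow_mul, ← pow_mul, mul_comm ℓ m]
  rw [div_pow, ← mul_div_assoc, ← h1, pow_succ, ← pow_mul, mul_comm j ℓ]
  field_simp

/-- If an `ℓ`-th root of `b ∈ K` lies in the compositum of `K` with the algebraic closure of a
relatively algebraically closed subfield `L`, then `b` is an `ℓ`-th power modulo `L`. -/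
theorem exists_eq_mul_pow_of_mem_adjoin {k K Ω : Type*} [Field k] [Field K] [Algebra k K]
    [Field Ω] [Algebra K Ω] [IsAlgClosure K Ω] [IsAlgClosed k] {ℓ : ℕ} [Fact ℓ.Prime]
    (hk : (ℓ : k) ≠ 0) {L : IntermediateField k K} (hL : RelAlgClosed L) {b : K} (hb : b ≠ 0) {y :
        Ω} (hy : y ^ ℓ = algebraMap K Ω b)
    (hmem : y ∈ adjoin K (algebraicClosure L Ω : Set Ω)) :
    ∃ l ∈ L, ∃ z : K, b = l * z ^ ℓ := by
  have hℓ0 : ℓ ≠ 0 := (Fact.out : ℓ.Prime).ne_zero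
  have : Algebra.IsAlgebraic K Ω := IsAlgClosure.isAlgebraic
  set Λ := algebraicClosure L Ω with hΛ
  have hspan : y ∈ Submodule.span Λ (Set.range (algebraMap K Ω)) := by
    have h1 : y ∈ (adjoin K (Λ : Set Ω)).toSubalgebra := hmem
    rw [adjoin_toSubalgebra_of_isAlgebraic fun x _ => Algebra.IsAlgebraic.isAlgebraic x,
      ← Subalgebra.mem_toSubmodule, Algebra.adjoin_eq_span,
      show (Λ : Set Ω) = (Λ.toSubalgebra.toSubsemiring.toSubmonoid : Set Ω) from rfl,
      Submonoid.closure_eq] at h1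
    clear hmem hy
    induction h1 using Submodule.span_induction with
    | mem x hx =>
      have h2 : x = (⟨x, hx⟩ : Λ) • (algebraMap K Ω 1) := by
        rw [_root_.map_one, Algebra.smul_def, mul_one]
        rfl
      rw [h2]
      exact Submodule.smul_mem _ _ (Submodule.subset_span ⟨1, rfl⟩)
    | zero => exact zero_mem _
    | add _ _ _ _ h1 h2 => exact add_mem h1 h2
    | smul a x _ hx =>
      clear * - hx
      induction hx using Submodule.span_induction with
      | mem x hx =>
        obtain ⟨c, rfl⟩ := hx
        refine Submodule.subset_span ⟨a * c, ?_⟩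
        rw [_root_.map_mul, Algebra.smul_def]
      | zero => simp
      | add _ _ _ _ h1 h2 => rw [smul_add]; exact add_mem h1 h2
      | smul c x _ hx => rw [smul_comm]; exact Submodule.smul_mem _ _ hx
  obtain ⟨s, hs, hspan', hli⟩ := exists_linearIndependent Λ (Set.range (algebraMap K Ω))
  rw [← hspan'] at hspan
  rw [← Subtype.range_coe (s := s), Finsupp.mem_span_range_iff_exists_finsupp] at hspan
  obtain ⟨c, hc⟩ := hspan
  have hbΩ : algebraMap K Ω b ≠ 0 := (_root_.map_ne_zero _).mpr hb
  have hy0 : y ≠ 0 := by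
    rintro rfl
    rw [zero_pow hℓ0] at hy
    exact hbΩ hy.symm
  have hc0 : c ≠ 0 := by
    rintro rfl
    exact hy0 (by simpa using hc.symm)
  obtain ⟨i, hi⟩ := Finsupp.ne_iff.mp hc0
  rw [Finsupp.zero_apply] at hi
  set e : Ω := (c i : Ω) with he
  have he0 : e ≠ 0 := by simpa [he] using hi
  have key : ∀ σ : Ω ≃ₐ[K] Ω, ∃ χ : Ω, χ ^ ℓ = 1 ∧ σ y = χ * y ∧ σ e = χ * e := by
    intro σ
    have h1 : (σ y / y) ^ ℓ = 1 := by
      rw [div_pow, ← _root_.map_pow, hy, σ.commutes, div_self hbΩ]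
    have hχ : σ y / y ∈ Λ := by
      rw [mem_algebraicClosure_iff]
      refine ⟨X ^ ℓ - 1, X_pow_sub_C_ne_zero (Nat.pos_of_ne_zero hℓ0) 1, ?_⟩
      simp [h1]
    set χ : Λ := ⟨σ y / y, hχ⟩
    have h2 : σ y = χ * y := (div_mul_cancel₀ _ hy0).symm
    refine ⟨χ, h1, h2, ?_⟩
    have hσΛ : ∀ a : Λ, σ (a : Ω) ∈ Λ := by
      intro a
      rw [mem_algebraicClosure_iff]
      have := mem_algebraicClosure_iff.mp a.2
      exact this.algHom ((σ : Ω →ₐ[K] Ω).restrictScalars L)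
    let c' : s →₀ Λ := c.mapRange (fun a : Λ => (⟨σ (a : Ω), hσΛ a⟩ : Λ)) (by ext; simp)
    have h3 : c' = χ • c := by
      have hinj : Function.Injective (Finsupp.linearCombination Λ (Subtype.val : s → Ω)) := hli
      apply hinj
      rw [_root_.map_smul, Finsupp.linearCombination_apply, Finsupp.linearCombination_apply, hc,
        Finsupp.sum_mapRange_index (by simp)]
      have h4 : χ • y = σ y := h2.symm
      rw [h4, ← hc, Finsupp.sum, Finsupp.sum, _root_.map_sum]
      refine Finset.sum_congr rfl fun a _ => ?_
      obtain ⟨d, hd⟩ := hs a.2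
      change σ (c a) * a = σ ((c a : Ω) * a)
      rw [_root_.map_mul, ← hd, σ.commutes]
    exact congrArg Subtype.val (DFunLike.congr_fun h3 i)
  set p := ringExpChar k
  have := expChar_of_injective_algebraMap (algebraMap k K).injective p
  obtain ⟨n, z, hz⟩ := exists_pow_mem_of_fixed (K := K) p (y / e) fun σ => by
    obtain ⟨χ, h1, h2, h3⟩ := key σ
    have hχ : χ ≠ 0 := by
      rintro rfl
      rw [zero_pow hℓ0] at h1
      exact zero_ne_one h1
    rw [map_div₀, h2, h3, mul_div_mul_left _ _ hχ]
  have hzℓ : algebraMap K Ω (b ^ p ^ n) = e ^ (ℓ * p ^ n) * algebraMap K Ω (z ^ ℓ) := by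
    rw [_root_.map_pow, _root_.map_pow, hz, ← hy, div_pow, div_pow, ← pow_mul, ← pow_mul,
      ← pow_mul, mul_comm (p ^ n) ℓ]
    field_simp
  have hz0 : z ≠ 0 := by
    rintro rfl
    rw [zero_pow hℓ0, _root_.map_zero, mul_zero, _root_.map_eq_zero] at hzℓ
    exact pow_ne_zero _ hb hzℓ
  set l : K := b ^ p ^ n / z ^ ℓ with hl
  have hlL : l ∈ L := by
    apply hL
    have h1 : algebraMap K Ω l = e ^ (ℓ * p ^ n) := by
      rw [hl, map_div₀, hzℓ]
      field_simp [(_root_.map_ne_zero (algebraMap K Ω)).mpr hz0]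
    have h2 : IsAlgebraic L (algebraMap K Ω l) := by
      rw [h1]
      exact (mem_algebraicClosure_iff.mp (c i).2).pow _
    exact (isAlgebraic_algebraMap_iff (algebraMap K Ω).injective).mp h2
  have hcop := coprime_expChar_pow (ℓ := ℓ) hk p n
  have hbz : b ^ p ^ n = l * z ^ ℓ := by rw [hl]; field_simp
  exact exists_eq_mul_pow_of_pow_coprime hcop (Fact.out : ℓ.Prime).one_lt hlL hb hbz

end Descent

section Kummer
open Polynomial IntermediateField

lemma irreducible_minpoly_map_adjoin_root {E Ω : Type*} [Field E] [Field Ω] [Algebra E Ω] {ℓ : ℕ}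
    (hℓ : ℓ.Prime) {θ y : Ω} (hθ : IsIntegral E θ) {b : E} (hy : y ^ ℓ = algebraMap E Ω b)
    (hno : ∀ z ∈ adjoin E {θ}, z ^ ℓ ≠ algebraMap E Ω b) :
    Irreducible ((minpoly E θ).map (algebraMap E (adjoin E {y}))) := by
  have hyint : IsIntegral E y := by
    refine ⟨X ^ ℓ - C b, monic_X_pow_sub_C b hℓ.ne_zero, ?_⟩
    simp [hy]
  have hθ' : IsIntegral (adjoin E {y}) θ := hθ.tower_top
  have hy' : IsIntegral (adjoin E {θ}) y := hyint.tower_top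
  have hdeg : (minpoly (adjoin E {θ}) y).natDegree = ℓ := by
    set b' : adjoin E {θ} := algebraMap E _ b
    have hirr : Irreducible (X ^ ℓ - C b') := by
      refine X_pow_sub_C_irreducible_of_prime hℓ fun z hz => hno z z.2 ?_
      exact congrArg Subtype.val hz
    rw [← minpoly.eq_of_irreducible_of_monic hirr (x := y) ?_ (monic_X_pow_sub_C b' hℓ.ne_zero),
      natDegree_X_pow_sub_C]
    rw [_root_.map_sub, _root_.map_pow, aeval_X, aeval_C, hy, sub_eq_zero]
    rfl
  have hdeg' : (minpoly E y).natDegree ≤ ℓ := by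
    have h1 : minpoly E y ∣ X ^ ℓ - C b := minpoly.dvd _ _ (by simp [hy])
    have h2 := natDegree_le_of_dvd h1 (X_pow_sub_C_ne_zero hℓ.pos b)
    rwa [natDegree_X_pow_sub_C] at h2
  have h1 := Module.finrank_mul_finrank E (adjoin E {θ}) (adjoin (adjoin E {θ}) {y})
  have h2 := Module.finrank_mul_finrank E (adjoin E {y}) (adjoin (adjoin E {y}) {θ})
  have h3 : Module.finrank E (adjoin (adjoin E {θ}) {y}) =
      Module.finrank E (adjoin (adjoin E {y}) {θ}) :=
    (equivOfEq (adjoin_simple_comm E (α := θ) (β := y))).toLinearEquiv.finrank_eq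
  rw [adjoin.finrank hθ, adjoin.finrank hy', hdeg] at h1
  rw [adjoin.finrank hyint, adjoin.finrank hθ'] at h2
  have h4 : (minpoly E θ).natDegree ≤ (minpoly (adjoin E {y}) θ).natDegree := by
    have : (minpoly E θ).natDegree * ℓ ≤ (minpoly (adjoin E {y}) θ).natDegree * ℓ := by
      rw [h1, h3, ← h2, mul_comm]
      exact Nat.mul_le_mul_left _ hdeg'
    exact Nat.le_of_mul_le_mul_right this hℓ.pos
  have h5 : minpoly (adjoin E {y}) θ = (minpoly E θ).map (algebraMap E (adjoin E {y})) := by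
    refine (eq_of_monic_of_dvd_of_natDegree_le (minpoly.monic hθ') ((minpoly.monic hθ).map _)
      ?_ ?_).symm
    · exact minpoly.dvd_map_of_isScalarTower E _ θ
    · rwa [natDegree_map]
  rw [← h5]
  exact minpoly.irreducible hθ'

end Kummer

section Specialization

/-- A domain of finite type over an algebraically closed field has a rational point. -/
lemma exists_algHom_of_finiteType {k R : Type*} [Field k] [IsAlgClosed k] [CommRing R]
    [Nontrivial R] [Algebra k R] [Algebra.FiniteType k R] : Nonempty (R →ₐ[k] k) := by
  obtain ⟨m, hm⟩ := Ideal.exists_maximal R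
  let _ := Ideal.Quotient.field m
  have : Module.Finite k (R ⧸ m) := finite_of_finite_type_of_isJacobsonRing k (R ⧸ m)
  have hbij := IsAlgClosed.algebraMap_bijective_of_isIntegral (k := k) (K := R ⧸ m)
  let e := AlgEquiv.ofBijective (Algebra.ofId k (R ⧸ m)) hbij
  exact ⟨e.symm.toAlgHom.comp (Ideal.Quotient.mkₐ k m)⟩

open Polynomial in
lemma exists_finset_forall_lift {σ Λ : Type*} [Field Λ] (P : (MvPolynomial σ Λ)[X]) :
    ∃ S : Finset Λ, ∀ R : Subring Λ, (S : Set Λ) ⊆ R →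
      ∃ P' : (MvPolynomial σ R)[X], P'.map (MvPolynomial.map R.subtype) = P := by
  classical
  refine ⟨P.support.biUnion fun n => (P.coeff n).coeffs, fun R hR => ?_⟩
  refine (mem_lifts P).mp ((lifts_iff_coeff_lifts P).mpr fun n => ?_)
  rw [MvPolynomial.mem_range_map_iff_coeffs_subset]
  intro a ha
  by_cases hn : n ∈ P.support
  · exact ⟨⟨a, hR (by simpa using ⟨n, by simpa using hn, ha⟩)⟩, rfl⟩
  · rw [notMem_support_iff.mp hn] at ha
    simp at ha

end Specialization

section PowVar
open MvPolynomial

/-- The substitution raising the variable `i` to its `ℓ`-th power. -/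
def powVar {σ : Type*} (R : Type*) [CommRing R] [DecidableEq σ] (ℓ : ℕ) (i : σ) :
    MvPolynomial σ R →ₐ[R] MvPolynomial σ R :=
  aeval fun j => if j = i then X j ^ ℓ else X j

lemma map_comp_powVar {σ R S : Type*} [CommRing R] [CommRing S] [DecidableEq σ] (ℓ : ℕ) (i : σ)
    (f : R →+* S) :
    (map f).comp (powVar R ℓ i).toRingHom = (powVar S ℓ i).toRingHom.comp (map f) := by
  apply MvPolynomial.ringHom_ext
  · intro r
    simp [powVar]
  · intro j
    by_cases h : j = i <;> simp [powVar, h]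

lemma powVar_injective {σ R : Type*} [CommRing R] [DecidableEq σ] {ℓ : ℕ} (hℓ : 0 < ℓ) (i : σ) :
    Function.Injective (powVar R ℓ i) := by
  have h : ((aeval fun j => if j = i then X j else X j ^ ℓ :
      MvPolynomial σ R →ₐ[R] MvPolynomial σ R)).comp (powVar R ℓ i) = expand ℓ := by
    apply MvPolynomial.algHom_ext
    intro j
    by_cases h : j = i <;> simp [powVar, h]
  have h2 : Function.Injective (expand ℓ : MvPolynomial σ R →ₐ[R] MvPolynomial σ R) :=
    expand_injective hℓ
  rw [← h, AlgHom.coe_comp] at h2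
  exact Function.Injective.of_comp h2

lemma powVar_mul_X_ne {σ F : Type*} [Field F] [DecidableEq σ] {ℓ : ℕ} {ζ : F} (hζ : ζ ^ ℓ = 1)
    (hζ1 : ζ ≠ 1) (i : σ) (a d : MvPolynomial σ F) (hℓ : 0 < ℓ) (hd : d ≠ 0) :
    powVar F ℓ i d * X i ≠ powVar F ℓ i a := by
  intro h
  let s : MvPolynomial σ F →ₐ[F] MvPolynomial σ F := aeval fun j => if j = i then C ζ * X j else X j
  have hs : s.comp (powVar F ℓ i) = powVar F ℓ i := by
    apply MvPolynomial.algHom_ext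
    intro j
    by_cases h : j = i
    · subst h
      have h3 : s (X j) = C ζ * X j := by simp [s]
      have h4 : powVar F ℓ j (X j) = X j ^ ℓ := by simp [powVar]
      rw [AlgHom.comp_apply, h4, map_pow, h3, mul_pow, ← map_pow, hζ, C_1, one_mul]
    · simp [powVar, s, h]
  have hs' : ∀ p, s (powVar F ℓ i p) = powVar F ℓ i p := fun p => DFunLike.congr_fun hs p
  have h1 := congrArg s h
  rw [map_mul, hs', hs', ← h] at h1
  have h2 := mul_left_cancel₀ ((map_ne_zero_iff _ (powVar_injective hℓ i)).mpr hd) h1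
  have h3 : s (X i) = C ζ * X i := by simp [s]
  rw [h3] at h2
  have h4 := mul_right_cancel₀ (X_ne_zero i) (h2.trans (one_mul _).symm)
  rw [← C_1] at h4
  exact hζ1 (C_injective _ _ h4)

end PowVar

section ResidueField
open Polynomial

/-- If `G` stays irreducible after extracting an `ℓ`-th root of the variable `i`, then this variable
is not an `ℓ`-th power in the function field of the hypersurface `G = 0`. -/
theorem exists_field_root_forall_pow_ne {k : Type u} {σ : Type v} [Field k] [IsAlgClosed k]
    [DecidableEq σ] {ℓ : ℕ} (hℓ : ℓ.Prime) (hk : (ℓ : k) ≠ 0) (i : σ)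
    (G : (MvPolynomial σ k)[X]) (hG : G.Monic)
    (hirr : Irreducible (G.map (powVar k ℓ i).toRingHom)) :
    ∃ (κ : Type (max u v)) (_ : Field κ) (j : FractionRing (MvPolynomial σ k) →+* κ) (θ : κ),
      eval₂ (j.comp (algebraMap (MvPolynomial σ k) _)) θ G = 0 ∧
      ∀ w : κ, w ^ ℓ ≠ j (algebraMap (MvPolynomial σ k) _ (MvPolynomial.X i)) := by
  set A := MvPolynomial σ k
  set F := FractionRing A
  have hinj : Function.Injective ((algebraMap A F).comp (powVar k ℓ i).toRingHom) :=
    (IsFractionRing.injective A F).comp (powVar_injective hℓ.pos i)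
  let e : F →+* F := IsFractionRing.lift hinj
  have he : ∀ a : A, e (algebraMap A F a) = algebraMap A F (powVar k ℓ i a) :=
    fun a => IsFractionRing.lift_algebraMap hinj a
  set P : F[X] := (G.map (powVar k ℓ i).toRingHom).map (algebraMap A F) with hP
  have hPm : P.Monic := (hG.map _).map _
  have hPirr : Irreducible P :=
    (Monic.irreducible_iff_irreducible_map_fraction_map (K := F) (hG.map _)).mp hirr
  have := Fact.mk hPirr
  let j : F →+* AdjoinRoot P := (AdjoinRoot.of P).comp e
  set θ : AdjoinRoot P := AdjoinRoot.root P with hθ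
  have hmin : ∀ g : F[X], g.degree < P.degree → eval₂ (AdjoinRoot.of P) θ g = 0 → g = 0 := by
    intro g hg h
    have h1 : AdjoinRoot.mk P g = 0 := by
      rw [← AdjoinRoot.aeval_eq]
      exact h
    rw [AdjoinRoot.mk_eq_zero] at h1
    exact eq_zero_of_dvd_of_degree_lt h1 hg
  have hroot : eval₂ (j.comp (algebraMap A F)) θ G = 0 := by
    have h1 : eval₂ (AdjoinRoot.of P) θ
        ((G.map (powVar k ℓ i).toRingHom).map (algebraMap A F)) = 0 := AdjoinRoot.eval₂_root P
    rw [eval₂_map, eval₂_map] at h1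
    have h2 : j.comp (algebraMap A F) =
        ((AdjoinRoot.of P).comp (algebraMap A F)).comp (powVar k ℓ i).toRingHom :=
      RingHom.ext fun a => congrArg (AdjoinRoot.of P) (he a)
    rw [h2]
    exact h1
  clear_value θ
  let o := AdjoinRoot.of P
  let _ : Algebra F (AdjoinRoot P) := j.toAlgebra
  have h_int : IsIntegral F θ := by
    refine ⟨G.map (algebraMap A F), hG.map _, ?_⟩
    rw [eval₂_map]
    exact hroot
  let κ := IntermediateField.adjoin F {θ}
  have hmap : ((algebraMap κ (AdjoinRoot P)).comp (algebraMap F κ)) = j := rfl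
  refine ⟨κ, inferInstance, algebraMap F κ, ⟨θ, IntermediateField.mem_adjoin_simple_self F θ⟩, ?_,
    ?_⟩
  · apply (algebraMap κ (AdjoinRoot P)).injective
    rw [hom_eval₂, ← RingHom.comp_assoc, hmap, map_zero]
    exact hroot
  · rintro ⟨w, hw⟩ h
    have hwℓ : w ^ ℓ = j (algebraMap A F (MvPolynomial.X i)) := congrArg Subtype.val h
    have hX : j (algebraMap A F (MvPolynomial.X i)) = o (algebraMap A F (MvPolynomial.X i)) ^ ℓ :=
        by
      change o (e _) = _
      rw [he, ← map_pow, ← map_pow]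
      congr 2
      simp [powVar]
    have hw' : w ∈ (IntermediateField.adjoin F {θ}).toSubalgebra := hw
    rw [IntermediateField.adjoin_simple_toSubalgebra_of_isAlgebraic h_int.isAlgebraic,
      Algebra.adjoin_singleton_eq_range_aeval] at hw'
    obtain ⟨g, rfl⟩ := hw'
    set G' := G.map (algebraMap A F)
    have hG' : G'.Monic := hG.map _
    have hgmod : aeval θ (g %ₘ G') = aeval θ g := by
      refine aeval_modByMonic_eq_self_of_root ?_
      rw [aeval_def, eval₂_map]
      exact hroot
    set g' := g %ₘ G'
    set x : AdjoinRoot P := o (algebraMap A F (MvPolynomial.X i)) with hx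
    have hx0 : x ≠ 0 := by
      rw [hx, _root_.map_ne_zero, ne_eq, IsFractionRing.to_map_eq_zero_iff]
      exact MvPolynomial.X_ne_zero i
    have hroot1 : ((aeval θ g : AdjoinRoot P) / x) ^ ℓ = 1 := by
      rw [div_pow, ← hX]
      exact (congrArg (· / _) hwℓ).trans (div_self (by rw [hX]; exact pow_ne_zero _ hx0))
    have : NeZero (ℓ : k) := ⟨hk⟩
    have : NeZero ℓ := ⟨hℓ.ne_zero⟩
    obtain ⟨ζ, hζ⟩ := HasEnoughRootsOfUnity.exists_primitiveRoot k ℓ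
    let c : k →+* AdjoinRoot P := o.comp ((algebraMap A F).comp MvPolynomial.C)
    obtain ⟨m, -, hm⟩ := (hζ.map_of_injective c.injective).eq_pow_of_pow_eq_one hroot1
    have hw2 : (aeval θ g : AdjoinRoot P) =
        o (algebraMap A F (MvPolynomial.C (ζ ^ m) * MvPolynomial.X i)) := by
      rw [eq_div_iff hx0] at hm
      rw [← hm, map_mul, map_mul, map_pow, map_pow, map_pow]
      rfl
    have hdeg : P.degree = G'.degree := by
      rw [hP, degree_map_eq_of_leadingCoeff_ne_zero _ (by simp [(hG.map _).leadingCoeff]),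
        degree_map_eq_of_leadingCoeff_ne_zero _ (by simp [hG.leadingCoeff]),
        degree_map_eq_of_leadingCoeff_ne_zero _ (by simp [hG.leadingCoeff])]
    have hzero := hmin (C (algebraMap A F (MvPolynomial.C (ζ ^ m) * MvPolynomial.X i)) - g'.map e)
      (lt_of_le_of_lt (degree_sub_le _ _) (max_lt
        (lt_of_le_of_lt degree_C_le (degree_pos_of_irreducible hPirr))
        (lt_of_le_of_lt degree_map_le (hdeg ▸ degree_modByMonic_lt g hG'))))
      (by
        rw [eval₂_sub, eval₂_C, eval₂_map, ← hw2, ← hgmod, sub_eq_zero]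
        rfl)
    have hcoeff : algebraMap A F (MvPolynomial.C (ζ ^ m) * MvPolynomial.X i) = e (g'.coeff 0) := by
      have := congrArg (coeff · 0) hzero
      rwa [coeff_sub, coeff_C_zero, coeff_map, coeff_zero, sub_eq_zero] at this
    obtain ⟨n, d, hd, hnd⟩ := IsFractionRing.div_surjective (A := A) (g'.coeff 0)
    have hd0 : d ≠ 0 := nonZeroDivisors.ne_zero hd
    have hed : algebraMap A F (powVar k ℓ i d) ≠ 0 := by
      rw [ne_eq, IsFractionRing.to_map_eq_zero_iff]
      exact (map_ne_zero_iff _ (powVar_injective hℓ.pos i)).mpr hd0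
    rw [← hnd, map_div₀, he, he, eq_div_iff hed, ← map_mul] at hcoeff
    have hζ1 : ζ ≠ 1 := hζ.ne_one hℓ.one_lt
    refine powVar_mul_X_ne hζ.pow_eq_one hζ1 i n (MvPolynomial.C (ζ ^ m) * d) hℓ.pos
      (mul_ne_zero ?_ hd0) ?_
    · rw [ne_eq, MvPolynomial.C_eq_zero]
      exact pow_ne_zero _ (hζ.ne_zero hℓ.ne_zero)
    · have h2 : powVar k ℓ i (MvPolynomial.C (ζ ^ m)) = MvPolynomial.C (ζ ^ m) :=
        (powVar k ℓ i).commutes _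
      rw [← IsFractionRing.injective A F hcoeff, map_mul, h2]
      ring

end ResidueField

section Specialization
open Polynomial

theorem exists_irreducible_specialization {k : Type u} {Λ : Type*} {σ : Type v} [Field k] [Field Λ]
    [Algebra k Λ] [IsAlgClosed k] [IsAlgClosed Λ] [Finite σ] [DecidableEq σ] (ℓ : ℕ) (i : σ)
    (t : Λ) (B : Finset k) (hB : ∀ c ∈ B, algebraMap k Λ c ≠ t)
    (f : (MvPolynomial σ k)[X][X]) (G : (MvPolynomial σ Λ)[X]) (hG : G.Monic)
    (hGf : G ∣ f.map (eval₂RingHom (MvPolynomial.map (algebraMap k Λ)) (MvPolynomial.C t)))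
    (hirr : Irreducible (G.map (powVar Λ ℓ i).toRingHom)) :
    ∃ c ∉ B, ∃ g : (MvPolynomial σ k)[X], g.Monic ∧
      g ∣ f.map (evalRingHom (MvPolynomial.C c)) ∧
      Irreducible (g.map (powVar k ℓ i).toRingHom) := by
  classical
  obtain ⟨H, hH⟩ := hGf
  obtain ⟨S₁, hS₁⟩ := exists_finset_forall_irreducible_map _ hirr (hG.map _)
  obtain ⟨S₂, hS₂⟩ := exists_finset_forall_lift G
  obtain ⟨S₃, hS₃⟩ := exists_finset_forall_lift H
  let S : Finset Λ := S₁ ∪ S₂ ∪ S₃ ∪ {t} ∪ B.image fun c => (t - algebraMap k Λ c)⁻¹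
  let R₀ : Subalgebra k Λ := Algebra.adjoin k S
  have hfg : Algebra.FiniteType k R₀ := (Subalgebra.fg_iff_finiteType _).mp ⟨S, rfl⟩
  obtain ⟨φ₀⟩ := exists_algHom_of_finiteType (k := k) (R := R₀)
  let R : Subring Λ := R₀.toSubring
  have hSR : (S : Set Λ) ⊆ R := Algebra.subset_adjoin
  have hsub : ∀ T : Finset Λ, T ⊆ S → (T : Set Λ) ⊆ R := fun T hT z hz => hSR (hT hz)
  let φ : R →+* k := (φ₀ : R₀ →+* k)
  let kR : k →+* R := algebraMap k R₀
  have hφ : φ.comp kR = RingHom.id k := RingHom.ext fun z => φ₀.commutes z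
  have hkR : R.subtype.comp kR = algebraMap k Λ := rfl
  obtain ⟨G', hG'⟩ := hS₂ R (hsub _ (by intro z hz; simp [S, hz]))
  obtain ⟨H', hH'⟩ := hS₃ R (hsub _ (by intro z hz; simp [S, hz]))
  have htR : t ∈ R := hSR (by simp [S])
  have hinj : Function.Injective (MvPolynomial.map (σ := σ) R.subtype) :=
    MvPolynomial.map_injective _ Subtype.val_injective
  have hG'm : G'.Monic := monic_of_injective hinj (by rw [hG']; exact hG)
  have hprod : f.map (eval₂RingHom (MvPolynomial.map kR) (MvPolynomial.C ⟨t, htR⟩)) = G' * H' := by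
    apply map_injective _ hinj
    rw [Polynomial.map_mul, hG', hH', ← hH, Polynomial.map_map]
    congr 1
    refine ringHom_ext' ?_ ?_
    · ext <;> simp [← hkR]
    · simp
  refine ⟨φ ⟨t, htR⟩, ?_, G'.map (MvPolynomial.map φ), hG'm.map _, ⟨H'.map (MvPolynomial.map φ),
      ?_⟩,
    ?_⟩
  · intro hc
    have hne := sub_ne_zero.mpr (hB _ hc).symm
    have hinvR : (t - algebraMap k Λ (φ ⟨t, htR⟩))⁻¹ ∈ R :=
      hSR (by
        simp only [S, Finset.coe_union, Set.mem_union, Finset.mem_coe]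
        exact Or.inr (Finset.mem_image_of_mem _ hc))
    have h1 : ((⟨t, htR⟩ : R) - kR (φ ⟨t, htR⟩)) * ⟨_, hinvR⟩ = 1 :=
      Subtype.ext (mul_inv_cancel₀ hne)
    have h2 := congrArg φ h1
    rw [map_mul, map_sub, ← RingHom.comp_apply, hφ, RingHom.id_apply, sub_self, zero_mul,
      map_one] at h2
    exact zero_ne_one h2
  · rw [← Polynomial.map_mul, ← hprod, Polynomial.map_map]
    congr 1
    refine ringHom_ext' ?_ ?_
    · refine MvPolynomial.ringHom_ext (fun r => ?_) (fun i => ?_)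
      · have h : φ (kR r) = r := RingHom.congr_fun hφ r
        simp [h]
      · simp
    · simp
  · have h1 := hS₁ k R (hsub _ (by intro z hz; simp [S, hz])) φ
      (G'.map (powVar R ℓ i).toRingHom) (by
        rw [Polynomial.map_map, map_comp_powVar, ← Polynomial.map_map, hG']) (hG'm.map _)
    rwa [Polynomial.map_map, map_comp_powVar, ← Polynomial.map_map] at h1

end Specialization

section GeometricFactor
open Polynomial

theorem irreducible_minpoly_map_of_comp_eq {B Ω : Type*} [CommRing B] [IsDomain B]
    [IsIntegrallyClosed B] [Field Ω] [Algebra B Ω] [FaithfulSMul B Ω] {ℓ : ℕ} (hℓ : ℓ.Prime)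
    {θ y : Ω} {b : B} (hθ : IsIntegral B θ) (hy : y ^ ℓ = algebraMap B Ω b) (M : Subfield Ω)
    (hBM : ∀ p, algebraMap B Ω p ∈ M) (hθM : θ ∈ M) (hno : ∀ z ∈ M, z ^ ℓ ≠ algebraMap B Ω b)
    (s : B →+* B) (u : B →+* Ω) (hus : u.comp s = algebraMap B Ω)
    (hu : ∀ M' : Subfield Ω, (∀ p, algebraMap B Ω p ∈ M') → y ∈ M' → ∀ p, u p ∈ M') :
    Irreducible ((minpoly B θ).map s) := by
  let E := FractionRing B
  let _ : Algebra E Ω := FractionRing.liftAlgebra B Ω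
  have hE : minpoly E θ = (minpoly B θ).map (algebraMap B E) :=
    minpoly.isIntegrallyClosed_eq_field_fractions' E hθ
  have hb : algebraMap E Ω (algebraMap B E b) = algebraMap B Ω b :=
    (IsScalarTower.algebraMap_apply B E Ω b).symm
  have hmem : ∀ z ∈ IntermediateField.adjoin E {θ}, z ∈ M := by
    intro z hz
    clear hb
    induction hz using IntermediateField.adjoin_induction with
    | mem w hw => rwa [Set.mem_singleton_iff.mp hw]
    | algebraMap e =>
      obtain ⟨n, d, -, rfl⟩ := IsFractionRing.div_surjective (A := B) e
      rw [map_div₀, ← IsScalarTower.algebraMap_apply, ← IsScalarTower.algebraMap_apply]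
      exact div_mem (hBM _) (hBM _)
    | add a b _ _ ha hb => exact add_mem ha hb
    | mul a b _ _ ha hb => exact mul_mem ha hb
    | inv a _ ha => exact inv_mem ha
  have hirr := irreducible_minpoly_map_adjoin_root hℓ hθ.tower_top (hy.trans hb.symm)
    fun z hz h => hno z (hmem z hz) (h.trans hb)
  rw [hE] at hirr
  let E' := IntermediateField.adjoin E {y}
  let u' : B →+* E' := u.codRestrict E' (hu E'.toSubfield
    (fun p => by
      rw [IsScalarTower.algebraMap_apply B E Ω]
      exact E'.algebraMap_mem _)
    (IntermediateField.mem_adjoin_simple_self E y))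
  have hu' : u'.comp s = (algebraMap E E').comp (algebraMap B E) := by
    ext p
    have : (u'.comp s p : Ω) = algebraMap B Ω p := RingHom.congr_fun hus p
    rw [this]
    exact IsScalarTower.algebraMap_apply B E Ω p
  refine Monic.irreducible_of_irreducible_map u' _ ((minpoly.monic hθ).map _) ?_
  rwa [Polynomial.map_map, hu', ← Polynomial.map_map]

theorem exists_geometric_factor {k K Λ Ω : Type*} {σ : Type*} [Field k] [Field K] [Field Λ]
    [Field Ω] [Algebra k K] [Algebra k Λ] [Algebra K Ω] [Algebra Λ Ω] [IsAlgClosed Ω]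
    (hkΩ : (algebraMap K Ω).comp (algebraMap k K) = (algebraMap Λ Ω).comp (algebraMap k Λ))
    [DecidableEq σ] {ℓ : ℕ} (hℓ : ℓ.Prime) (x : σ → K)
    (hxΩ : AlgebraicIndependent Λ fun j => algebraMap K Ω (x j)) (i : σ)
    (hno : ∀ z ∈ IntermediateField.adjoin K (Set.range (algebraMap Λ Ω)),
      z ^ ℓ ≠ algebraMap K Ω (x i)) (t : K) (tΛ : Λ) (ht : algebraMap K Ω t = algebraMap Λ Ω tΛ)
    (f : (MvPolynomial σ k)[X][X]) (hf : f.Monic) (θ : K)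
    (hθ : eval₂ (eval₂RingHom (MvPolynomial.aeval x : MvPolynomial σ k →ₐ[k] K).toRingHom t)
      θ f = 0) :
    ∃ G : (MvPolynomial σ Λ)[X], G.Monic ∧
      G ∣ f.map (eval₂RingHom (MvPolynomial.map (algebraMap k Λ)) (MvPolynomial.C tΛ)) ∧
      Irreducible (G.map (powVar Λ ℓ i).toRingHom) := by
  let B := MvPolynomial σ Λ
  let xΩ : σ → Ω := fun j => algebraMap K Ω (x j)
  let _ : Algebra B Ω := (MvPolynomial.aeval xΩ : MvPolynomial σ Λ →ₐ[Λ] Ω).toRingHom.toAlgebra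
  have hinj : Function.Injective (algebraMap B Ω) := hxΩ
  have hX : ∀ j, algebraMap B Ω (MvPolynomial.X j) = xΩ j := fun j => MvPolynomial.aeval_X _ _
  have hC : ∀ r, algebraMap B Ω (MvPolynomial.C r) = algebraMap Λ Ω r :=
      fun r => MvPolynomial.aeval_C _ _
  have : FaithfulSMul B Ω := (faithfulSMul_iff_algebraMap_injective B Ω).mpr hinj
  let θΩ : Ω := algebraMap K Ω θ
  set fΛ := f.map (eval₂RingHom (MvPolynomial.map (algebraMap k Λ))
    (MvPolynomial.C tΛ)) with hfΛ
  have hroot : aeval θΩ fΛ = 0 := by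
    have h1 := congrArg (algebraMap K Ω) hθ
    rw [hom_eval₂, map_zero] at h1
    rw [aeval_def, hfΛ, eval₂_map]
    convert h1 using 2
    refine ringHom_ext' (MvPolynomial.ringHom_ext (fun r => ?_) fun j => ?_) ?_
    · simpa using (hC _).trans (RingHom.congr_fun hkΩ r).symm
    · simpa using hX j
    · simpa [ht] using hC tΛ
  have h_int : IsIntegral B θΩ := ⟨fΛ, hf.map _, hroot⟩
  obtain ⟨y, hy⟩ := IsAlgClosed.exists_pow_nat_eq (xΩ i) hℓ.pos
  let u : B →+* Ω := (MvPolynomial.aeval fun j => if j = i then y else xΩ j :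
    MvPolynomial σ Λ →ₐ[Λ] Ω).toRingHom
  have huX : ∀ j, u (MvPolynomial.X j) = if j = i then y else xΩ j :=
    fun j => MvPolynomial.aeval_X _ _
  have huC : ∀ r, u (MvPolynomial.C r) = algebraMap Λ Ω r := fun r => MvPolynomial.aeval_C _ _
  clear_value u
  refine ⟨minpoly B θΩ, minpoly.monic h_int, minpoly.isIntegrallyClosed_dvd h_int hroot,
    irreducible_minpoly_map_of_comp_eq hℓ h_int (hy.trans (hX i).symm)
    (IntermediateField.adjoin K (Set.range (algebraMap Λ Ω))).toSubfield (fun p => ?_)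
    (IntermediateField.algebraMap_mem _ _) (fun z hz hzℓ => ?_) _ u ?_ fun M' hB hy' p => ?_⟩
  · induction p using MvPolynomial.induction_on with
    | C a =>
      rw [hC]
      exact IntermediateField.subset_adjoin K _ ⟨a, rfl⟩
    | add p q hp hq => rw [map_add]; exact add_mem hp hq
    | mul_X p j hp =>
      rw [map_mul, hX]
      exact mul_mem hp (IntermediateField.algebraMap_mem _ _)
  · exact hno z hz (hzℓ.trans (hX i))
  · refine MvPolynomial.ringHom_ext (fun r => ?_) fun j => ?_
    · simp [huC, hC]
    · by_cases h : j = i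
      · simp [powVar, huX, hX, h, hy]
      · simp [powVar, huX, hX, h]
  · induction p using MvPolynomial.induction_on with
    | C a =>
      rw [huC, ← hC]
      exact hB _
    | add p q hp hq => rw [map_add]; exact add_mem hp hq
    | mul_X p j hp =>
      rw [map_mul, huX]
      refine mul_mem hp ?_
      split_ifs
      · exact hy'
      · rw [← hX]
        exact hB _

end GeometricFactor

section LaurentPlace
open Polynomial

lemma isFractionRing_ratFunc (B F : Type*) [CommRing B] [IsDomain B] [Field F] [Algebra B F]
    [IsFractionRing B F] [Algebra B[X] (RatFunc F)]
    (h : ∀ p : B[X], algebraMap B[X] (RatFunc F) p = algebraMap F[X] _ (p.map (algebraMap B F))) :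
    IsFractionRing B[X] (RatFunc F) := by
  have hinj : Function.Injective (algebraMap B[X] (RatFunc F)) := by
    intro p q hpq
    rw [h, h] at hpq
    exact map_injective _ (IsFractionRing.injective B F)
      (IsFractionRing.injective F[X] (RatFunc F) hpq)
  have : FaithfulSMul B[X] (RatFunc F) := (faithfulSMul_iff_algebraMap_injective _ _).mpr hinj
  have h_int : ∀ p : F[X], ∃ (b : B) (q : B[X]), b ≠ 0 ∧
      q.map (algebraMap B F) = C (algebraMap B F b) * p := by
    intro p
    obtain ⟨b, hb₀, hb⟩ := IsLocalization.integerNormalization_spec (nonZeroDivisors B) (S := F) p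
    refine ⟨b, _, nonZeroDivisors.ne_zero hb₀, hb.trans ?_⟩
    rw [Algebra.smul_def]
    rfl
  refine IsFractionRing.of_field _ _ fun z => ?_
  obtain ⟨n, d, hd, rfl⟩ := IsFractionRing.div_surjective (A := F[X]) z
  obtain ⟨b₁, q₁, hb₁, h₁⟩ := h_int n
  obtain ⟨b₂, q₂, hb₂, h₂⟩ := h_int d
  have hC : ∀ b : B, b ≠ 0 → algebraMap F[X] (RatFunc F) (C (algebraMap B F b)) ≠ 0 := by
    intro b hb
    simpa using hb
  refine ⟨C b₂ * q₁, C b₁ * q₂, ?_⟩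
  rw [h, h, Polynomial.map_mul, Polynomial.map_mul, h₁, h₂, map_C, map_C, map_mul, map_mul, map_mul,
    map_mul]
  have hd' : algebraMap F[X] (RatFunc F) d ≠ 0 := by simpa using nonZeroDivisors.ne_zero hd
  have := hC b₁ hb₁
  have := hC b₂ hb₂
  field_simp

theorem exists_laurent_place_of_root (B : Type*) {F K : Type*} [CommRing B] [IsDomain B]
    [UniqueFactorizationMonoid B] [Field F] [Algebra B F] [IsFractionRing B F] [Field K]
    [Algebra (RatFunc F) K] [FiniteDimensional (RatFunc F) K] (p : ℕ) [ExpChar F p] :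
    ∃ (n : ℕ) (f : B[X][X]) (θ : K) (r : F[X]), f.Monic ∧ r ≠ 0 ∧
      eval₂ ((algebraMap (RatFunc F) K).comp
        ((algebraMap F[X] (RatFunc F)).comp (mapRingHom (algebraMap B F)))) θ f = 0 ∧
      ∀ c : B, r.eval (algebraMap B F c) ≠ 0 → ∀ (κ : Type w) [Field κ] (j : F →+* κ) (θb : κ),
        eval₂ (j.comp (algebraMap B F)) θb (f.map (evalRingHom c)) = 0 →
        ∃ ι : K →+* LaurentSeries κ, ∀ z : RatFunc F,
          ι (algebraMap _ _ z) = ratExpandAt j (j (algebraMap B F c)) z ^ p ^ n := by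
  have : ExpChar (RatFunc F) p :=
    expChar_of_injective_algebraMap (algebraMap F (RatFunc F)).injective p
  obtain ⟨n, ψ, hψ⟩ := exists_frobenius_to_separableClosure (RatFunc F) K p
  let N := separableClosure (RatFunc F) K
  let _ : Algebra B[X] (RatFunc F) :=
    ((algebraMap F[X] (RatFunc F)).comp (mapRingHom (algebraMap B F))).toAlgebra
  have hfr : IsFractionRing B[X] (RatFunc F) := isFractionRing_ratFunc B F fun _ => rfl
  let _ : Algebra B[X] N := ((algebraMap (RatFunc F) N).comp (algebraMap B[X] (RatFunc
      F))).toAlgebra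
  have : IsScalarTower B[X] (RatFunc F) N := IsScalarTower.of_algebraMap_eq fun _ => rfl
  have : FaithfulSMul B[X] N := (faithfulSMul_iff_algebraMap_injective _ _).mpr
    ((algebraMap (RatFunc F) N).injective.comp (IsFractionRing.injective B[X] (RatFunc F)))
  obtain ⟨θ, hθ, h_int⟩ := exists_integral_primitive B[X] (E := RatFunc F) (N := N)
  have hmin := minpoly.isIntegrallyClosed_eq_field_fractions' (RatFunc F) h_int
  have hm := minpoly.monic h_int
  obtain ⟨r, hr, H⟩ := exists_laurent_embedding.{_, _, w} θ hθ (Algebra.IsIntegral.isIntegral θ)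
    ((minpoly B[X] θ).map (mapRingHom (algebraMap B F))) (hm.map _)
    (by rw [hmin, Polynomial.map_map]; rfl) (Algebra.IsSeparable.isSeparable _ θ)
  refine ⟨n, minpoly B[X] θ, θ, r, hm, hr, ?_, fun c hc κ _ j θb hroot => ?_⟩
  · have h1 := congrArg (algebraMap N K) (minpoly.aeval B[X] θ)
    rw [aeval_def, hom_eval₂, map_zero] at h1
    exact h1
  · obtain ⟨ι, hι⟩ := H _ hc κ j θb (by
      rw [← hroot, Polynomial.map_map, ← eval₂_map, Polynomial.map_map]
      have e : (evalRingHom (algebraMap B F c)).comp (mapRingHom (algebraMap B F)) =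
          (algebraMap B F).comp (evalRingHom c) := by
        ext <;> simp
      rw [e])
    refine ⟨ι.comp ψ, fun z => ?_⟩
    have h1 : ψ (algebraMap (RatFunc F) K z) = algebraMap (RatFunc F) N (z ^ p ^ n) := by
      apply Subtype.ext
      rw [hψ, map_pow]
      rfl
    rw [RingHom.comp_apply, h1, hι, map_pow]

end LaurentPlace

section NonzeroSymbol
open Polynomial IntermediateField

/-- A tame symbol computation: if `ι t` is a uniformizer to the power `m`, and `ι b` is a constant
which is a prime-to-`ℓ` power of a non-`ℓ`-th power, then `{t, b} ≠ 0`. -/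
lemma sym_ne_zero_of_hom {K κ : Type*} [Field K] [Field κ] {ℓ : ℕ} (hneg : ∃ z : κ, z ^ ℓ = -1)
    (ι : K →+* LaurentSeries κ) {t b : K} {m e : ℕ} {v : κ} (hm : m.Coprime ℓ) (he : e.Coprime ℓ)
    (ht : ι t = HahnSeries.single 1 1 ^ m) (hb : ι b = HahnSeries.C (v ^ e)) (hv0 : v ≠ 0)
    (hv : ∀ w : κ, w ^ ℓ ≠ v) : sym ℓ t b ≠ 0 := by
  intro h0
  obtain ⟨s, hs⟩ := exists_tame_of_hom hneg ι
  have ht0 : t ≠ 0 := by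
    rintro rfl
    rw [map_zero] at ht
    exact pow_ne_zero m (HahnSeries.single_ne_zero one_ne_zero) ht.symm
  have hb0 : b ≠ 0 := by
    rintro rfl
    rw [map_zero] at hb
    exact pow_ne_zero e hv0 (HahnSeries.C_injective (hb.symm.trans (map_zero _).symm))
  let v' : κˣ := Units.mk0 v hv0
  have h1 := hs t b ht0 hb0 1 (v' ^ e)
    (by rw [ht, HahnSeries.single_pow, HahnSeries.leadingCoeff_of_single]; simp)
    (by
      rw [hb, HahnSeries.C_apply, HahnSeries.leadingCoeff_of_single]
      simp [v'])
  rw [h0, map_zero, hb, HahnSeries.order_C, ht, order_single_one_pow, zpow_zero, one_mul] at h1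
  have h2 := (K1proj_eq_one_iff (K := κ)).mp (Additive.ofMul.injective h1.symm)
  obtain ⟨z, hz⟩ := h2
  have h3 : v' ^ (e * m) = z⁻¹ ^ ℓ := by
    rw [inv_pow, ← hz, zpow_neg, inv_inv, zpow_natCast, pow_mul]
  obtain ⟨w, hw⟩ := exists_pow_of_pow_coprime (Nat.Coprime.mul_left he hm) h3
  exact hv w (by rw [← Units.val_pow_eq_pow_val, ← hw]; rfl)

theorem exists_sym_sub_ne_zero {k : Type u} {K σ : Type v} {Λ Ω : Type*} [Field k] [Field K]
    [Field Λ] [Field Ω] [Algebra k K] [Algebra k Λ] [Algebra K Ω] [Algebra Λ Ω] [IsAlgClosed k]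
    [IsAlgClosed Λ] [IsAlgClosed Ω]
    (hkΩ : (algebraMap K Ω).comp (algebraMap k K) = (algebraMap Λ Ω).comp (algebraMap k Λ))
    [Finite σ] [DecidableEq σ] {ℓ : ℕ} [Fact ℓ.Prime] (hk : (ℓ : k) ≠ 0) (hK : IsFunctionField k K)
    (x : σ → K) (hx : AlgebraicIndependent k x)
    (hxΩ : AlgebraicIndependent Λ fun j => algebraMap K Ω (x j)) (i : σ)
    (hno : ∀ z ∈ adjoin K (Set.range (algebraMap Λ Ω)), z ^ ℓ ≠ algebraMap K Ω (x i))
    (t : K) (tΛ : Λ) (ht : algebraMap K Ω t = algebraMap Λ Ω tΛ)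
    (htr : Transcendental (adjoin k (Set.range x)) t)
    (halg : ∀ z : K, IsAlgebraic (adjoin k (insert t (Set.range x))) z) :
    ∃ c : k, sym ℓ (t - algebraMap k K c) (x i) ≠ 0 := by
  have hℓ : ℓ.Prime := Fact.out
  let B := MvPolynomial σ k
  let F := FractionRing B
  let _ : Algebra B K := (MvPolynomial.aeval x : MvPolynomial σ k →ₐ[k] K).toRingHom.toAlgebra
  have hBX : ∀ i, algebraMap B K (MvPolynomial.X i) = x i := fun i => MvPolynomial.aeval_X _ _
  have hBC : ∀ r, algebraMap B K (MvPolynomial.C r) = algebraMap k K r :=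
    fun r => MvPolynomial.aeval_C _ _
  have : FaithfulSMul B K := (faithfulSMul_iff_algebraMap_injective B K).mpr hx
  let _ : Algebra F K := FractionRing.liftAlgebra B K
  have hFB : ∀ b, algebraMap F K (algebraMap B F b) = algebraMap B K b :=
    fun b => (IsScalarTower.algebraMap_apply B F K b).symm
  have : IsScalarTower k F K := IsScalarTower.of_algebraMap_eq fun r => by
    rw [IsScalarTower.algebraMap_apply k B F, hFB]
    exact (hBC r).symm
  have hFt : Transcendental F t := by
    intro h
    refine htr (h.of_range_subset ?_)
    rintro _ ⟨z, rfl⟩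
    have hB : ∀ p : B, algebraMap B K p ∈ adjoin k (Set.range x) := by
      intro p
      induction p using MvPolynomial.induction_on with
      | C a => rw [hBC]; exact IntermediateField.algebraMap_mem _ _
      | add p q hp hq => rw [map_add]; exact add_mem hp hq
      | mul_X p j hp =>
        rw [map_mul, hBX]
        exact mul_mem hp (subset_adjoin k _ ⟨j, rfl⟩)
    obtain ⟨n, d, -, rfl⟩ := IsFractionRing.div_surjective (A := B) z
    rw [map_div₀, hFB, hFB]
    exact ⟨⟨_, div_mem (hB n) (hB d)⟩, rfl⟩
  let _ := (ratFuncEval t hFt).toRingHom.toAlgebra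
  have hRF : ∀ z, algebraMap (RatFunc F) K (algebraMap F (RatFunc F) z) = algebraMap F K z :=
    fun z => (ratFuncEval t hFt).commutes z
  have hRX : algebraMap (RatFunc F) K RatFunc.X = t := ratFuncEval_X t hFt
  have : IsScalarTower k (RatFunc F) K := IsScalarTower.of_algebraMap_eq fun r => by
    rw [IsScalarTower.algebraMap_apply k F (RatFunc F), hRF, ← IsScalarTower.algebraMap_apply]
  have hle : adjoin k (insert t (Set.range x)) ≤
      (IsScalarTower.toAlgHom k (RatFunc F) K).fieldRange := by
    rw [adjoin_le_iff]
    rintro _ (rfl | ⟨j, rfl⟩)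
    · exact ⟨_, hRX⟩
    · exact ⟨_, (hRF _).trans ((hFB _).trans (hBX j))⟩
  have : Algebra.IsAlgebraic (RatFunc F) K := ⟨fun z => (halg z).of_range_subset (by
    rintro _ ⟨y, rfl⟩
    exact hle y.2)⟩
  have : FiniteDimensional (RatFunc F) K := finiteDimensional_of_isFunctionField hK.of_tower
  have : ExpChar F (ringExpChar k) := expChar_of_injective_algebraMap (algebraMap k F).injective _
  obtain ⟨n, f, θ, r, hf, hr, hroot, H⟩ :=
    exists_laurent_place_of_root.{max u v} B (F := F) (K := K) (ringExpChar k)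
  have hRB : ∀ b : B, algebraMap (RatFunc F) K (algebraMap F[X] _ (C (algebraMap B F b))) =
      algebraMap B K b := fun b => (hRF _).trans (hFB b)
  obtain ⟨G, hG, hGf, hGirr⟩ := exists_geometric_factor hkΩ hℓ x hxΩ i hno t tΛ ht f hf θ (by
    rw [← hroot]
    congr 1
    refine ringHom_ext' (RingHom.ext fun b => ?_) ?_
    · have h1 : MvPolynomial.aeval x b = _ := (hRB b).symm
      simpa using h1
    · simpa using hRX.symm)
  have hcF : ∀ c, algebraMap B F (MvPolynomial.C c) = algebraMap k F c :=
    fun c => (IsScalarTower.algebraMap_apply k B F c).symm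
  have hbad : {c : k | r.IsRoot (algebraMap k F c)}.Finite :=
    (Polynomial.finite_setOfPred_isRoot hr).preimage (algebraMap k F).injective.injOn
  obtain ⟨c, hc, g, hg, ⟨h, hgf⟩, hgirr⟩ := exists_irreducible_specialization ℓ i tΛ hbad.toFinset
    (fun c _ hc => htr (by
      have h1 : algebraMap K Ω (algebraMap k K c) = algebraMap K Ω t := by
        rw [ht, ← hc]
        exact RingHom.congr_fun hkΩ c
      rw [← (algebraMap K Ω).injective h1]
      exact isAlgebraic_algebraMap (⟨_, IntermediateField.algebraMap_mem _ c⟩ :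
        adjoin k (Set.range x)))) f G hG hGf hGirr
  obtain ⟨κ, _, j, θb, hθb, hw⟩ := exists_field_root_forall_pow_ne hℓ hk i g hg hgirr
  obtain ⟨ι, hι⟩ := H (MvPolynomial.C c) (by
    rw [hcF]
    exact fun h => hc (hbad.mem_toFinset.mpr h)) κ j θb (by rw [hgf, eval₂_mul, hθb, zero_mul])
  have hcop := coprime_expChar_pow hk (ringExpChar k) n
  obtain ⟨z, hz⟩ := IsAlgClosed.exists_pow_nat_eq (-1 : k) hℓ.pos
  refine ⟨c, sym_ne_zero_of_hom (v := j (algebraMap B F (MvPolynomial.X i)))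
    ⟨j (algebraMap k F z), by rw [← map_pow, ← map_pow, hz]; simp⟩ ι hcop hcop ?_ ?_ ?_ hw⟩
  · have h1 : t - algebraMap k K c = algebraMap (RatFunc F) K
        (algebraMap F[X] _ (X - C (algebraMap B F (MvPolynomial.C c)))) := by
      rw [_root_.map_sub, _root_.map_sub, hRB, hBC, RatFunc.algebraMap_X, hRX]
    rw [h1, hι, ratExpandAt_algebraMap]
    congr 1
    simp
  · rw [← hBX, ← hRB, hι, ratExpandAt_algebraMap]
    simp [← _root_.map_pow]
  · rw [_root_.map_ne_zero, ne_eq, IsFractionRing.to_map_eq_zero_iff]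
    exact MvPolynomial.X_ne_zero i

end NonzeroSymbol

section RelativeClosure
open IntermediateField

variable {k : Type u} {K : Type v} [Field k] [Field K] [Algebra k K]

/-- The relative algebraic closure of `E` in `K`. -/
def racl (E : IntermediateField k K) : IntermediateField k K :=
  (algebraicClosure E K).restrictScalars k

lemma mem_racl {E : IntermediateField k K} {z : K} : z ∈ racl E ↔ IsAlgebraic E z :=
  mem_algebraicClosure_iff

lemma le_racl (E : IntermediateField k K) : E ≤ racl E :=
  fun z hz => mem_racl.mpr (isAlgebraic_algebraMap (⟨z, hz⟩ : E))

lemma IsAlgebraic.mono_intermediateField {E F : IntermediateField k K} (h : E ≤ F) {z : K}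
    (hz : IsAlgebraic E z) : IsAlgebraic F z :=
  hz.of_range_subset (by
    rintro _ ⟨y, rfl⟩
    exact ⟨⟨y, h y.2⟩, rfl⟩)

lemma IsAlgebraic.trans_le_racl {E F : IntermediateField k K} (h : F ≤ racl E) {z : K}
    (hz : IsAlgebraic F z) : IsAlgebraic E z := by
  have h1 : IsAlgebraic (algebraicClosure E K) z := hz.of_range_subset (by
    rintro _ ⟨y, rfl⟩
    exact ⟨⟨y, h y.2⟩, rfl⟩)
  exact h1.restrictScalars E

lemma relAlgClosed_racl (E : IntermediateField k K) : RelAlgClosed (racl E) :=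
  fun _ hz => mem_racl.mpr (hz.trans_le_racl le_rfl)

lemma RelAlgClosed.racl_le {E F : IntermediateField k K} (hF : RelAlgClosed F) (h : E ≤ F) :
    racl E ≤ F :=
  fun z hz => hF z ((mem_racl.mp hz).mono_intermediateField h)

lemma racl_mono {E F : IntermediateField k K} (h : E ≤ F) : racl E ≤ racl F :=
  (relAlgClosed_racl F).racl_le (h.trans (le_racl F))

lemma RelAlgClosed.racl_eq {E : IntermediateField k K} (hE : RelAlgClosed E) : racl E = E :=
  le_antisymm (hE.racl_le le_rfl) (le_racl E)

lemma hasTrdeg_iff {F : Type*} [Field F] [Algebra k F] {d : ℕ} :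
    HasTrdeg k F d ↔ Algebra.trdeg k F = d := by
  constructor
  · rintro ⟨x, hx⟩
    have := hx.lift_cardinalMk_eq_trdeg
    simpa using this.symm
  · intro h
    obtain ⟨ι, x, hx⟩ := exists_isTranscendenceBasis' k F
    have h1 := hx.lift_cardinalMk_eq_trdeg
    rw [h] at h1
    have h2 : Cardinal.mk ι = d := by simpa using h1
    obtain ⟨e⟩ := Cardinal.mk_eq_nat_iff.mp h2
    exact ⟨x ∘ e.symm, (isTranscendenceBasis_equiv e.symm).mpr hx⟩

lemma trdeg_add_trdeg_field (k : Type*) (E F : Type v) [Field k] [Field E] [Field F] [Algebra k E]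
    [Algebra E F] [Algebra k F] [IsScalarTower k E F] :
    Algebra.trdeg k E + Algebra.trdeg E F = Algebra.trdeg k F :=
  trdeg_add_eq k E

lemma trdeg_eq_one_of_isAlgebraic {E F : Type*} [Field E] [Field F] [Algebra E F] {t : F}
    (ht : Transcendental E t) (h : ∀ z : F, IsAlgebraic (adjoin E {t}) z) :
    Algebra.trdeg E F = 1 := by
  have h1 : AlgebraicIndependent E fun _ : Unit => t := by
    rw [algebraicIndependent_unique_type_iff]
    exact ht
  have h2 : IsTranscendenceBasis E fun _ : Unit => t := by
    rw [h1.isTranscendenceBasis_iff_isAlgebraic, Set.range_const]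
    exact ⟨fun z => isAlgebraic_adjoin_iff.mp (h z)⟩
  have := h2.lift_cardinalMk_eq_trdeg
  simpa using this.symm

lemma trdeg_add_of_le {E F : IntermediateField k K} (h : E ≤ F) :
    ∃ c : Cardinal.{v}, Algebra.trdeg k E + c = Algebra.trdeg k F ∧ (c = 0 → F ≤ racl E) ∧
      ∀ t ∈ F, Transcendental E t → F ≤ racl (adjoin k (insert t E)) → c = 1 := by
  let _ : Algebra E F := (inclusion h).toRingHom.toAlgebra
  have : IsScalarTower k E F := IsScalarTower.of_algebraMap_eq fun _ => rfl
  have : IsScalarTower E F K := IsScalarTower.of_algebraMap_eq fun _ => rfl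
  refine ⟨Algebra.trdeg E F, trdeg_add_trdeg_field k E F, fun h0 z hz => ?_,
    fun t ht htr hle => ?_⟩
  · have := _root_.trdeg_eq_zero_iff.mp h0
    have h1 : IsAlgebraic E (⟨z, hz⟩ : F) := Algebra.IsAlgebraic.isAlgebraic _
    exact mem_racl.mpr (h1.algebraMap (A := K))
  · refine trdeg_eq_one_of_isAlgebraic (t := (⟨t, ht⟩ : F))
      (fun h => htr (h.algebraMap (A := K))) fun z => ?_
    let A := adjoin E {(⟨t, ht⟩ : F)}
    have hA : adjoin k (insert t (E : Set K)) ≤ (A.restrictScalars k).map F.val := by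
      rw [adjoin_le_iff]
      rintro y (rfl | hy)
      · exact ⟨⟨y, ht⟩, subset_adjoin E _ rfl, rfl⟩
      · exact ⟨⟨y, h hy⟩, A.algebraMap_mem ⟨y, hy⟩, rfl⟩
    have h2 : IsAlgebraic A (algebraMap F K z) :=
      (mem_racl.mp (hle z.2)).of_range_subset (by
        rintro _ ⟨y, rfl⟩
        obtain ⟨w, hw, hwy⟩ := hA y.2
        exact ⟨⟨w, hw⟩, hwy⟩)
    exact (isAlgebraic_algebraMap_iff (algebraMap F K).injective).mp h2

lemma HasTrdeg.mono {E F : IntermediateField k K} (h : E ≤ F) {d e : ℕ} (hE : HasTrdeg k E d)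
    (hF : HasTrdeg k F e) : d ≤ e ∧ (d = e → F ≤ racl E) := by
  obtain ⟨c, h1, h2, -⟩ := trdeg_add_of_le h
  rw [hasTrdeg_iff.mp hE, hasTrdeg_iff.mp hF] at h1
  have h3 : c < Cardinal.aleph0 := by
    refine lt_of_le_of_lt (b := (e : Cardinal)) ?_ Cardinal.natCast_lt_aleph0
    rw [← h1]
    exact le_add_self
  obtain ⟨n, rfl⟩ := Cardinal.lt_aleph0.mp h3
  have h4 : d + n = e := by exact_mod_cast h1
  refine ⟨by omega, fun h5 => h2 ?_⟩
  have : n = 0 := by omega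
  simp [this]

lemma HasTrdeg.racl_insert {E : IntermediateField k K} {d : ℕ} (hE : HasTrdeg k E d) {t : K}
    (ht : Transcendental E t) : HasTrdeg k (racl (adjoin k (insert t (E : Set K)))) (d + 1) := by
  have hle : E ≤ racl (adjoin k (insert t (E : Set K))) :=
    le_trans (fun z hz => subset_adjoin k _ (Or.inr hz)) (le_racl _)
  obtain ⟨c, h1, -, h2⟩ := trdeg_add_of_le hle
  have h3 := h2 t (le_racl _ (subset_adjoin k _ (Or.inl rfl))) ht le_rfl
  rw [hasTrdeg_iff, ← h1, hasTrdeg_iff.mp hE, h3]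
  simp

lemma hasTrdeg_bot : HasTrdeg k (⊥ : IntermediateField k K) 0 := by
  rw [hasTrdeg_iff, Nat.cast_zero, _root_.trdeg_eq_zero_iff]
  infer_instance

lemma TrdegGe.exists_notMem {E : IntermediateField k K} {d e : ℕ} (hE : HasTrdeg k E d)
    (hK : TrdegGe k K e) (hde : d < e) : ∃ t, t ∉ E := by
  by_contra! h
  obtain ⟨x, hx⟩ := hK
  have h1 : AlgebraicIndependent k fun i => (⟨x i, h _⟩ : E) :=
    AlgebraicIndependent.of_comp E.val hx
  have h2 := h1.lift_cardinalMk_le_trdeg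
  rw [hasTrdeg_iff.mp hE] at h2
  have h3 : e ≤ d := by simpa using h2
  omega

end RelativeClosure

section Maximality
open IntermediateField

variable {k : Type u} {K : Type v} [Field k] [Field K] [Algebra k K] {ℓ : ℕ}

lemma exists_finite_transcendenceBasis_mem (hK : IsFunctionField k K) {L : IntermediateField k K}
    {b : K} (hb : Transcendental L b) :
    ∃ u : Set K, u.Finite ∧ b ∈ u ∧ IsTranscendenceBasis L (Subtype.val : u → K) := by
  obtain ⟨s, hs⟩ := hK
  have h1 : AlgebraicIndepOn L _root_.id ({b} : Set K) := by
    have : Unique (({b} : Set K)) := Set.uniqueSingleton b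
    refine algebraicIndependent_unique_type_iff.mpr ?_
    rw [(default : ({b} : Set K)).2]
    exact hb
  have h2 : adjoin L ({b} ∪ (s : Set K)) = ⊤ := by
    apply restrictScalars_injective k
    rw [restrictScalars_top, eq_top_iff, ← hs, adjoin_le_iff]
    exact fun z hz => subset_adjoin L _ (Or.inr hz)
  have h3 : Algebra.IsAlgebraic (Algebra.adjoin L ({b} ∪ (s : Set K))) K := by
    rw [← isAlgebraic_adjoin_iff_top, h2]
    exact ⟨fun z => isAlgebraic_algebraMap (⟨z, mem_top⟩ : (⊤ : IntermediateField L K))⟩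
  obtain ⟨u, hu1, hu2, hu3⟩ := exists_isTranscendenceBasis_between {b} ({b} ∪ (s : Set K))
    Set.subset_union_left h1
  exact ⟨u, ((Set.finite_singleton b).union s.finite_toSet).subset hu2, hu1 rfl, hu3⟩

lemma transcendental_adjoin_range_of_mem {σ : Type*} {L : IntermediateField k K} {x : σ → K}
    (hx : AlgebraicIndependent L x) {t : K} (ht : t ∈ L) (htt : Transcendental k t) :
    Transcendental (adjoin k (Set.range x)) t := by
  have h1 : AlgebraicIndependent k fun _ : Unit => t :=
    algebraicIndependent_unique_type_iff.mpr htt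
  have h2 := h1.sumElim_of_tower (S := L) (by rintro _ ⟨_, rfl⟩; exact ⟨⟨t, ht⟩, rfl⟩) hx
  have h3 : AlgebraicIndependent k (Sum.elim (fun _ : Unit => t) x) := by
    rw [← algebraicIndependent_equiv (Equiv.sumComm _ _)]
    convert h2 using 1
    ext (i | i) <;> rfl
  have h4 := (AlgebraicIndependent.sumElim_iff.mp h3).2
  rw [algebraicIndependent_unique_type_iff] at h4
  rw [transcendental_adjoin_iff]
  exact h4

/-- Elements of `K` outside `Lˣ K^ℓ` pair nontrivially with some element of `L`, when `L` is
relatively algebraically closed of transcendence degree one. -/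
theorem exists_sym_ne_zero [IsAlgClosed k] [Fact ℓ.Prime] (hk : (ℓ : k) ≠ 0)
    (hK : IsFunctionField k K) {L : IntermediateField k K} (hL : RelAlgClosed L) {t : K}
    (ht : t ∈ L) (htt : Transcendental k t) (hLt : ∀ z ∈ L, IsAlgebraic (adjoin k {t}) z) {b : K}
    (hb : ∀ l ∈ L, ∀ z, b ≠ l * z ^ ℓ) : ∃ a ∈ L, sym ℓ a b ≠ 0 := by
  classical
  have hbL : b ∉ L := fun h => hb b h 1 (by simp)
  have hb0 : b ≠ 0 := fun h => hbL (h ▸ L.zero_mem)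
  obtain ⟨u, hu, hbu, hx⟩ := exists_finite_transcendenceBasis_mem hK (fun h => hbL (hL b h))
  have := hu.to_subtype
  let Ω := AlgebraicClosure K
  let Λ := algebraicClosure L Ω
  have hΛ : IsAlgClosed Λ := (algebraicClosure.isAlgClosure L Ω).isAlgClosed
  have hxk : AlgebraicIndependent k (Subtype.val : u → K) :=
    hx.1.restrictScalars (algebraMap k L).injective
  have hxL : AlgebraicIndependent L fun j : u => algebraMap K Ω j :=
    hx.1.map' (f := IsScalarTower.toAlgHom L K Ω) (algebraMap K Ω).injective
  obtain ⟨c, hc⟩ := exists_sym_sub_ne_zero (Λ := Λ) (Ω := Ω) (k := k) (K := K) (σ := u) (ℓ := ℓ)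
    rfl hk hK Subtype.val hxk (hxL.extendScalars Λ) ⟨b, hbu⟩ (by
      intro z hz hzb
      obtain ⟨l, hl, w, hw⟩ := exists_eq_mul_pow_of_mem_adjoin hk hL hb0 hzb (by
        convert hz
        ext y
        simp [Λ])
      exact hb l hl w hw) t (algebraMap L Λ ⟨t, ht⟩) rfl
    (transcendental_adjoin_range_of_mem hx.1 ht htt) (by
      intro z
      let E := adjoin k (insert t (Set.range (Subtype.val : u → K)))
      have h1 : L ≤ racl E := fun w hw => mem_racl.mpr
        ((hLt w hw).mono_intermediateField (adjoin.mono _ _ _ (by simp)))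
      have h2 : IsAlgebraic (adjoin L (Set.range (Subtype.val : u → K))) z :=
        hx.isAlgebraic_field.isAlgebraic z
      have h3 : (adjoin L (Set.range (Subtype.val : u → K))).restrictScalars k ≤ racl E := by
        intro w hw
        have h4 : adjoin L (Set.range (Subtype.val : u → K)) ≤
            extendScalars h1 := by
          rw [adjoin_le_iff]
          exact fun y hy => le_racl E (subset_adjoin k _ (Or.inr hy))
        exact h4 hw
      exact IsAlgebraic.trans_le_racl h3 h2)
  exact ⟨_, L.sub_mem ht (L.algebraMap_mem c), hc⟩

end Maximality

section Interpolation
open Polynomial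

lemma exists_map_eq_of_infinite_eval_mem {F E : Type*} [Field F] [Field E] [Algebra F E] {p : E[X]}
    {S : Set F} (hS : S.Infinite)
    (h : ∀ a ∈ S, p.eval (algebraMap F E a) ∈ Set.range (algebraMap F E)) :
    ∃ r : F[X], r.map (algebraMap F E) = p := by
  classical
  obtain ⟨T, hT, hc⟩ := hS.exists_subset_card_eq (p.natDegree + 1)
  choose! v hv using h
  refine ⟨Lagrange.interpolate T _root_.id v, ?_⟩
  have hinj : Set.InjOn (_root_.id : F → F) T := Function.injective_id.injOn
  refine Polynomial.eq_of_degrees_lt_of_eval_finset_eq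
    (T.map ⟨algebraMap F E, (algebraMap F E).injective⟩) ?_ ?_ ?_
  · rw [Finset.card_map, Polynomial.degree_map]
    exact Lagrange.degree_interpolate_lt v hinj
  · rw [Finset.card_map, hc]
    exact lt_of_le_of_lt degree_le_natDegree (by exact_mod_cast Nat.lt_succ_self _)
  · intro x hx
    obtain ⟨a, ha, rfl⟩ := Finset.mem_map.mp hx
    have h1 := Lagrange.eval_interpolate_at_node v hinj ha
    simp only [_root_.id] at h1
    simp only [Function.Embedding.coeFn_mk]
    rw [eval_map_algebraMap, aeval_algebraMap_apply, coe_aeval_eq_eval, h1, hv a (hT ha)]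

lemma exists_map_eq_of_isRoot_map {F E : Type*} [Field F] [Field E] [Algebra F E] [Infinite F]
    (hF : ∀ e : E, IsAlgebraic F e → e ∈ Set.range (algebraMap F E)) {p : E[X]} {P : F[X][X]}
    (hP : P.Monic) (h : P.eval₂ (mapRingHom (algebraMap F E)) p = 0) :
    ∃ r : F[X], r.map (algebraMap F E) = p := by
  refine exists_map_eq_of_infinite_eval_mem (Set.infinite_univ (α := F)) fun a _ => hF _ ?_
  refine ⟨P.map (evalRingHom a), (hP.map _).ne_zero, ?_⟩
  have h1 := congrArg (evalRingHom (algebraMap F E a)) h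
  rw [hom_eval₂, _root_.map_zero] at h1
  rw [aeval_def, eval₂_map, ← h1]
  congr 1
  ext x <;> simp

lemma ratFuncEval_algebraMap {E K : Type*} [Field E] [Field K] [Algebra E K] (t : K)
    (ht : Transcendental E t) (p : E[X]) :
    ratFuncEval t ht (algebraMap E[X] (RatFunc E) p) = aeval t p := by
  have : (ratFuncEval t ht).comp (IsScalarTower.toAlgHom E E[X] (RatFunc E)) = aeval t := by
    ext
    simp [ratFuncEval_X]
  exact DFunLike.congr_fun this p

lemma mem_adjoin_of_isAlgebraic_adjoin {F E K : Type*} [Field F] [Field E] [Field K] [Algebra F E]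
    [Algebra E K] [Algebra F K] [IsScalarTower F E K] [Infinite F]
    (hF : ∀ e : E, IsAlgebraic F e → e ∈ Set.range (algebraMap F E)) {t e : K}
    (ht : Transcendental E t) (he : e ∈ IntermediateField.adjoin E {t})
    (halg : IsAlgebraic (IntermediateField.adjoin F {t}) e) :
    e ∈ IntermediateField.adjoin F {t} := by
  rw [IntermediateField.isAlgebraic_adjoin_iff] at halg
  obtain ⟨⟨y, hy⟩, hy0, q, hq, hqe⟩ := halg.exists_integral_multiple
  have hrange : ∀ z : Algebra.adjoin F {t}, ∃ r : F[X], aeval t r = (z : K) := fun z => by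
    obtain ⟨z, hz⟩ := z
    rw [Algebra.adjoin_singleton_eq_range_aeval] at hz
    exact hz
  obtain ⟨h, hh⟩ := hrange ⟨y, hy⟩
  simp only at hh
  let θ : F[X] →+* Algebra.adjoin F {t} :=
    ((aeval t : F[X] →ₐ[F] K).codRestrict _ fun r => by
      rw [Algebra.adjoin_singleton_eq_range_aeval]; exact ⟨r, rfl⟩).toRingHom
  have hθ : Function.Surjective θ := fun z => by
    obtain ⟨r, hr⟩ := hrange z
    exact ⟨r, Subtype.ext hr⟩
  obtain ⟨P, hP, -, hPm⟩ := lifts_and_natDegree_eq_and_monic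
    (mem_lifts_of_surjective hθ q) hq
  have hhe : aeval t (h.map (algebraMap F E)) = y := by rw [aeval_map_algebraMap, hh]
  have h0 : aeval t h ≠ 0 := by
    rw [hh]
    exact fun h => hy0 (Subtype.ext h)
  have hroot : P.eval₂ ((aeval t : E[X] →ₐ[E] K).toRingHom.comp (mapRingHom (algebraMap F E)))
      (y * e) = 0 := by
    rw [← hP, eval₂_map] at hqe
    refine Eq.trans ?_ hqe
    congr 1
    refine RingHom.ext fun r => ?_
    simp [θ, aeval_map_algebraMap]
  obtain ⟨w, hw⟩ := ratFuncEval_range t ht (y * e)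
    (mul_mem (by
      rw [← hhe]
      exact IntermediateField.algebra_adjoin_le_adjoin E _ (aeval_mem_adjoin_singleton E t)) he)
  have hψ := ratFuncEval_algebraMap t ht
  have h_int : IsIntegral E[X] w := by
    refine ⟨P.map (mapRingHom (algebraMap F E)), hPm.map _, ?_⟩
    apply (ratFuncEval t ht).injective
    rw [_root_.map_zero, ← hroot, eval₂_map, ← hw]
    refine (hom_eval₂ P _ (ratFuncEval t ht).toRingHom w).trans ?_
    congr 1
    exact RingHom.ext fun r => hψ _
  obtain ⟨p, hp⟩ := IsIntegrallyClosed.isIntegral_iff.mp h_int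
  rw [← hp, hψ] at hw
  obtain ⟨r, rfl⟩ := exists_map_eq_of_isRoot_map hF hPm (p := p) (by
    apply transcendental_iff_injective.mp ht
    rw [_root_.map_zero, ← hroot, ← hw]
    exact hom_eval₂ P _ (aeval t : E[X] →ₐ[E] K).toRingHom p)
  rw [aeval_map_algebraMap] at hw
  have h1 : e = aeval t r / aeval t h := by
    rw [eq_div_iff h0, hw, hh, mul_comm]
  rw [IntermediateField.mem_adjoin_simple_iff]
  exact ⟨r, h, h1⟩

lemma exists_coprime_of_mem_adjoin {F K : Type*} [Field F] [Field K] [Algebra F K] {t e : K}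
    (ht : Transcendental F t) (he : e ∈ IntermediateField.adjoin F {t}) :
    ∃ r s : F[X], IsCoprime r s ∧ s.Monic ∧ e = aeval t r / aeval t s := by
  obtain ⟨w, rfl⟩ := ratFuncEval_range t ht e he
  refine ⟨w.num, w.denom, w.isCoprime_num_denom, w.monic_denom, ?_⟩
  rw [← ratFuncEval_algebraMap t ht, ← ratFuncEval_algebraMap t ht, ← map_div₀, w.num_div_denom]

lemma aeval_mem_adjoin_of_coeff_mem {k K : Type*} [Field k] [Field K] [Algebra k K]
    {L : IntermediateField k K} {M : IntermediateField k K} {t : K} {r : M[X]}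
    (hr : ∀ n, (r.coeff n : K) ∈ L) : aeval t r ∈ IntermediateField.adjoin L {t} := by
  rw [aeval_eq_sum_range]
  refine sum_mem fun n _ => ?_
  rw [Algebra.smul_def]
  exact mul_mem ((IntermediateField.adjoin L {t}).algebraMap_mem ⟨_, hr n⟩)
    (pow_mem (IntermediateField.mem_adjoin_simple_self L t) n)

/-- Intersections of rational function fields over two subfields. -/
lemma mem_adjoin_inf {k K : Type*} [Field k] [Field K] [Algebra k K]
    {L₁ L₂ M : IntermediateField k K} (h₁ : L₁ ≤ M) (h₂ : L₂ ≤ M) {t e : K}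
    (ht : Transcendental M t) (he₁ : e ∈ IntermediateField.adjoin L₁ {t})
    (he₂ : e ∈ IntermediateField.adjoin L₂ {t}) :
    e ∈ IntermediateField.adjoin (L₁ ⊓ L₂ : IntermediateField k K) {t} := by
  have hmap : ∀ {L : IntermediateField k K} (h : L ≤ M) (r : L[X]),
      aeval t (r.map (IntermediateField.inclusion h).toRingHom) = aeval t r := fun h r => by
    rw [aeval_def, aeval_def, eval₂_map]
    rfl
  have ht₁ : Transcendental L₁ t := fun h => ht (h.mono_intermediateField h₁)
  have ht₂ : Transcendental L₂ t := fun h => ht (h.mono_intermediateField h₂)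
  obtain ⟨r₁, s₁, hc₁, hm₁, e₁⟩ := exists_coprime_of_mem_adjoin ht₁ he₁
  obtain ⟨r₂, s₂, hc₂, hm₂, e₂⟩ := exists_coprime_of_mem_adjoin ht₂ he₂
  have n₁ : aeval t s₁ ≠ 0 := fun h =>
    hm₁.ne_zero (transcendental_iff_injective.mp ht₁ (h.trans (_root_.map_zero _).symm))
  have n₂ : aeval t s₂ ≠ 0 := fun h =>
    hm₂.ne_zero (transcendental_iff_injective.mp ht₂ (h.trans (_root_.map_zero _).symm))
  let i₁ : L₁ →+* M := (IntermediateField.inclusion h₁).toRingHom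
  let i₂ : L₂ →+* M := (IntermediateField.inclusion h₂).toRingHom
  have heq : r₁.map i₁ * s₂.map i₂ = r₂.map i₂ * s₁.map i₁ := by
    apply transcendental_iff_injective.mp ht
    simp only [_root_.map_mul, i₁, i₂, hmap]
    rw [← div_eq_div_iff n₁ n₂, ← e₁, ← e₂]
  have hd₁ : s₁.map i₁ ∣ s₂.map i₂ :=
    ((isCoprime_map i₁).mpr hc₁).symm.dvd_of_dvd_mul_left (Dvd.intro_left _ heq.symm)
  have hd₂ : s₂.map i₂ ∣ s₁.map i₁ :=
    ((isCoprime_map i₂).mpr hc₂).symm.dvd_of_dvd_mul_left (Dvd.intro_left _ heq)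
  have hs : s₁.map i₁ = s₂.map i₂ :=
    eq_of_monic_of_associated (hm₁.map _) (hm₂.map _) (associated_of_dvd_dvd hd₁ hd₂)
  have hr : r₁.map i₁ = r₂.map i₂ := by
    rw [hs] at heq
    exact mul_right_cancel₀ (hm₂.map i₂).ne_zero heq
  have hcoeff : ∀ {p₁ : L₁[X]} {p₂ : L₂[X]}, p₁.map i₁ = p₂.map i₂ →
      ∀ n, (p₁.coeff n : K) ∈ L₁ ⊓ L₂ := fun {p₁ p₂} h n => by
    refine ⟨(p₁.coeff n).2, ?_⟩
    have h2 := congrArg (fun p => ((p.coeff n : M) : K)) h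
    simp only [coeff_map] at h2
    have h3 : (p₁.coeff n : K) = p₂.coeff n := h2
    rw [h3]
    exact (p₂.coeff n).2
  rw [e₁]
  exact div_mem (aeval_mem_adjoin_of_coeff_mem (hcoeff hr))
    (aeval_mem_adjoin_of_coeff_mem (hcoeff hs))

end Interpolation

section Reconstruction
open Polynomial IntermediateField

lemma isAlgebraic_coeff_minpoly (A B : Type*) {K : Type*} [Field A] [Field B] [Field K]
    [Algebra A B] [Algebra A K] [Algebra B K] [IsScalarTower A B K] {x : K} (hx : IsAlgebraic A x)
    (n : ℕ) : IsAlgebraic A ((minpoly B x).coeff n) := by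
  have h := hx.isIntegral
  exact (isIntegral_coeff_of_dvd (minpoly A x) (minpoly B x) (minpoly.monic h)
    (minpoly.monic h.tower_top) (minpoly.dvd_map_of_isScalarTower A B x) n).isAlgebraic

lemma isAlgebraic_coeff_minpoly_of_range_subset {A B K : Type*} [Field A] [Field B] [Field K]
    [Algebra A K] [Algebra B K] (h : Set.range (algebraMap A K) ⊆ Set.range (algebraMap B K))
    {x : K} (hx : IsAlgebraic A x) (n : ℕ) :
    IsAlgebraic A (algebraMap B K ((minpoly B x).coeff n)) := by
  let e : B ≃+* (algebraMap B K).range :=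
    RingEquiv.ofBijective (algebraMap B K).rangeRestrict
      ⟨fun a b hab => (algebraMap B K).injective (congrArg Subtype.val hab),
        (algebraMap B K).rangeRestrict_surjective⟩
  let f : A →+* B := e.symm.toRingHom.comp
    ((algebraMap A K).codRestrict (algebraMap B K).range fun a => h ⟨a, rfl⟩)
  have hf : ∀ a, algebraMap B K (f a) = algebraMap A K a := fun a =>
    congrArg Subtype.val (e.apply_symm_apply
      ((algebraMap A K).codRestrict (algebraMap B K).range (fun a => h ⟨a, rfl⟩) a))
  let _ : Algebra A B := f.toAlgebra
  have : IsScalarTower A B K := IsScalarTower.of_algebraMap_eq fun a => (hf a).symm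
  exact (isAlgebraic_coeff_minpoly A B hx n).algebraMap

lemma isAlgebraic_of_coeff_minpoly_mem {A B K : Type*} [Field A] [Field B] [Field K]
    [Algebra A K] [Algebra B K] {x : K} (hx : IsAlgebraic B x)
    (h : ∀ n, algebraMap B K ((minpoly B x).coeff n) ∈ Set.range (algebraMap A K)) :
    IsAlgebraic A x := by
  have h1 : (minpoly B x).map (algebraMap B K) ∈ lifts (algebraMap A K) := by
    rw [lifts_iff_coeff_lifts]
    intro n
    rw [coeff_map]
    exact h n
  obtain ⟨g, hg⟩ := (mem_lifts _).mp h1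
  refine ⟨g, ?_, ?_⟩
  · rintro rfl
    rw [Polynomial.map_zero] at hg
    exact ((minpoly.monic hx.isIntegral).map (algebraMap B K)).ne_zero hg.symm
  · rw [← eval_map_algebraMap, hg, eval_map_algebraMap, minpoly.aeval]

variable {k : Type u} {K : Type v} [Field k] [Field K] [Algebra k K]

lemma mem_adjoin_insert_iff {L : IntermediateField k K} {t z : K} :
    z ∈ adjoin k (insert t (L : Set K)) ↔ z ∈ adjoin L {t} := by
  rw [Set.insert_eq, Set.union_comm, ← restrictScalars_adjoin, mem_restrictScalars]

lemma isAlgebraic_adjoin_insert_iff {L : IntermediateField k K} {t z : K} :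
    IsAlgebraic (adjoin k (insert t (L : Set K))) z ↔ IsAlgebraic (adjoin L {t}) z :=
  ⟨fun h => h.of_range_subset (by
    rintro _ ⟨y, rfl⟩; exact ⟨⟨y, mem_adjoin_insert_iff.mp y.2⟩, rfl⟩),
    fun h => h.of_range_subset (by
    rintro _ ⟨y, rfl⟩; exact ⟨⟨y, mem_adjoin_insert_iff.mpr y.2⟩, rfl⟩)⟩

lemma adjoin_singleton_le_of_le {L M : IntermediateField k K} (h : L ≤ M) {t z : K}
    (hz : z ∈ adjoin L {t}) : z ∈ adjoin M {t} := by
  rw [← mem_adjoin_insert_iff] at hz ⊢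
  exact adjoin.mono _ _ _ (Set.insert_subset_insert h) hz

lemma coeff_minpoly_mem_adjoin [Infinite k] {L M : IntermediateField k K} (hL : RelAlgClosed L)
    (hLM : L ≤ M) {t x : K} (ht : Transcendental M t) (hx : IsAlgebraic (adjoin L {t}) x) (n : ℕ) :
    ((minpoly (adjoin M {t}) x).coeff n : K) ∈ adjoin L {t} := by
  let _ : Algebra L M := (inclusion hLM).toRingHom.toAlgebra
  have : IsScalarTower L M K := IsScalarTower.of_algebraMap_eq fun _ => rfl
  have : Infinite L := Infinite.of_injective _ (algebraMap k L).injective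
  refine mem_adjoin_of_isAlgebraic_adjoin (E := M) (fun e he => ?_) ht
    ((minpoly (adjoin M {t}) x).coeff n).2 ?_
  · exact ⟨⟨e, hL _ (he.algebraMap (A := K))⟩, rfl⟩
  · exact isAlgebraic_coeff_minpoly_of_range_subset (B := adjoin M {t})
      (by rintro _ ⟨y, rfl⟩; exact ⟨⟨y, adjoin_singleton_le_of_le hLM y.2⟩, rfl⟩) hx n

lemma isAlgebraic_adjoin_inf [Infinite k] {L₁ L₂ M : IntermediateField k K} (h₁ : RelAlgClosed L₁)
    (h₂ : RelAlgClosed L₂) (h₁M : L₁ ≤ M) (h₂M : L₂ ≤ M) {t x : K} (ht : Transcendental M t)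
    (hx₁ : IsAlgebraic (adjoin L₁ {t}) x) (hx₂ : IsAlgebraic (adjoin L₂ {t}) x) :
    IsAlgebraic (adjoin (L₁ ⊓ L₂ : IntermediateField k K) {t}) x := by
  have hc : ∀ n, ((minpoly (adjoin M {t}) x).coeff n : K) ∈
      adjoin (L₁ ⊓ L₂ : IntermediateField k K) {t} := fun n =>
    mem_adjoin_inf h₁M h₂M ht (coeff_minpoly_mem_adjoin h₁ h₁M ht hx₁ n)
      (coeff_minpoly_mem_adjoin h₂ h₂M ht hx₂ n)
  refine isAlgebraic_of_coeff_minpoly_mem (B := adjoin M {t}) (hx₁.of_range_subset ?_)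
    fun n => ⟨⟨_, hc n⟩, rfl⟩
  rintro _ ⟨y, rfl⟩
  exact ⟨⟨y, adjoin_singleton_le_of_le h₁M y.2⟩, rfl⟩

end Reconstruction

section Configuration
open IntermediateField

variable {k : Type u} {K : Type v} [Field k] [Field K] [Algebra k K]

lemma adjoin_insert_bot (t : K) :
    adjoin k (insert t ((⊥ : IntermediateField k K) : Set K)) = adjoin k {t} := by
  refine le_antisymm ?_ (adjoin.mono _ _ _ (by simp))
  rw [adjoin_le_iff]
  rintro z (rfl | hz)
  · exact mem_adjoin_simple_self k z
  · exact (bot_le : ⊥ ≤ adjoin k {t}) hz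

lemma IsAlgebraic.mem_bot [IsAlgClosed k] {z : K} (hz : IsAlgebraic k z) :
    z ∈ (⊥ : IntermediateField k K) :=
  IntermediateField.mem_bot.mpr (mem_range_algebraMap_of_isAlgebraic hz)

lemma transcendental_of_notMem_bot [IsAlgClosed k] {t : K} (ht : t ∉ (⊥ : IntermediateField k K)) :
    Transcendental k t :=
  fun h => ht h.mem_bot

lemma hasTrdeg_racl_adjoin_singleton [IsAlgClosed k] {t : K}
    (ht : t ∉ (⊥ : IntermediateField k K)) : HasTrdeg k (racl (adjoin k {t})) 1 := by
  have h := (hasTrdeg_bot (k := k) (K := K)).racl_insert (t := t)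
    (fun h => ht (relAlgClosed_bot t h))
  rwa [adjoin_insert_bot] at h

lemma HasTrdeg.exists_notMem_of_lt {E F : IntermediateField k K} {d e : ℕ} (hE : HasTrdeg k E d)
    (hF : HasTrdeg k F e) (hde : d < e) : ∃ z ∈ F, z ∉ E := by
  by_contra! h
  have := (HasTrdeg.mono h hF hE).1
  omega

lemma HasTrdeg.eq_of_le {E F : IntermediateField k K} {d : ℕ} (hE : HasTrdeg k E d)
    (hF : HasTrdeg k F d) (hrac : RelAlgClosed E) (h : E ≤ F) : E = F :=
  le_antisymm h (((HasTrdeg.mono h hE hF).2 rfl).trans hrac.racl_eq.le)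

lemma HasTrdeg.racl_adjoin_singleton_eq [IsAlgClosed k] {L : IntermediateField k K}
    (hL : HasTrdeg k L 1) (hrac : RelAlgClosed L) {t : K} (ht : t ∈ L)
    (htb : t ∉ (⊥ : IntermediateField k K)) : racl (adjoin k {t}) = L :=
  (hasTrdeg_racl_adjoin_singleton htb).eq_of_le hL (relAlgClosed_racl _)
    (hrac.racl_le (adjoin_simple_le_iff.mpr ht))

lemma RelAlgClosed.inf {E F : IntermediateField k K} (hE : RelAlgClosed E) (hF : RelAlgClosed F) :
    RelAlgClosed (E ⊓ F) :=
  fun z hz => ⟨hE z (hz.mono_intermediateField inf_le_left),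
    hF z (hz.mono_intermediateField inf_le_right)⟩

lemma RelAlgClosed.racl_insert_le {E F : IntermediateField k K} (hF : RelAlgClosed F) (h : E ≤ F)
    {t : K} (ht : t ∈ F) : racl (adjoin k (insert t (E : Set K))) ≤ F :=
  hF.racl_le (adjoin_le_iff.mpr (Set.insert_subset ht h))

lemma HasTrdeg.racl_insert_eq {E F : IntermediateField k K} {d : ℕ} (hE : HasTrdeg k E d)
    (hEr : RelAlgClosed E) (hF : HasTrdeg k F (d + 1)) (hFr : RelAlgClosed F) (h : E ≤ F) {t : K}
    (ht : t ∈ F) (htE : t ∉ E) : racl (adjoin k (insert t (E : Set K))) = F :=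
  (hE.racl_insert (fun h => htE (hEr t h))).eq_of_le hF (relAlgClosed_racl _)
    (hFr.racl_insert_le h ht)

/-- The configuration of subfields forcing an intersection to have transcendence degree one. -/
theorem hasTrdeg_inf_of_configuration [IsAlgClosed k] {L₁ L₂ M M₁ M₂ F : IntermediateField k K}
    (h₁ : RelAlgClosed L₁) (h₂ : RelAlgClosed L₂) (hM : RelAlgClosed M) (hM₁ : RelAlgClosed M₁)
    (hM₂ : RelAlgClosed M₂) (d₁ : HasTrdeg k L₁ 2) (d₂ : HasTrdeg k L₂ 2) (e₁ : HasTrdeg k M₁ 3)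
    (e₂ : HasTrdeg k M₂ 3) (hF : HasTrdeg k F 2) (hne : L₁ ≠ L₂) (l₁ : L₁ ≤ M) (l₂ : L₂ ≤ M)
    (m₁ : L₁ ≤ M₁) (m₂ : L₂ ≤ M₂) (f₁ : F ≤ M₁) (f₂ : F ≤ M₂) {t : K} (ht : t ∉ M)
    (t₁ : t ∈ M₁) (t₂ : t ∈ M₂) : HasTrdeg k (L₁ ⊓ L₂ : IntermediateField k K) 1 := by
  have : Infinite k := IsAlgClosed.instInfinite
  have htb : t ∉ (⊥ : IntermediateField k K) := fun h => ht ((bot_le : ⊥ ≤ M) h)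
  obtain ⟨x, hxF, hx⟩ := (hasTrdeg_racl_adjoin_singleton htb).exists_notMem_of_lt hF (by norm_num)
  have a₁ : IsAlgebraic (adjoin L₁ {t}) x := by
    rw [← isAlgebraic_adjoin_insert_iff, ← mem_racl,
      d₁.racl_insert_eq h₁ e₁ hM₁ m₁ t₁ (fun h => ht (l₁ h))]
    exact f₁ hxF
  have a₂ : IsAlgebraic (adjoin L₂ {t}) x := by
    rw [← isAlgebraic_adjoin_insert_iff, ← mem_racl,
      d₂.racl_insert_eq h₂ e₂ hM₂ m₂ t₂ (fun h => ht (l₂ h))]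
    exact f₂ hxF
  have a₃ := isAlgebraic_adjoin_inf h₁ h₂ l₁ l₂ (fun h => ht (hM t h)) a₁ a₂
  obtain ⟨z, hz, hzb⟩ : ∃ z ∈ L₁ ⊓ L₂, z ∉ (⊥ : IntermediateField k K) := by
    by_contra! h
    rw [← isAlgebraic_adjoin_insert_iff, (eq_bot_iff.mpr h : L₁ ⊓ L₂ = ⊥), adjoin_insert_bot] at a₃
    exact hx (mem_racl.mpr a₃)
  have hz' := hasTrdeg_racl_adjoin_singleton hzb
  have hR := relAlgClosed_racl (adjoin k {z})
  have hle : racl (adjoin k {z}) ≤ L₁ ⊓ L₂ :=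
    (h₁.inf h₂).racl_le (adjoin_simple_le_iff.mpr hz)
  suffices h : racl (adjoin k {z}) = L₁ ⊓ L₂ by rwa [← h]
  refine le_antisymm hle fun w hw => ?_
  by_contra hwR
  exact hne ((hz'.racl_insert_eq hR d₁ h₁ (hle.trans inf_le_left) hw.1 hwR).symm.trans
    (hz'.racl_insert_eq hR d₂ h₂ (hle.trans inf_le_right) hw.2 hwR))

variable {ℓ : ℕ}

lemma dimMge_one_of_ne {S : Set (K1 ℓ K)} {a : Kˣ} (ha : K1proj ℓ K a ∈ S)
    (h : K1proj ℓ K a ≠ 1) : dimMge ℓ S 1 :=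
  ⟨fun _ => a, fun _ => ha, milnorSymbol_one_ne_zero h⟩

lemma dimMge_two_iff {S : Set (K1 ℓ K)} :
    dimMge ℓ S 2 ↔ ∃ a b : Kˣ, K1proj ℓ K a ∈ S ∧ K1proj ℓ K b ∈ S ∧ sym ℓ (a : K) b ≠ 0 := by
  constructor
  · rintro ⟨a, ha, h⟩
    refine ⟨a 0, a 1, ha 0, ha 1, ?_⟩
    have e : ![a 0, a 1] = a := by
      funext i
      fin_cases i <;> rfl
    rw [← e] at h
    rwa [sym_units]
  · rintro ⟨a, b, ha, hb, h⟩
    refine ⟨![a, b], fun i => ?_, ?_⟩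
    · fin_cases i
      · exact ha
      · exact hb
    · rwa [sym_units] at h

theorem not_dimMge_Omega_two [IsAlgClosed k] [Fact ℓ.Prime] (hk : (ℓ : k) ≠ 0)
    {L : IntermediateField k K} (hL : RelAlgClosed L)
    (hd : HasTrdeg k L 1) : ¬ dimMge ℓ (Omega ℓ L : Set (K1 ℓ K)) 2 := by
  have hℓ : ℓ ≠ 0 := (Fact.out : ℓ.Prime).ne_zero
  rw [dimMge_two_iff]
  rintro ⟨a, b, ha, hb, h⟩
  obtain ⟨a', ha', z, rfl⟩ := K1proj_mem_Omega_iff.mp ha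
  obtain ⟨b', hb', w, rfl⟩ := K1proj_mem_Omega_iff.mp hb
  refine h ?_
  push_cast
  rw [sym_mul_left a'.ne_zero (pow_ne_zero _ z.ne_zero), sym_ellpow_left hℓ, add_zero,
    sym_mul_right _ b'.ne_zero (pow_ne_zero _ w.ne_zero), sym_ellpow_right hℓ, add_zero]
  by_cases hab : (a' : K) ∈ (⊥ : IntermediateField k K)
  · have h1 := (K1proj_mem_Omega_bot (k := k) hℓ a').mp
      (K1proj_mem_Omega_iff.mpr ⟨a', hab, 1, by simp⟩)
    obtain ⟨y, rfl⟩ := K1proj_eq_one_iff.mp h1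
    push_cast
    exact sym_ellpow_left hℓ _ _
  · refine sym_eq_zero_of_isAlgebraic hk _ _ (mem_racl.mp ?_)
    rw [hd.racl_adjoin_singleton_eq hL ha' hab]
    exact hb'

theorem Omega_mem_M1Set [IsAlgClosed k] [Fact ℓ.Prime] (hk : (ℓ : k) ≠ 0)
    (hK : IsFunctionField k K) {L : IntermediateField k K} (hL : RelAlgClosed L)
    (hd : HasTrdeg k L 1) : Omega ℓ L ∈ M1Set ℓ K := by
  have hℓ : ℓ ≠ 0 := (Fact.out : ℓ.Prime).ne_zero
  refine ⟨⟨?_, not_dimMge_Omega_two hk hL hd⟩, fun B hB hLB => ?_⟩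
  · by_contra h
    obtain ⟨z, hz, hzb⟩ := hasTrdeg_bot.exists_notMem_of_lt hd one_pos
    refine hzb (le_of_Omega_le (ℓ := ℓ) hk hK relAlgClosed_bot ?_ hz)
    intro x hx
    obtain ⟨a, rfl⟩ := QuotientGroup.mk'_surjective _ x
    exact (K1proj_mem_Omega_bot hℓ a).mpr (by_contra fun h1 => h (dimMge_one_of_ne hx h1))
  · refine le_antisymm (fun x hx => ?_) hLB
    obtain ⟨b, rfl⟩ := QuotientGroup.mk'_surjective _ x
    by_contra hb
    obtain ⟨t, ht, htb⟩ := hasTrdeg_bot.exists_notMem_of_lt hd one_pos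
    obtain ⟨a, ha, hab⟩ := exists_sym_ne_zero (ℓ := ℓ) (b := (b : K)) hk hK hL ht
      (transcendental_of_notMem_bot htb)
      (fun z hz => mem_racl.mp ((hd.racl_adjoin_singleton_eq hL ht htb).ge hz))
      (fun l hl z hlz => hb (K1proj_mem_Omega_iff.mpr (by
        have hl0 : l ≠ 0 := by rintro rfl; exact b.ne_zero (by rw [hlz, zero_mul])
        have hz0 : z ≠ 0 := by rintro rfl; exact b.ne_zero (by rw [hlz, zero_pow hℓ, mul_zero])
        exact ⟨Units.mk0 l hl0, hl, Units.mk0 z hz0, Units.ext hlz⟩)))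
    have ha0 : a ≠ 0 := by rintro rfl; exact hab (sym_zero_left _)
    refine hB.2 (dimMge_two_iff.mpr ⟨Units.mk0 a ha0, b, ?_, hx, hab⟩)
    exact hLB (K1proj_mem_Omega_iff.mpr ⟨Units.mk0 a ha0, ha, 1, by simp⟩)

end Configuration

section Characterization
open IntermediateField

variable {k : Type u} {K : Type v} [Field k] [Field K] [Algebra k K] {ℓ : ℕ}

theorem mem_GSet_one_of_configuration [IsAlgClosed k] [Fact ℓ.Prime] (hk : (ℓ : k) ≠ 0)
    (hK : IsFunctionField k K) {A D B₁ B₂ E B₁' B₂' C : Subgroup (K1 ℓ K)} (hA : A ∈ M1Set ℓ K)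
    (hD : IsRationalSubgroup ℓ k D) (h₁ : B₁ ∈ GSet ℓ k 2) (h₂ : B₂ ∈ GSet ℓ k 2)
    (hE : E ∈ GSet ℓ k 2) (h₁' : B₁' ∈ GSet ℓ k 3) (h₂' : B₂' ∈ GSet ℓ k 3) (hC : C ∈ GSet ℓ k 3)
    (hne : B₁ ≠ B₂) (hDC : ¬ D ≤ C) (l₁ : B₁ ≤ C) (l₂ : B₂ ≤ C) (m₁ : B₁ ≤ B₁') (t₁ : D ≤ B₁')
    (m₂ : B₂ ≤ B₂') (t₂ : D ≤ B₂') (f : E ≤ B₁' ⊓ B₂') (hAB : A = B₁ ⊓ B₂) :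
    A ∈ GSet ℓ k 1 := by
  obtain ⟨t, ht, rfl⟩ := hD
  obtain ⟨L₁, r₁, d₁, rfl⟩ := h₁
  obtain ⟨L₂, r₂, d₂, rfl⟩ := h₂
  obtain ⟨F, rF, dF, rfl⟩ := hE
  obtain ⟨M₁, s₁, e₁, rfl⟩ := h₁'
  obtain ⟨M₂, s₂, e₂, rfl⟩ := h₂'
  obtain ⟨M, rM, dM, rfl⟩ := hC
  have hd := hasTrdeg_inf_of_configuration r₁ r₂ rM s₁ s₂ d₁ d₂ e₁ e₂ dF
    (fun h => hne (by rw [h])) (le_of_Omega_le hk hK rM l₁) (le_of_Omega_le hk hK rM l₂)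
    (le_of_Omega_le hk hK s₁ m₁) (le_of_Omega_le hk hK s₂ m₂)
    (le_of_Omega_le hk hK s₁ (f.trans inf_le_left))
    (le_of_Omega_le hk hK s₂ (f.trans inf_le_right))
    (fun h => hDC (Omega_mono (adjoin_simple_le_iff.mpr h)))
    (adjoin_simple_le_iff.mp (le_of_Omega_le hk hK s₁ t₁))
    (adjoin_simple_le_iff.mp (le_of_Omega_le hk hK s₂ t₂))
  refine ⟨L₁ ⊓ L₂, r₁.inf r₂, hd, (Omega_mem_M1Set hk hK (r₁.inf r₂) hd).2 _ hA.1 ?_⟩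
  rw [hAB]
  exact le_inf (Omega_mono inf_le_left) (Omega_mono inf_le_right)

end Characterization

section FiniteClosure
open IntermediateField algebraAdjoinAdjoin

lemma linearIndependent_adjoin_of_algebraicIndependent {F K ι κ : Type*} [Field F] [Field K]
    [Algebra F K] {x : ι → K} (hx : AlgebraicIndependent F x) {C : IntermediateField F K}
    [Algebra.IsAlgebraic F C] {b : κ → C} (hb : LinearIndependent F b) :
    LinearIndependent (adjoin F (Set.range x)) (fun i => (b i : K)) := by
  rw [← LinearIndependent.iff_fractionRing (R := Algebra.adjoin F (Set.range x))]
  have hxC : AlgebraicIndependent C x := hx.extendScalars C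
  rw [linearIndependent_iff'] at hb ⊢
  intro s g hg i hi
  have hlift : ∀ i, ∃ p : MvPolynomial ι F, MvPolynomial.aeval x p = (g i : K) := fun i =>
    (Algebra.adjoin_range_eq_range_aeval F x).le (g i).2
  choose p hp using hlift
  have hz : ∑ i ∈ s, MvPolynomial.C (b i) * MvPolynomial.map (algebraMap F C) (p i) = 0 := by
    refine (algebraicIndependent_iff.mp hxC) _ ?_
    rw [map_sum, ← hg]
    refine Finset.sum_congr rfl fun i _ => ?_
    rw [_root_.map_mul, MvPolynomial.aeval_C, MvPolynomial.aeval_map_algebraMap, hp, mul_comm]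
    rfl
  have hp0 : p i = 0 := by
    ext m
    refine hb s (fun i => (p i).coeff m) ?_ i hi
    have h := congrArg (MvPolynomial.coeff m) hz
    rw [MvPolynomial.coeff_sum, MvPolynomial.coeff_zero] at h
    rw [← h]
    refine Finset.sum_congr rfl fun i _ => ?_
    rw [MvPolynomial.coeff_C_mul, MvPolynomial.coeff_map, Algebra.smul_def, mul_comm]
  refine Subtype.ext ?_
  rw [← hp, hp0]
  simp

/-- The algebraic closure of the base field in a finitely generated extension is finite. -/
theorem finiteDimensional_of_isAlgebraic_le {F K : Type*} [Field F] [Field K] [Algebra F K]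
    (hK : IsFunctionField F K) (C : IntermediateField F K) [Algebra.IsAlgebraic F C] :
    FiniteDimensional F C := by
  obtain ⟨ι, x, hx⟩ := exists_isTranscendenceBasis' F K
  have : Algebra.IsAlgebraic (adjoin F (Set.range x)) K := hx.isAlgebraic_field
  have : FiniteDimensional (adjoin F (Set.range x)) K :=
    finiteDimensional_of_isFunctionField hK.of_tower
  have h := linearIndependent_adjoin_of_algebraicIndependent hx.1
    (Module.Basis.ofVectorSpace F C).linearIndependent
  have := h.finite
  exact Module.Finite.of_basis (Module.Basis.ofVectorSpace F C)

end FiniteClosure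

section Bertini
open IntermediateField

lemma finite_setOf_le_of_isSeparable {G K : Type*} [Field G] [Field K] [Algebra G K]
    (S : IntermediateField G K) [FiniteDimensional G S] [Algebra.IsSeparable G S] :
    Finite {N : IntermediateField G K // N ≤ S} := by
  have h := (Field.exists_primitive_element_iff_finite_intermediateField G S).mp
    ⟨inferInstance, Field.exists_primitive_element G S⟩
  refine Finite.of_injective (fun N : {N : IntermediateField G K // N ≤ S} => restrict N.2)
    fun N N' h => Subtype.ext ?_
  have h' := congrArg lift h
  rwa [lift_restrict, lift_restrict] at h'

lemma hasTrdeg_racl_of_transcendental {F : Type u} {K : Type v} [Field F] [Field K] [Algebra F K]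
    {s : K} (hs : Transcendental F s) : HasTrdeg F (racl (adjoin F {s})) 1 := by
  have h := (hasTrdeg_bot (k := F) (K := K)).racl_insert (t := s) (fun h => hs ?_)
  · rwa [adjoin_insert_bot] at h
  · refine h.of_range_subset ?_
    rintro _ ⟨⟨y, hy⟩, rfl⟩
    exact IntermediateField.mem_bot.mp hy

lemma Transcendental.notMem_racl_add_smul {F : Type u} {K : Type v} [Field F] [Field K]
    [Algebra F K] {u v : K} (hv : Transcendental F v) (hu : Transcendental (adjoin F {v}) u)
    (c : F) : v ∉ racl (adjoin F {u + c • v}) := by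
  have hvv := mem_adjoin_simple_self F v
  have hs : Transcendental F (u + c • v) := fun h => hu (by
    have h1 := (h.tower_top (adjoin F {v})).sub
      (isAlgebraic_algebraMap (R := adjoin F {v}) (A := K) (c • ⟨v, hvv⟩))
    rwa [show algebraMap (adjoin F {v}) K (c • ⟨v, hvv⟩) = c • v from rfl,
      add_sub_cancel_right] at h1)
  intro hvE
  have huE : u ∈ racl (adjoin F {u + c • v}) := by
    have h1 := sub_mem (le_racl _ (mem_adjoin_simple_self F (u + c • v)))
      (IntermediateField.smul_mem _ hvE (x := c))
    rwa [add_sub_cancel_right] at h1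
  have hd : HasTrdeg F (racl (adjoin F (insert u (racl (adjoin F {v}) : Set K)))) 2 :=
    (hasTrdeg_racl_of_transcendental hv).racl_insert fun h =>
      hu (mem_racl.mp (relAlgClosed_racl _ u h))
  have hE := relAlgClosed_racl (adjoin F {u + c • v})
  have := (HasTrdeg.mono (hE.racl_insert_le (hE.racl_le (adjoin_simple_le_iff.mpr hvE)) huE) hd
    (hasTrdeg_racl_of_transcendental hs)).1
  omega

lemma mem_of_add_smul_mem {F K : Type*} [Field F] [Field K] [Algebra F K]
    {T : IntermediateField F K} {u v : K} {c c' : F} (hne : c ≠ c') (h : u + c • v ∈ T)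
    (h' : u + c' • v ∈ T) : u ∈ T ∧ v ∈ T := by
  have hv : v = (c' - c)⁻¹ • ((u + c' • v) - (u + c • v)) := by
    rw [add_sub_add_left_eq_sub, ← sub_smul, smul_smul, inv_mul_cancel₀ (sub_ne_zero.mpr hne.symm),
      one_smul]
  have hvT : v ∈ T := hv ▸ IntermediateField.smul_mem _ (sub_mem h' h)
  refine ⟨?_, hvT⟩
  have h1 := sub_mem h (IntermediateField.smul_mem _ hvT (x := c))
  rwa [add_sub_cancel_right] at h1

lemma mem_of_mem_adjoin {F K : Type*} [Field F] [Field K] [Algebra F K] {G T :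
    IntermediateField F K}
    {W : Set K} (hG : G ≤ T) (hW : W ⊆ T) {z : K} (hz : z ∈ adjoin G W) : z ∈ T := by
  rw [← mem_restrictScalars (K := F), restrictScalars_adjoin] at hz
  exact adjoin_le_iff.mpr (Set.union_subset hG hW) hz

/-- A general member of a pencil generates a separably closed subfield. -/
theorem exists_forall_isSeparable_mem_adjoin {F : Type u} {K : Type v} [Field F] [Field K]
    [Algebra F K] [Infinite F] (hK : IsFunctionField F K)
    (hF : ∀ e : K, IsAlgebraic F e → e ∈ Set.range (algebraMap F K)) {u v : K}
    (hv : Transcendental F v) (hu : Transcendental (adjoin F {v}) u) :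
    ∃ c : F, ∀ z : K, IsSeparable (adjoin F {u + c • v}) z → z ∈ adjoin F {u + c • v} := by
  let G := adjoin F {u, v}
  have huG : u ∈ G := subset_adjoin _ _ (by simp)
  have hvG : v ∈ G := subset_adjoin _ _ (by simp)
  have hsG : ∀ c : F, adjoin F {u + c • v} ≤ G := fun c =>
    adjoin_simple_le_iff.mpr (add_mem huG (IntermediateField.smul_mem _ hvG))
  let S := separableClosure G K
  have : FiniteDimensional G S := finiteDimensional_of_isAlgebraic_le hK.of_tower S
  have := finite_setOf_le_of_isSeparable S
  let N : F → {N : IntermediateField G K // N ≤ S} := fun c =>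
    ⟨adjoin G {z | IsSeparable (adjoin F {u + c • v}) z}, adjoin_le_iff.mpr fun z hz => by
      let _ : Algebra (adjoin F {u + c • v}) G := (inclusion (hsG c)).toRingHom.toAlgebra
      have : IsScalarTower (adjoin F {u + c • v}) G K := IsScalarTower.of_algebraMap_eq fun _ => rfl
      exact mem_separableClosure_iff.mpr (IsSeparable.tower_top G hz)⟩
  obtain ⟨c, c', hne, hN⟩ := Finite.exists_ne_map_eq_of_infinite N
  refine ⟨c', fun e he => ?_⟩
  let E := racl (adjoin F {u + c • v})
  have hvE : v ∉ E := hv.notMem_racl_add_smul hu c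
  have hsE : u + c • v ∈ E := le_racl _ (mem_adjoin_simple_self F _)
  refine mem_adjoin_of_isAlgebraic_adjoin (E := E) (fun x hx => ?_) (fun h => hvE ?_) ?_
    he.isIntegral.isAlgebraic
  · obtain ⟨y, hy⟩ := hF x (hx.algebraMap (A := K))
    exact ⟨y, Subtype.ext hy⟩
  · exact (mem_of_add_smul_mem hne hsE (relAlgClosed_racl _ _ h)).2
  · have h1 : e ∈ adjoin G {z | IsSeparable (adjoin F {u + c • v}) z} := by
      rw [show adjoin G {z | IsSeparable (adjoin F {u + c • v}) z} =
        adjoin G {z | IsSeparable (adjoin F {u + c' • v}) z} from congrArg Subtype.val hN]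
      exact subset_adjoin _ _ he
    have hEa : ∀ z ∈ E, z ∈ adjoin E {u + c' • v} := fun z hz =>
      (adjoin E {u + c' • v}).algebraMap_mem ⟨z, hz⟩
    obtain ⟨hua, hva⟩ := mem_of_add_smul_mem (T := (adjoin E {u + c' • v}).restrictScalars F) hne
      (hEa _ hsE) (mem_adjoin_simple_self E _)
    have hGT : G ≤ (adjoin E {u + c' • v}).restrictScalars F :=
      adjoin_le_iff.mpr (Set.insert_subset hua (Set.singleton_subset_iff.mpr hva))
    exact mem_of_mem_adjoin (T := (adjoin E {u + c' • v}).restrictScalars F) hGT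
      (fun z hz => hEa z (mem_racl.mpr (IsSeparable.isIntegral hz).isAlgebraic)) h1

end Bertini

section GeneralElement
open IntermediateField Polynomial

lemma IsSeparable.coe_intermediateField {F K : Type*} [Field F] [Field K] [Algebra F K]
    {T : IntermediateField F K} {x : T} (hx : IsSeparable F x) : IsSeparable F (x : K) :=
  IsSeparable.map (f := T.val) T.val.injective hx

lemma exists_forall_pow_mem_range {F K : Type*} [Field F] [Field K] [Algebra F K]
    (hK : IsFunctionField F K) (p : ℕ) [ExpChar F p]
    (h : ∀ z : K, IsSeparable F z → z ∈ Set.range (algebraMap F K)) :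
    ∃ n, ∀ z : K, IsAlgebraic F z → z ^ p ^ n ∈ Set.range (algebraMap F K) := by
  have : FiniteDimensional F (algebraicClosure F K) :=
    finiteDimensional_of_isAlgebraic_le hK _
  have : IsPurelyInseparable F (algebraicClosure F K) := by
    rw [isPurelyInseparable_iff]
    refine fun x => ⟨Algebra.IsIntegral.isIntegral x, fun hx => ?_⟩
    obtain ⟨y, hy⟩ := h x hx.coe_intermediateField
    exact ⟨y, Subtype.ext hy⟩
  refine ⟨IsPurelyInseparable.exponent F (algebraicClosure F K), fun z hz => ?_⟩
  obtain ⟨y, hy⟩ := IsPurelyInseparable.exponent_def' F p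
    (⟨z, mem_algebraicClosure_iff'.mpr hz.isIntegral⟩ : algebraicClosure F K)
  exact ⟨y, congrArg Subtype.val hy⟩

lemma exponent_eq_one_of_pow_eq {F K : Type*} [Field F] [Field K] [Algebra F K] {s w : K}
    (hs : Transcendental F s) (hw : w ∈ adjoin F {s}) {e : ℕ} (h : w ^ e = s) : e = 1 := by
  obtain ⟨w, rfl⟩ := ratFuncEval_range s hs w hw
  have h1 : w ^ e = RatFunc.X := (ratFuncEval s hs).toRingHom.injective
    (((ratFuncEval s hs).map_pow w e).trans (h.trans (ratFuncEval_X s hs).symm))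
  have hw0 : w ≠ 0 := by
    rintro rfl
    rcases eq_or_ne e 0 with rfl | he
    · have h2 := congrArg RatFunc.intDegree h1
      simp at h2
    · rw [zero_pow he] at h1
      exact RatFunc.X_ne_zero h1.symm
  have h2 : ∀ n : ℕ, (w ^ n).intDegree = n * w.intDegree := fun n => by
    induction n with
    | zero => simp
    | succ n ih => rw [pow_succ, RatFunc.intDegree_mul (pow_ne_zero _ hw0) hw0, ih]; push_cast; ring
  have h3 := congrArg RatFunc.intDegree h1
  rw [h2, RatFunc.intDegree_X] at h3
  have h4 : (e : ℤ) ∣ 1 := ⟨_, h3.symm⟩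
  exact_mod_cast Int.eq_one_of_dvd_one (by positivity) h4

/-- A simple root over the subfield of `p`-th powers of a polynomial is a `p`-th power. -/
lemma exists_pow_eq_of_aeval_eq {k K : Type*} [Field k] [Field K] [Algebra k K] [IsAlgClosed k]
    (p : ℕ) [Fact p.Prime] [CharP k p] {r y : K} {f : k[X]} (hf : aeval r f = y ^ p)
    (hf' : aeval r (derivative f) ≠ 0) : ∃ x, x ^ p = r := by
  have : CharP K p := charP_of_injective_algebraMap (algebraMap k K).injective p
  let T := (frobenius K p).fieldRange
  have : CharP T p := (algebraMap T K).charP (algebraMap T K).injective p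
  have hT : ∀ z : K, z ^ p ∈ T := fun z => ⟨z, rfl⟩
  let φ : k →+* T := (algebraMap k K).codRestrict T fun c => by
    obtain ⟨d, hd⟩ := IsAlgClosed.exists_pow_nat_eq c (Fact.out : p.Prime).pos
    rw [← hd, _root_.map_pow]
    exact hT _
  let P := f.map φ - C ⟨y ^ p, hT y⟩
  have hφ : ∀ g : k[X], aeval r (g.map φ) = aeval r g := fun g => by
    rw [aeval_def, aeval_def, eval₂_map]
    rfl
  have hP : aeval r P = 0 := by
    rw [_root_.map_sub, hφ, hf, aeval_C]
    exact sub_self _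
  have hP' : aeval r (derivative P) ≠ 0 := by
    rwa [derivative_sub, derivative_C, sub_zero, derivative_map, hφ]
  have h_int : IsIntegral T r :=
    ⟨X ^ p - C ⟨r ^ p, hT r⟩, monic_X_pow_sub_C _ (Fact.out : p.Prime).ne_zero, by
      rw [← aeval_def, _root_.map_sub, aeval_C, _root_.map_pow, aeval_X]
      exact sub_self _⟩
  have hsep : IsSeparable T r := by
    rw [IsSeparable, separable_iff_derivative_ne_zero (minpoly.irreducible h_int)]
    intro h0
    obtain ⟨q, hq⟩ := minpoly.dvd T r hP
    refine hP' ?_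
    rw [hq, derivative_mul, h0, zero_mul, zero_add, _root_.map_mul, minpoly.aeval, zero_mul]
  have h1 := adjoin_simple_eq_adjoin_pow_expChar_of_isSeparable T K hsep p
  have h2 : r ∈ (⊥ : IntermediateField T K) := by
    have h3 : adjoin T {r ^ p} = ⊥ := adjoin_simple_eq_bot_iff.mpr
      (IntermediateField.mem_bot.mpr ⟨⟨r ^ p, hT r⟩, rfl⟩)
    rw [← h3, ← h1]
    exact mem_adjoin_simple_self T r
  obtain ⟨⟨_, z, rfl⟩, hz⟩ := IntermediateField.mem_bot.mp h2
  exact ⟨z, hz⟩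

lemma mem_adjoin_of_pow_mem {k K : Type*} [Field k] [Field K] [Algebra k K] [IsAlgClosed k]
    (p : ℕ) [Fact p.Prime] [CharP k p] {r z : K} (htr : Transcendental k r)
    (hr : ¬ ∃ x, x ^ p = r) (hz : z ^ p ∈ adjoin k {r}) : z ∈ adjoin k {r} := by
  have : CharP K p := charP_of_injective_algebraMap (algebraMap k K).injective p
  obtain ⟨f, g, -, hg, hfg⟩ := exists_coprime_of_mem_adjoin htr hz
  have hg0 : aeval r g ≠ 0 := fun h => hg.ne_zero (transcendental_iff.mp htr g h)
  have hmem : ∀ h : k[X], aeval r h ∈ adjoin k {r} := fun h =>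
    algebra_adjoin_le_adjoin k {r} (aeval_mem_adjoin_singleton k r)
  have hF : aeval r (f * g ^ (p - 1)) = (z * aeval r g) ^ p := by
    rw [mul_pow, hfg, _root_.map_mul, _root_.map_pow, div_mul_eq_mul_div, eq_div_iff hg0, mul_assoc,
      ← pow_succ, Nat.sub_add_cancel (Fact.out : p.Prime).one_le]
  have hd : derivative (f * g ^ (p - 1)) = 0 := by
    by_contra h
    exact hr (exists_pow_eq_of_aeval_eq p hF fun h' => h (transcendental_iff.mp htr _ h'))
  rw [← expand_contract p hd (Fact.out : p.Prime).ne_zero, polynomial_expand_eq,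
      _root_.map_pow] at hF
  have h1 := frobenius_inj K p (show frobenius K p _ = frobenius K p _ from hF)
  rw [← mul_div_cancel_right₀ z hg0, ← h1]
  exact div_mem (hmem _) (hmem _)

lemma relAlgClosed_adjoin_of_isSeparable {k K : Type*} [Field k] [Field K] [Algebra k K]
    [CharZero k] {s : K} (h : ∀ z : K, IsSeparable (adjoin k {s}) z → z ∈ adjoin k {s}) :
    RelAlgClosed (adjoin k {s}) := fun z hz =>
  h z (minpoly.irreducible hz.isIntegral).separable

theorem exists_isGeneralElement_of_isSeparable {k K : Type*} [Field k] [Field K] [Algebra k K]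
    [IsAlgClosed k] (hK : IsFunctionField k K) {s : K} (hs : s ∉ (⊥ : IntermediateField k K))
    (h : ∀ z : K, IsSeparable (adjoin k {s}) z → z ∈ adjoin k {s}) :
    ∃ t, IsGeneralElement k t ∧ s ∈ adjoin k {t} := by
  obtain ⟨p, hp⟩ := ExpChar.exists k
  obtain _ | ⟨hp'⟩ := hp
  · exact ⟨s, ⟨hs, relAlgClosed_adjoin_of_isSeparable h⟩, mem_adjoin_simple_self k s⟩
  have : Fact p.Prime := ⟨hp'⟩
  have : CharP (adjoin k {s}) p :=
    charP_of_injective_algebraMap (algebraMap k (adjoin k {s})).injective p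
  have hstr := transcendental_of_notMem_bot hs
  obtain ⟨n, hn⟩ := exists_forall_pow_mem_range (F := adjoin k {s}) hK.of_tower p
    fun z hz => ⟨⟨z, h z hz⟩, rfl⟩
  have hn' : ∀ z : K, IsAlgebraic (adjoin k {s}) z → z ^ p ^ n ∈ adjoin k {s} := fun z hz => by
    obtain ⟨y, hy⟩ := hn z hz
    exact hy ▸ y.2
  have halg : ∀ {r : K} {m : ℕ}, r ^ p ^ m = s → IsAlgebraic (adjoin k {s}) r := fun {r m} hr =>
    IsAlgebraic.of_pow (pow_pos hp'.pos m) (by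
      rw [hr]
      exact isAlgebraic_algebraMap (⟨s, mem_adjoin_simple_self k s⟩ : adjoin k {s}))
  have hbound : ∀ {r : K} {m : ℕ}, r ^ p ^ m = s → m ≤ n := fun {r m} hr => by
    by_contra! hm
    have h1 := exponent_eq_one_of_pow_eq hstr (hn' r (halg hr)) (e := p ^ (m - n)) (by
      rw [← pow_mul, ← pow_add, Nat.add_sub_cancel' hm.le, hr])
    exact (Nat.one_lt_pow (by omega) hp'.one_lt).ne' h1
  classical
  let m := Nat.findGreatest (fun m => ∃ r : K, r ^ p ^ m = s) n
  obtain ⟨r, hr⟩ : ∃ r : K, r ^ p ^ m = s :=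
    Nat.findGreatest_spec (P := fun m => ∃ r : K, r ^ p ^ m = s) (Nat.zero_le n) ⟨s, by simp⟩
  have hrp : ¬ ∃ x, x ^ p = r := by
    rintro ⟨x, rfl⟩
    rw [← pow_mul, ← pow_succ'] at hr
    exact absurd (Nat.le_findGreatest (P := fun m => ∃ r : K, r ^ p ^ m = s) (hbound hr) ⟨x, hr⟩)
      (by omega)
  have hsr : s ∈ adjoin k {r} := hr ▸ pow_mem (mem_adjoin_simple_self k r) _
  have hr0 : r ∉ (⊥ : IntermediateField k K) := fun hb => hs (hr ▸ pow_mem hb _)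
  have hle : adjoin k {s} ≤ adjoin k {r} := adjoin_simple_le_iff.mpr hsr
  refine ⟨r, ⟨hr0, fun z hz => ?_⟩, hsr⟩
  have hzs : z ∈ racl (adjoin k {s}) :=
    relAlgClosed_racl _ z (hz.mono_intermediateField (adjoin_simple_le_iff.mpr (mem_racl.mpr (halg
        hr))))
  have key : ∀ (j : ℕ) (z : K), z ^ p ^ j ∈ adjoin k {r} → z ∈ adjoin k {r} := fun j => by
    induction j with
    | zero => intro z hz; simpa using hz
    | succ j ih =>
      intro z hz
      rw [pow_succ, pow_mul] at hz
      exact ih z (mem_adjoin_of_pow_mem p (transcendental_of_notMem_bot hr0) hrp hz)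
  exact key n z (hle (hn' z (mem_racl.mp hzs)))

/-- Bertini: there is a general element outside any proper relatively algebraically closed
subextension of transcendence degree at least one. -/
theorem exists_isGeneralElement_notMem {k : Type u} {K : Type v} [Field k] [Field K] [Algebra k K]
    [IsAlgClosed k] (hK : IsFunctionField k K) {M : IntermediateField k K} (hM : RelAlgClosed M)
    {u v : K} (hv : v ∈ M) (hv0 : v ∉ (⊥ : IntermediateField k K)) (hu : u ∉ M) :
    ∃ t, IsGeneralElement k t ∧ t ∉ M := by
  have : Infinite k := IsAlgClosed.instInfinite
  obtain ⟨c, hc⟩ := exists_forall_isSeparable_mem_adjoin hK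
    (fun e he => mem_range_algebraMap_of_isAlgebraic he) (transcendental_of_notMem_bot hv0)
    (u := u) fun h => hu (hM u (h.mono_intermediateField (adjoin_simple_le_iff.mpr hv)))
  have hs : u + c • v ∉ M := fun h => hu (by
    have h1 := sub_mem h (IntermediateField.smul_mem _ hv (x := c))
    rwa [add_sub_cancel_right] at h1)
  obtain ⟨t, ht, hst⟩ := exists_isGeneralElement_of_isSeparable hK
    (fun h => hs ((bot_le : ⊥ ≤ M) h)) hc
  exact ⟨t, ht, fun h => hs (adjoin_simple_le_iff.mpr h hst)⟩

end GeneralElement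

section Existence
open IntermediateField Polynomial

lemma exists_algebraMap_eq_mul_pow_of_mem_adjoin {F E K : Type*} [Field F] [Field E] [Field K]
    [Algebra F E]
    [Algebra E K] [Algebra F K] [IsScalarTower F E K] {t b z : K} (ht : Transcendental E t)
    {a : E} (hb : b ∈ adjoin F {t}) (hz : z ∈ adjoin E {t}) {n : ℕ}
    (h : algebraMap E K a = b * z ^ n) : ∃ (c : F) (d : E), a = algebraMap F E c * d ^ n := by
  have htF : Transcendental F t := fun h => ht (h.extendScalars (algebraMap F E).injective)
  obtain ⟨r, s, -, hs, rfl⟩ := exists_coprime_of_mem_adjoin htF hb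
  obtain ⟨r', s', -, hs', rfl⟩ := exists_coprime_of_mem_adjoin ht hz
  refine ⟨r.leadingCoeff, r'.leadingCoeff, ?_⟩
  have hs0 : aeval t s ≠ 0 := fun h => hs.ne_zero (transcendental_iff.mp htF s h)
  have hs0' : aeval t s' ≠ 0 := fun h => hs'.ne_zero (transcendental_iff.mp ht s' h)
  have h1 : C a * s.map (algebraMap F E) * s' ^ n = r.map (algebraMap F E) * r' ^ n := by
    refine sub_eq_zero.mp (transcendental_iff.mp ht _ ?_)
    simp only [_root_.map_sub, _root_.map_mul, _root_.map_pow, aeval_map_algebraMap, aeval_C]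
    rw [sub_eq_zero, h, div_pow]
    field_simp
  have h2 := congrArg leadingCoeff h1
  simpa [leadingCoeff_mul, leadingCoeff_map, hs.leadingCoeff, hs'.leadingCoeff] using h2

lemma Omega_inf_Omega_racl_le {ℓ : ℕ} [Fact ℓ.Prime] {k K : Type*} [Field k] [Field K]
    [Algebra k K] [IsAlgClosed k] (hk : (ℓ : k) ≠ 0) (hK : IsFunctionField k K)
    {L L₁ : IntermediateField k K} (hL : RelAlgClosed L) (hle : L ≤ L₁) {y : K}
    (hy : Transcendental L₁ y)
    (hsep : ∀ z : K, IsSeparable (adjoin L₁ {y}) z → z ∈ adjoin L₁ {y}) :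
    Omega ℓ L₁ ⊓ Omega ℓ (racl (adjoin k (insert y (L : Set K)))) ≤ Omega ℓ L := by
  rintro α ⟨h₁, h₂⟩
  obtain ⟨a, rfl⟩ := QuotientGroup.mk'_surjective _ α
  obtain ⟨a₁, ha₁, z₁, e₁⟩ := (K1proj_mem_Omega_iff (ℓ := ℓ) (a := a)).mp h₁
  obtain ⟨b, hb, z₂, e₂⟩ := (K1proj_mem_Omega_iff (ℓ := ℓ) (a := a)).mp h₂
  refine (K1proj_mem_Omega_iff (ℓ := ℓ) (a := a)).mpr ?_
  let _ : Algebra L L₁ := (inclusion hle).toRingHom.toAlgebra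
  have : IsScalarTower L L₁ K := IsScalarTower.of_algebraMap_eq fun _ => rfl
  have : Infinite k := IsAlgClosed.instInfinite
  have : Infinite L := Infinite.of_injective _ (algebraMap k L).injective
  let p := ringExpChar k
  have : ExpChar (adjoin L₁ {y}) p := expChar_of_injective_algebraMap
    (algebraMap k (adjoin L₁ {y})).injective p
  have : IsScalarTower k (adjoin L₁ {y}) K := IsScalarTower.of_algebraMap_eq fun _ => rfl
  obtain ⟨n, hn⟩ := exists_forall_pow_mem_range (F := adjoin L₁ {y}) hK.of_tower p
    fun z hz => ⟨⟨z, hsep z hz⟩, rfl⟩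
  have hn' : ∀ z : K, IsAlgebraic (adjoin L₁ {y}) z → z ^ p ^ n ∈ adjoin L₁ {y} := fun z hz => by
    obtain ⟨w, hw⟩ := hn z hz
    exact hw ▸ w.2
  have hbL : IsAlgebraic (adjoin L {y}) (b : K) :=
    isAlgebraic_adjoin_insert_iff.mp (mem_racl.mp hb)
  have hbL₁ : IsAlgebraic (adjoin L₁ {y}) (b : K) := by
    refine isAlgebraic_adjoin_insert_iff.mp (mem_racl.mp (racl_mono ?_ hb))
    exact adjoin.mono _ _ _ (Set.insert_subset_insert hle)
  have ez : (a₁ : K) = b * ((z₂ / z₁ : Kˣ) : K) ^ ℓ := by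
    have h3 : a₁ = b * (z₂ / z₁) ^ ℓ := by
      rw [div_pow, ← mul_div_assoc, ← e₂, e₁, mul_div_cancel_right]
    exact_mod_cast congrArg Units.val h3
  have hz : IsAlgebraic (adjoin L₁ {y}) ((z₂ / z₁ : Kˣ) : K) := by
    refine IsAlgebraic.of_pow (Fact.out : ℓ.Prime).pos ?_
    rw [show ((z₂ / z₁ : Kˣ) : K) ^ ℓ = a₁ * (b : K)⁻¹ by rw [ez]; field_simp]
    refine IsAlgebraic.mul ?_ hbL₁.inv
    exact isAlgebraic_algebraMap (⟨a₁, (adjoin L₁ {y}).algebraMap_mem ⟨a₁, ha₁⟩⟩ : adjoin L₁ {y})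
  have hbq : (b : K) ^ p ^ n ∈ adjoin L {y} :=
    mem_adjoin_of_isAlgebraic_adjoin (E := L₁)
      (fun e he => ⟨⟨e, hL e (he.algebraMap (A := K))⟩, Subtype.ext rfl⟩) hy (hn' _ hbL₁) (hbL.pow
          _)
  obtain ⟨c, d, hcd⟩ := exists_algebraMap_eq_mul_pow_of_mem_adjoin (n := ℓ)
    hy (a := (⟨a₁, ha₁⟩ : L₁) ^ p ^ n) hbq (hn' _ hz) (by
      rw [_root_.map_pow, ← pow_mul, mul_comm (p ^ n), pow_mul, ← mul_pow, ← ez]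
      rfl)
  obtain ⟨l, hl, z, e⟩ := exists_eq_mul_pow_of_pow_coprime (L := L) (l := (c : K)) (z := (d : K))
    (coprime_expChar_pow (ℓ := ℓ) hk p n) (Fact.out : ℓ.Prime).one_lt c.2 a₁.ne_zero
    (congrArg Subtype.val hcd)
  have hl0 : l ≠ 0 := by
    rintro rfl
    exact a₁.ne_zero (by rw [e, zero_mul])
  have hz0 : z ≠ 0 := by
    rintro rfl
    exact a₁.ne_zero (by rw [e, zero_pow (Fact.out : ℓ.Prime).ne_zero, mul_zero])
  refine ⟨Units.mk0 l hl0, hl, Units.mk0 z hz0 * z₁, ?_⟩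
  rw [mul_pow, ← mul_assoc, e₁]
  congr 1
  exact Units.ext (by simpa using e)

theorem exists_configuration {ℓ : ℕ} [Fact ℓ.Prime] {k : Type u} {K : Type v} [Field k] [Field K]
    [Algebra k K] [IsAlgClosed k] (hk : (ℓ : k) ≠ 0) (hK : IsFunctionField k K)
    (htr : TrdegGe k K 4) {L : IntermediateField k K} (hL : RelAlgClosed L) (hd : HasTrdeg k L 1) :
    ∃ D B₁ B₂ E B₁' B₂' C : Subgroup (K1 ℓ K), IsRationalSubgroup ℓ k D ∧
      B₁ ∈ GSet ℓ k 2 ∧ B₂ ∈ GSet ℓ k 2 ∧ E ∈ GSet ℓ k 2 ∧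
      B₁' ∈ GSet ℓ k 3 ∧ B₂' ∈ GSet ℓ k 3 ∧ C ∈ GSet ℓ k 3 ∧
      (B₁ ≠ B₂ ∧ ¬ D ≤ C) ∧ (B₁ ≤ C ∧ B₂ ≤ C) ∧
      (B₁ ≤ B₁' ∧ D ≤ B₁' ∧ B₂ ≤ B₂' ∧ D ≤ B₂') ∧ E ≤ B₁' ⊓ B₂' ∧ Omega ℓ L = B₁ ⊓ B₂ := by
  let A := fun (N : IntermediateField k K) (t : K) => racl (adjoin k (insert t (N : Set K)))
  have hA : ∀ {N : IntermediateField k K} {t : K} {d : ℕ}, HasTrdeg k N d → RelAlgClosed N →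
      t ∉ N → HasTrdeg k (A N t) (d + 1) := fun h hN ht => h.racl_insert fun h' => ht (hN _ h')
  have hAr : ∀ {N t}, RelAlgClosed (A N t) := fun {N t} => relAlgClosed_racl _
  have hNA : ∀ {N t}, N ≤ A N t := fun {N t} z hz =>
    le_racl _ (subset_adjoin _ _ (Set.mem_insert_of_mem _ hz))
  have htA : ∀ {N t}, t ∈ A N t := fun {N t} =>
    le_racl _ (subset_adjoin _ _ (Set.mem_insert _ _))
  have hmono : ∀ {N N' t}, N ≤ N' → A N t ≤ A N' t := fun {N N' t} h =>
    racl_mono (adjoin.mono _ _ _ (Set.insert_subset_insert h))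
  obtain ⟨x, hx⟩ := TrdegGe.exists_notMem hd htr (by norm_num)
  let L₁ := A L x
  have hd₁ : HasTrdeg k L₁ 2 := hA hd hL hx
  obtain ⟨v, hv⟩ := TrdegGe.exists_notMem hd₁ htr (by norm_num)
  obtain ⟨u, hu⟩ := TrdegGe.exists_notMem (hA hd₁ hAr hv) htr (by norm_num)
  have : Infinite k := IsAlgClosed.instInfinite
  have : Infinite L₁ := Infinite.of_injective _ (algebraMap k L₁).injective
  obtain ⟨c, hc⟩ := exists_forall_isSeparable_mem_adjoin (F := L₁) hK.of_tower
    (fun e he => ⟨⟨e, hAr e he⟩, rfl⟩) (u := u) (v := v) (fun h => hv (hAr v h))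
    fun h => hu (mem_racl.mpr (isAlgebraic_adjoin_insert_iff.mpr h))
  let y := u + c • v
  have hy : y ∉ L₁ := fun h => hu (by
    have h1 : c • v ∈ A L₁ v := by
      rw [Algebra.smul_def]
      exact mul_mem (hNA c.2) htA
    have h2 := sub_mem (hNA (t := v) h) h1
    rwa [add_sub_cancel_right] at h2)
  have hyL : y ∉ L := fun h => hy (hNA h)
  let L₂ := A L y
  let M := A L₁ y
  have hd₂ : HasTrdeg k L₂ 2 := hA hd hL hyL
  have hdM : HasTrdeg k M 3 := hA hd₁ hAr hy
  have h₁M : L₁ ≤ M := hNA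
  have h₂M : L₂ ≤ M := hmono hNA
  obtain ⟨w, hw⟩ := TrdegGe.exists_notMem hdM htr (by norm_num)
  obtain ⟨t, ht, htM⟩ := exists_isGeneralElement_notMem hK hAr (v := y) (M := M) htA
    (fun h => hy ((bot_le : ⊥ ≤ L₁) h)) hw
  have hD : ∀ {N}, adjoin k {t} ≤ A N t := fun {N} => adjoin_simple_le_iff.mpr htA
  refine ⟨Omega ℓ (adjoin k {t}), Omega ℓ L₁, Omega ℓ L₂, Omega ℓ (A L t), Omega ℓ (A L₁ t),
    Omega ℓ (A L₂ t), Omega ℓ M, ⟨t, ht, rfl⟩, ⟨L₁, hAr, hd₁, rfl⟩, ⟨L₂, hAr, hd₂, rfl⟩,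
    ⟨_, hAr, hA hd hL fun h => htM (h₁M (hNA h)), rfl⟩,
    ⟨_, hAr, hA hd₁ hAr fun h => htM (h₁M h), rfl⟩,
    ⟨_, hAr, hA hd₂ hAr fun h => htM (h₂M h), rfl⟩, ⟨M, hAr, hdM, rfl⟩,
    ⟨fun h => hy (le_of_Omega_le hk hK hAr h.ge htA),
      fun h => htM (le_of_Omega_le hk hK hAr h (mem_adjoin_simple_self k t))⟩,
    ⟨Omega_mono h₁M, Omega_mono h₂M⟩,
    ⟨Omega_mono hNA, Omega_mono hD, Omega_mono hNA, Omega_mono hD⟩,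
    le_inf (Omega_mono (hmono hNA)) (Omega_mono (hmono hNA)), ?_⟩
  exact le_antisymm (le_inf (Omega_mono hNA) (Omega_mono hNA))
    (Omega_inf_Omega_racl_le hk hK hL hNA (fun h => hy (hAr y h)) hc)

end Existence

lemma natCast_ne_zero_of_ringChar_ne {k : Type*} [Field k] {ℓ : ℕ} (hℓ : ℓ.Prime)
    (h : ringChar k ≠ ℓ) : (ℓ : k) ≠ 0 := fun h0 =>
  (hℓ.eq_one_or_self_of_dvd _ (ringChar.dvd h0)).elim CharP.ringChar_ne_one h

theorem statement_7 (ℓ : ℕ) (hℓ : ℓ.Prime) (k K : Type*) [Field k] [Field K] [Algebra k K]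
    [IsAlgClosed k] (hchar : ringChar k ≠ ℓ) (hK : IsFunctionField k K)
    (htr : TrdegGe k K 4) (A : Subgroup (K1 ℓ K)) :
    A ∈ GSet ℓ k 1 ↔
      (A ∈ M1Set ℓ K ∧
        ∃ D B₁ B₂ E B₁' B₂' C : Subgroup (K1 ℓ K),
          IsRationalSubgroup ℓ k D ∧
          B₁ ∈ GSet ℓ k 2 ∧ B₂ ∈ GSet ℓ k 2 ∧ E ∈ GSet ℓ k 2 ∧
          B₁' ∈ GSet ℓ k 3 ∧ B₂' ∈ GSet ℓ k 3 ∧ C ∈ GSet ℓ k 3 ∧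
          (B₁ ≠ B₂ ∧ ¬ D ≤ C) ∧
          (B₁ ≤ C ∧ B₂ ≤ C) ∧
          (B₁ ≤ B₁' ∧ D ≤ B₁' ∧ B₂ ≤ B₂' ∧ D ≤ B₂') ∧
          E ≤ B₁' ⊓ B₂' ∧
          A = B₁ ⊓ B₂) := by
  have : Fact ℓ.Prime := ⟨hℓ⟩
  have hk := natCast_ne_zero_of_ringChar_ne hℓ hchar
  constructor
  · rintro ⟨L, hL, hd, rfl⟩
    exact ⟨Omega_mem_M1Set hk hK hL hd, exists_configuration hk hK htr hL hd⟩
  · rintro ⟨hA, D, B₁, B₂, E, B₁', B₂', C, hD, h₁, h₂, hE, h₁', h₂', hC, ⟨hne, hDC⟩, ⟨l₁, l₂⟩,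
      ⟨m₁, t₁, m₂, t₂⟩, f, hAB⟩
    exact mem_GSet_one_of_configuration hk hK hA hD h₁ h₂ hE h₁' h₂' hC hne hDC l₁ l₂ m₁ t₁ m₂ t₂
      f hAB

end
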